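/- arXiv:2009.07072 — 7 statements merged into one kernel-verified Lean document; each statement's English description precedes it below -/
import Mathlib

section
/- For every integer d ≥ 1, the hypercube graph Q_d is ⌊d/2⌋-linked. -/
/-- The hypercube graph `Q_d`: vertices are functions `Fin d → Bool`, two vertices
being adjacent iff they differ in exactly one coordinate. -/
def cubeGraph (d : ℕ) : SimpleGraph (Fin d → Bool) where
  Adj x y := hammingDist x y = 1
  symm := ⟨fun x y h => by rwa [hammingDist_comm]⟩
  loopless := ⟨fun x h => by simp [hammingDist_self] at h⟩

/-- A graph `G` is `k`-linked if it has at least `2k` vertices and, for every choice of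
`2k` distinct vertices `s 0, …, s (k-1), t 0, …, t (k-1)`, there exist `k` pairwise
vertex-disjoint paths, the `i`-th joining `s i` to `t i`. -/
def IsLinked {V : Type*} (G : SimpleGraph V) (k : ℕ) : Prop :=
  2 * k ≤ Nat.card V ∧
    ∀ s t : Fin k → V, Function.Injective (Sum.elim s t) →
      ∃ P : (i : Fin k) → G.Walk (s i) (t i),
        (∀ i, (P i).IsPath) ∧
        ∀ i j, i ≠ j → ∀ v, v ∈ (P i).support → v ∉ (P j).support


open Function Finset

/-- `u` and `v` are joined by a walk of `G` all of whose vertices lie in `S`. -/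
def ReachIn {V : Type*} (G : SimpleGraph V) (S : Set V) (u v : V) : Prop :=
  ∃ p : G.Walk u v, ∀ x ∈ p.support, x ∈ S

namespace ReachIn

variable {V : Type*} {G : SimpleGraph V} {S T : Set V} {u v w : V}

theorem refl (hu : u ∈ S) : ReachIn G S u u :=
  ⟨.nil, by simpa using hu⟩

theorem of_adj (h : G.Adj u v) (hu : u ∈ S) (hv : v ∈ S) : ReachIn G S u v :=
  ⟨h.toWalk, by simp [hu, hv]⟩

theorem symm (h : ReachIn G S u v) : ReachIn G S v u := by
  obtain ⟨p, hp⟩ := h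
  exact ⟨p.reverse, by simpa using hp⟩

theorem trans (h : ReachIn G S u v) (h' : ReachIn G S v w) : ReachIn G S u w := by
  obtain ⟨p, hp⟩ := h
  obtain ⟨q, hq⟩ := h'
  refine ⟨p.append q, fun x hx => ?_⟩
  rcases (SimpleGraph.Walk.mem_support_append_iff _ _).mp hx with hx | hx
  exacts [hp x hx, hq x hx]

theorem mono (hST : S ⊆ T) (h : ReachIn G S u v) : ReachIn G T u v := by
  obtain ⟨p, hp⟩ := h
  exact ⟨p, fun x hx => hST (hp x hx)⟩

theorem left_mem (h : ReachIn G S u v) : u ∈ S := by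
  obtain ⟨p, hp⟩ := h
  exact hp _ p.start_mem_support

theorem right_mem (h : ReachIn G S u v) : v ∈ S := h.symm.left_mem

end ReachIn

namespace Cube

variable {d : ℕ}

theorem adj_update (x : Fin d → Bool) (e : Fin d) {b : Bool} (h : x e ≠ b) :
    (cubeGraph d).Adj x (update x e b) := by
  change hammingDist x (update x e b) = 1
  rw [hammingDist, Finset.card_eq_one]
  refine ⟨e, ?_⟩
  ext i
  by_cases hi : i = e
  · subst hi; simpa using h
  · simp [hi]

theorem reachIn_update {S : Set (Fin d → Bool)} {x : Fin d → Bool} {e : Fin d} {b : Bool}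
    (hx : x ∈ S) (hy : update x e b ∈ S) : ReachIn (cubeGraph d) S x (update x e b) := by
  by_cases h : x e = b
  · rw [← h, update_eq_self]
    exact .refl hx
  · exact .of_adj (adj_update x e h) hx hy

/-- If every direction of `D` contains an edge spanned by the nonempty set `X` of vertices of the
cube, then `D` has fewer elements than `X` (Bondy's theorem). -/
theorem card_lt_of_forall_not_injOn (D : Finset (Fin d)) (X : Finset (Fin d → Bool))
    (hX : X.Nonempty)
    (h : ∀ e ∈ D, ¬ Set.InjOn (fun x : Fin d → Bool => update x e false) X) :
    #D < #X := by
  induction D using Finset.induction_on generalizing X with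
  | empty => simpa using hX
  | insert e D he ih =>
    have hlt : #(X.image fun x => update x e false) < #X := by
      refine lt_of_le_of_ne card_image_le fun hc => ?_
      exact h e (mem_insert_self _ _) (card_image_iff.mp hc)
    have hD := ih (X.image fun x => update x e false) (hX.image _) fun e' he' hinj => by
      refine h e' (mem_insert_of_mem he') fun x hx y hy hxy => ?_
      have hne : e ≠ e' := fun hh => he (hh ▸ he')
      have hp : update x e false = update y e false := by
        apply hinj (by simpa using ⟨x, hx, rfl⟩) (by simpa using ⟨y, hy, rfl⟩)
        simp only at hxy ⊢
        rw [update_comm hne, update_comm hne, hxy]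
      funext i
      by_cases hi : i = e
      · simpa [hi, hne] using congrFun hxy e
      · simpa [hi] using congrFun hp i
    rw [card_insert_of_notMem he]
    omega

/-- The face of the cube through `z` whose free coordinates are those in `D`. -/
def face (D : Finset (Fin d)) (z : Fin d → Bool) : Set (Fin d → Bool) :=
  {y | ∀ i ∉ D, y i = z i}

theorem mem_face_erase {D : Finset (Fin d)} {z y : Fin d → Bool} {e : Fin d} (he : e ∈ D)
    {b : Bool} : y ∈ face (D.erase e) (update z e b) ↔ y ∈ face D z ∧ y e = b := by
  constructor
  · intro h
    refine ⟨fun i hi => ?_, ?_⟩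
    · have hne : i ≠ e := fun hh => hi (hh ▸ he)
      simpa [hne] using h i (by simp [hi])
    · simpa using h e (by simp)
  · rintro ⟨h, hb⟩ i hi
    by_cases hie : i = e
    · subst hie; simpa using hb
    · simpa [hie] using h i fun hD => hi (by simp [hie, hD])

theorem update_mem_face {D : Finset (Fin d)} {z y : Fin d → Bool} {e : Fin d} (he : e ∈ D)
    (b : Bool) (hy : y ∈ face D z) : update y e b ∈ face D z := by
  intro i hi
  have hne : i ≠ e := fun hh => hi (hh ▸ he)
  simpa [hne] using hy i hi

theorem update_mem_face_erase {D : Finset (Fin d)} {z y : Fin d → Bool} {e : Fin d} (he : e ∈ D)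
    (b : Bool) (hy : y ∈ face D z) : update y e b ∈ face (D.erase e) (update z e b) :=
  (mem_face_erase he).mpr ⟨update_mem_face he b hy, by simp⟩

/-- A face of dimension `n` stays connected after deleting fewer than `n` vertices. -/
theorem reachIn_face_diff (D : Finset (Fin d)) (z : Fin d → Bool) (F : Finset (Fin d → Bool))
    (hF : F = ∅ ∨ #F < #D) {u v : Fin d → Bool} (hu : u ∈ face D z \ F) (hv : v ∈ face D z \ F) :
    ReachIn (cubeGraph d) (face D z \ F) u v := by
  induction hn : #D generalizing D z F u v with
  | zero =>
    obtain rfl := card_eq_zero.mp hn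
    have huv : u = v := funext fun i => by rw [hu.1 i (by simp), hv.1 i (by simp)]
    exact huv ▸ .refl hu
  | succ n ih =>
    obtain ⟨e, he⟩ : D.Nonempty := card_pos.mp (by omega)
    have hcard : #(D.erase e) = n := by rw [card_erase_of_mem he]; omega
    have half (b : Bool) (hb : #{x ∈ F | x e = b} = 0 ∨ #{x ∈ F | x e = b} < n)
        {x y : Fin d → Bool} (hx : x ∈ face D z \ F) (hy : y ∈ face D z \ F)
        (hxb : x e = b) (hyb : y e = b) : ReachIn (cubeGraph d) (face D z \ F) x y := by
      refine (ih (D.erase e) (update z e b) {x ∈ F | x e = b} ?_ ?_ ?_ hcard).mono ?_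
      · rwa [hcard, ← card_eq_zero]
      · exact ⟨(mem_face_erase he).mpr ⟨hx.1, hxb⟩, fun h => hx.2 (mem_filter.mp h).1⟩
      · exact ⟨(mem_face_erase he).mpr ⟨hy.1, hyb⟩, fun h => hy.2 (mem_filter.mp h).1⟩
      · rintro w ⟨hw, hwF⟩
        rw [mem_face_erase he] at hw
        exact ⟨hw.1, fun h => hwF (by simpa using ⟨h, hw.2⟩)⟩
    by_cases hempty : ∃ b, #{x ∈ F | x e = b} = 0
    · obtain ⟨b, hb⟩ := hempty
      have hproj {x : Fin d → Bool} (hx : x ∈ face D z \ F) : update x e b ∈ face D z \ F := by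
        refine ⟨update_mem_face he b hx.1, fun h => ?_⟩
        have := filter_eq_empty_iff.mp (card_eq_zero.mp hb) h
        simp at this
      exact ((reachIn_update hu (hproj hu)).trans
        (half b (.inl hb) (hproj hu) (hproj hv) (by simp) (by simp))).trans
        (reachIn_update hv (hproj hv)).symm
    · push Not at hempty
      have hFn : #F < n + 1 := by
        rcases hF with rfl | hF
        · simp at hempty
        · omega
      have hsum : #{x ∈ F | x e = true} + #{x ∈ F | x e = false} = #F := by
        simpa using card_filter_add_card_filter_not (s := F) (fun x => x e = true)
      have hlt (b : Bool) : #{x ∈ F | x e = b} < n := by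
        have h1 := hempty true
        have h2 := hempty false
        cases b <;> omega
      -- some column through `u` or a neighbour of `u` avoids `F`
      let g : Fin d → Fin d → Bool := fun i => update (update u i (!u i)) e (u e)
      have hg : Set.InjOn g D := by
        intro i _ j _ hij
        by_contra hne
        have hi := congrFun hij i
        have hj := congrFun hij j
        by_cases hie : i = e
        · subst hie
          simp [g, Ne.symm hne] at hj
        · simp [g, hie, hne] at hi
      obtain ⟨y, hy, hyF⟩ : ∃ y ∈ D.image g, y ∉ F.image fun x => update x e (u e) := by
        apply exists_mem_notMem_of_card_lt_card
        rw [card_image_of_injOn hg, hn]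
        exact card_image_le.trans_lt hFn
      have hye : y e = u e := by
        obtain ⟨i, -, rfl⟩ := mem_image.mp hy
        simp [g]
      have hyface : y ∈ face D z := by
        obtain ⟨i, hi, rfl⟩ := mem_image.mp hy
        exact update_mem_face he _ (update_mem_face hi _ hu.1)
      have hfree (b : Bool) : update y e b ∈ face D z \ F := by
        refine ⟨update_mem_face he b hyface, fun h => hyF (mem_image.mpr ⟨_, h, ?_⟩)⟩
        simp [← hye]
      have hy' : y ∈ face D z \ F := by simpa using hfree (y e)
      exact ((half (u e) (.inr (hlt _)) hu hy' rfl hye).trans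
        (reachIn_update hy' (hfree (v e)))).trans
        (half (v e) (.inr (hlt _)) (hfree (v e)) hv (by simp) rfl)

section Linkage

variable {κ : Type*} {D : Finset (Fin d)} {z : Fin d → Bool} {K : Finset κ}
  {p : κ → Bool → Fin d → Bool} {F : Finset (Fin d → Bool)}

/-- The set of endpoints of the pairs `p i`, `i ∈ K`. -/
def terminals (K : Finset κ) (p : κ → Bool → Fin d → Bool) : Finset (Fin d → Bool) :=
  (K ×ˢ univ).image fun q => p q.1 q.2

theorem mem_terminals {x : Fin d → Bool} : x ∈ terminals K p ↔ ∃ i ∈ K, ∃ a, p i a = x := by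
  simp only [terminals, mem_image, mem_product, mem_univ, and_true, Prod.exists]
  tauto

/-- The pairs `p i`, `i ∈ K`, consist of distinct vertices of the face outside `F`, and `F` lies in
the face. -/
structure Admissible (D : Finset (Fin d)) (z : Fin d → Bool) (K : Finset κ)
    (p : κ → Bool → Fin d → Bool) (F : Finset (Fin d → Bool)) : Prop where
  mem_face : ∀ i ∈ K, ∀ a, p i a ∈ face D z
  subset_face : ∀ x ∈ F, x ∈ face D z
  notMem : ∀ i ∈ K, ∀ a, p i a ∉ F
  inj : ∀ i ∈ K, ∀ j ∈ K, ∀ a b, p i a = p j b → i = j ∧ a = b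

/-- The pairs `p i`, `i ∈ K`, can be joined inside the face by disjoint walks avoiding `F`. -/
def Linkable (D : Finset (Fin d)) (z : Fin d → Bool) (K : Finset κ)
    (p : κ → Bool → Fin d → Bool) (F : Finset (Fin d → Bool)) : Prop :=
  ∃ S : κ → Set (Fin d → Bool),
    (∀ i ∈ K, ReachIn (cubeGraph d) (S i) (p i false) (p i true)) ∧
    (∀ i ∈ K, S i ⊆ face D z \ F) ∧ (K : Set κ).PairwiseDisjoint S

theorem mem_of_reachIn_pair {S : Set (Fin d → Bool)} {q : Bool → Fin d → Bool}
    (h : ReachIn (cubeGraph d) S (q false) (q true)) (a : Bool) : q a ∈ S := by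
  cases a
  exacts [h.left_mem, h.right_mem]

theorem Admissible.mono {K' : Finset κ} (h : Admissible D z K p F) (hK : K' ⊆ K) :
    Admissible D z K' p F :=
  ⟨fun i hi => h.mem_face i (hK hi), h.subset_face, fun i hi => h.notMem i (hK hi),
    fun i hi j hj => h.inj i (hK hi) j (hK hj)⟩

theorem Admissible.card_terminals (h : Admissible D z K p F) : #(terminals K p) = 2 * #K := by
  rw [terminals, card_image_of_injOn, card_product, card_univ, Fintype.card_bool, mul_comm]
  rintro ⟨i, a⟩ hi ⟨j, b⟩ hj hij
  simp only [coe_product, Set.mem_prod, mem_coe] at hi hj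
  obtain ⟨rfl, rfl⟩ := h.inj i hi.1 j hj.1 a b hij
  rfl

theorem Admissible.disjoint (h : Admissible D z K p F) : Disjoint (terminals K p) F := by
  rw [disjoint_left]
  intro x hx
  obtain ⟨i, hi, a, rfl⟩ := mem_terminals.mp hx
  exact h.notMem i hi a

theorem Admissible.card_union (h : Admissible D z K p F) :
    #(terminals K p ∪ F) = 2 * #K + #F := by
  rw [card_union_of_disjoint h.disjoint, h.card_terminals]

theorem Admissible.linkable_singleton {i : κ} (h : Admissible D z {i} p F) (hF : #F < #D) :
    Linkable D z {i} p F := by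
  have hmem (a : Bool) : p i a ∈ face D z \ F :=
    ⟨h.mem_face i (by simp) a, h.notMem i (by simp) a⟩
  refine ⟨fun _ => face D z \ F, ?_, fun _ _ => subset_rfl, by simp⟩
  intro j hj
  obtain rfl := mem_singleton.mp hj
  exact reachIn_face_diff D z F (.inr hF) (hmem _) (hmem _)

/-- The pairs moved along direction `e` into the half with `e`-th coordinate `b`. -/
def shift (e : Fin d) (b : Bool) (p : κ → Bool → Fin d → Bool) : κ → Bool → Fin d → Bool :=
  fun i a => update (p i a) e b

/-- The vertices in the half with `e`-th coordinate `b` to be avoided by the pairs that are routed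
there, when `r i` tells in which half the pair `p i` is routed. -/
def obstacles (e : Fin d) (r : κ → Bool) (K : Finset κ) (p : κ → Bool → Fin d → Bool)
    (F : Finset (Fin d → Bool)) (b : Bool) : Finset (Fin d → Bool) :=
  {x ∈ terminals K p ∪ F | x e = b} \ terminals {i ∈ K | r i = b} p

theorem Admissible.shift {e : Fin d} (h : Admissible D z K p F) (he : e ∈ D) (b : Bool)
    (hinj : Set.InjOn (fun x : Fin d → Bool => update x e b) (terminals K p ∪ F : Finset _))
    (r : κ → Bool) :
    Admissible (D.erase e) (update z e b) {i ∈ K | r i = b} (shift e b p)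
      (obstacles e r K p F b) where
  mem_face i hi a := update_mem_face_erase he b (h.mem_face i (mem_filter.mp hi).1 a)
  subset_face x hx := by
    obtain ⟨hx, hxb⟩ := mem_filter.mp (mem_sdiff.mp hx).1
    refine (mem_face_erase he).mpr ⟨?_, hxb⟩
    rcases mem_union.mp hx with hx | hx
    · obtain ⟨i, hi, a, rfl⟩ := mem_terminals.mp hx
      exact h.mem_face i hi a
    · exact h.subset_face x hx
  notMem i hi a hmem := by
    obtain ⟨hx, hxt⟩ := mem_sdiff.mp hmem
    have hiK := (mem_filter.mp hi).1
    have heq : Cube.shift e b p i a = p i a :=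
      hinj (mem_filter.mp hx).1 (mem_union_left _ (mem_terminals.mpr ⟨i, hiK, a, rfl⟩))
        (by simp [Cube.shift])
    exact hxt (mem_terminals.mpr ⟨i, hi, a, heq.symm⟩)
  inj i hi j hj a c hac := by
    have hi := (mem_filter.mp hi).1
    have hj := (mem_filter.mp hj).1
    exact h.inj i hi j hj a c (hinj (mem_union_left _ (mem_terminals.mpr ⟨i, hi, a, rfl⟩))
      (mem_union_left _ (mem_terminals.mpr ⟨j, hj, c, rfl⟩)) hac)

theorem terminals_union_obstacles_subset (e : Fin d) (r : κ → Bool) (b : Bool) :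
    terminals {i ∈ K | r i = b} p ∪ obstacles e r K p F b ⊆ terminals K p ∪ F := by
  refine union_subset (fun y hy => ?_) (sdiff_subset.trans (filter_subset _ _))
  obtain ⟨i, hi, a, rfl⟩ := mem_terminals.mp hy
  exact mem_union_left _ (mem_terminals.mpr ⟨i, (mem_filter.mp hi).1, a, rfl⟩)

theorem Admissible.card_terminals_union_obstacles (h : Admissible D z K p F) (e : Fin d)
    (r : κ → Bool) (b : Bool) :
    #(terminals {i ∈ K | r i = b} p ∪ obstacles e r K p F b) =
      2 * #{i ∈ K | r i = b} + #(obstacles e r K p F b) := by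
  rw [card_union_of_disjoint (by exact disjoint_sdiff),
    (h.mono (filter_subset (fun i => r i = b) K)).card_terminals]

theorem Admissible.card_obstacles_le (h : Admissible D z K p F) (e : Fin d) (r : κ → Bool)
    (b : Bool) : 2 * #{i ∈ K | r i = b} + #(obstacles e r K p F b) ≤ 2 * #K + #F := by
  rw [← h.card_terminals_union_obstacles, ← h.card_union]
  exact card_le_card (terminals_union_obstacles_subset e r b)

theorem Admissible.card_obstacles_lt (h : Admissible D z K p F) (e : Fin d) (r : κ → Bool)
    (b : Bool) {x : Fin d → Bool} (hx : x ∈ terminals K p ∪ F) (hxe : x e ≠ b)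
    (hxt : x ∉ terminals {i ∈ K | r i = b} p) :
    2 * #{i ∈ K | r i = b} + #(obstacles e r K p F b) < 2 * #K + #F := by
  rw [← h.card_terminals_union_obstacles, ← h.card_union]
  refine card_lt_card
    ((ssubset_iff_of_subset (terminals_union_obstacles_subset e r b)).mpr ⟨x, hx, ?_⟩)
  simp only [mem_union, not_or]
  exact ⟨hxt, fun hxo => hxe (mem_filter.mp (mem_sdiff.mp hxo).1).2⟩

/-- Linkages of the two halves combine to a linkage of the face. -/
theorem Admissible.linkable_of_halves {e : Fin d} (h : Admissible D z K p F) (he : e ∈ D)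
    (r : κ → Bool)
    (hlink : ∀ b, Linkable (D.erase e) (update z e b) {i ∈ K | r i = b} (Cube.shift e b p)
      (obstacles e r K p F b)) : Linkable D z K p F := by
  choose S hS hface hdisj using hlink
  have hface' {i : κ} (hi : i ∈ K) {y : Fin d → Bool} (hy : y ∈ S (r i) i) :
      y ∈ face D z ∧ y e = r i ∧ y ∉ obstacles e r K p F (r i) := by
    have := hface (r i) i (by simp [hi]) hy
    rw [Set.mem_sdiff, mem_face_erase he] at this
    exact ⟨this.1.1, this.1.2, this.2⟩
  have hshift {i : κ} (hi : i ∈ K) (a : Bool) : update (p i a) e (r i) ∈ S (r i) i :=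
    mem_of_reachIn_pair (q := Cube.shift e (r i) p i) (hS (r i) i (by simp [hi])) a
  have hSS {i j : κ} (hi : i ∈ K) (hj : j ∈ K) (hij : i ≠ j) {y : Fin d → Bool}
      (hyi : y ∈ S (r i) i) (hyj : y ∈ S (r j) j) : False := by
    have hr : r i = r j := (hface' hi hyi).2.1.symm.trans (hface' hj hyj).2.1
    have hd := hdisj (r j) (x := i) (by simp [hi, hr]) (y := j) (by simp [hj]) hij
    exact Set.disjoint_left.mp hd (hr ▸ hyi) hyj
  have hSp {i j : κ} (hi : i ∈ K) (hj : j ∈ K) (hij : i ≠ j) (a : Bool)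
      (hy : p j a ∈ S (r i) i) : False := by
    obtain ⟨-, hye, hyo⟩ := hface' hi hy
    by_cases hr : r j = r i
    · refine hSS hi hj hij hy ?_
      have := hshift hj a
      rwa [hr, ← hye, update_eq_self, hye, ← hr] at this
    · refine hyo (mem_sdiff.mpr ⟨mem_filter.mpr
        ⟨mem_union_left _ (mem_terminals.mpr ⟨j, hj, a, rfl⟩), hye⟩, fun ht => ?_⟩)
      obtain ⟨k, hk, c, hkc⟩ := mem_terminals.mp ht
      obtain ⟨hk, hkr⟩ := mem_filter.mp hk
      obtain ⟨rfl, -⟩ := h.inj k hk j hj c a hkc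
      exact hr hkr
  refine ⟨fun i => S (r i) i ∪ Set.range (p i), fun i hi => ?_, fun i hi y hy => ?_, ?_⟩
  · have hstep (a : Bool) : ReachIn (cubeGraph d) (S (r i) i ∪ Set.range (p i)) (p i a)
        (update (p i a) e (r i)) :=
      reachIn_update (.inr ⟨a, rfl⟩) (.inl (hshift hi a))
    exact ((hstep false).trans ((hS (r i) i (by simp [hi])).mono Set.subset_union_left)).trans
      (hstep true).symm
  · rcases hy with hy | ⟨a, rfl⟩
    · obtain ⟨hyf, hye, hyo⟩ := hface' hi hy
      refine ⟨hyf, fun hyF => hyo (mem_sdiff.mpr ⟨mem_filter.mpr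
        ⟨mem_union_right _ hyF, hye⟩, fun ht => ?_⟩)⟩
      obtain ⟨k, hk, c, rfl⟩ := mem_terminals.mp ht
      exact h.notMem k (mem_filter.mp hk).1 c hyF
    · exact ⟨h.mem_face i hi a, h.notMem i hi a⟩
  · intro i hi j hj hij
    refine Set.disjoint_left.mpr ?_
    rintro y (hy | ⟨a, rfl⟩) (hy' | ⟨c, hc⟩)
    · exact hSS hi hj hij hy hy'
    · exact hSp hi hj hij c (hc ▸ hy)
    · exact hSp hj hi hij.symm a hy'
    · exact hij (h.inj i hi j hj a c hc.symm).1

theorem injOn_update {e : Fin d} {X : Finset (Fin d → Bool)} {b : Bool}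
    (h : Set.InjOn (fun x : Fin d → Bool => update x e false) X) :
    Set.InjOn (fun x : Fin d → Bool => update x e b) X := by
  intro x hx y hy hxy
  apply h hx hy
  simpa using congrArg (fun w => update w e false) hxy

/-- If a direction separates a set containing two pairs, then it separates two vertices of the set
that do not form a pair. -/
theorem Admissible.exists_separated (h : Admissible D z K p F) (hK : 1 < #K) {e : Fin d}
    {x y : Fin d → Bool} (hx : x ∈ terminals K p ∪ F) (hy : y ∈ terminals K p ∪ F)
    (hxe : x e = false) (hye : y e = true) :
    ∃ x ∈ terminals K p ∪ F, ∃ y ∈ terminals K p ∪ F, x e = false ∧ y e = true ∧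
      ∀ i ∈ K, ∀ a c, p i a = x → p i c ≠ y := by
  by_cases hmate : ∃ i ∈ K, ∃ a c, p i a = x ∧ p i c = y
  · obtain ⟨i, hi, a, c, hax, hcy⟩ := hmate
    obtain ⟨j, hj, hji⟩ := exists_mem_ne hK i
    have hjmem : p j false ∈ terminals K p ∪ F :=
      mem_union_left _ (mem_terminals.mpr ⟨j, hj, false, rfl⟩)
    have key {k : κ} (hk : k ∈ K) {u v w : Bool} (hu : p k u = p i v) (hw : p k w = p j false) :
        False := by
      have h1 := (h.inj k hk i hi _ _ hu).1
      have h2 := (h.inj k hk j hj _ _ hw).1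
      exact hji (h2.symm.trans h1)
    cases hje : p j false e
    · exact ⟨_, hjmem, y, hy, hje, hye, fun k hk u v hu hv => key hk (hv.trans hcy.symm) hu⟩
    · exact ⟨x, hx, _, hjmem, hxe, hje, fun k hk u v hu hv => key hk (hu.trans hax.symm) hv⟩
  · exact ⟨x, hx, y, hy, hxe, hye, fun i hi a c ha hc => hmate ⟨i, hi, a, c, ha, hc⟩⟩

theorem Admissible.linkable (h : Admissible D z K p F) (hcard : 2 * #K + #F ≤ #D) :
    Linkable D z K p F := by
  classical
  induction hn : #D generalizing D z K p F with
  | zero =>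
    obtain rfl : K = ∅ := card_eq_zero.mp (by omega)
    exact ⟨fun _ => ∅, by simp, by simp, by simp⟩
  | succ n ih =>
    rcases Nat.lt_or_ge 1 #K with hK | hK
    · obtain ⟨e, he, hinj⟩ : ∃ e ∈ D,
          Set.InjOn (fun x : Fin d → Bool => update x e false) (terminals K p ∪ F : Finset _) := by
        by_contra! hcon
        have hlt := card_lt_of_forall_not_injOn D _ (card_pos.mp (by rw [h.card_union]; omega)) hcon
        rw [h.card_union] at hlt
        omega
      have hD : #(D.erase e) = n := by rw [card_erase_of_mem he]; omega
      have hadm (b : Bool) (r : κ → Bool) := h.shift he b (injOn_update hinj) r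
      have hhalf (b : Bool) (r : κ → Bool) {x : Fin d → Bool} (hx : x ∈ terminals K p ∪ F)
          (hxe : x e ≠ b) (hxt : x ∉ terminals {i ∈ K | r i = b} p) :
          Linkable (D.erase e) (update z e b) {i ∈ K | r i = b} (Cube.shift e b p)
            (obstacles e r K p F b) := by
        refine ih (hadm b r) ?_ hD
        have := h.card_obstacles_lt e r b hx hxe hxt
        omega
      by_cases hsep : ∃ x ∈ terminals K p ∪ F, ∃ y ∈ terminals K p ∪ F, x e = false ∧ y e = true
      · obtain ⟨x, hx, y, hy, hxe, hye⟩ := hsep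
        obtain ⟨x, hx, y, hy, hxe, hye, hxy⟩ := h.exists_separated hK hx hy hxe hye
        refine h.linkable_of_halves he (fun i => decide (∃ c, p i c = y)) fun b => ?_
        cases b
        · refine hhalf _ _ hy (by simp [hye]) fun ht => ?_
          obtain ⟨i, hi, a, ha⟩ := mem_terminals.mp ht
          exact of_decide_eq_false (mem_filter.mp hi).2 ⟨a, ha⟩
        · refine hhalf _ _ hx (by simp [hxe]) fun ht => ?_
          obtain ⟨i, hi, a, ha⟩ := mem_terminals.mp ht
          obtain ⟨hi, hir⟩ := mem_filter.mp hi
          obtain ⟨c, hc⟩ := of_decide_eq_true hir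
          exact hxy i hi a c ha hc
      · obtain ⟨i, hi⟩ : K.Nonempty := card_pos.mp (by omega)
        have hmem : p i false ∈ terminals K p ∪ F :=
          mem_union_left _ (mem_terminals.mpr ⟨i, hi, false, rfl⟩)
        set b₀ := p i false e
        refine h.linkable_of_halves he (fun j => if j = i then b₀ else !b₀) fun b => ?_
        by_cases hb : b = b₀
        · have hKi : ({j ∈ K | (if j = i then b₀ else !b₀) = b} : Finset κ) = {i} := by
            ext j
            by_cases hj : j = i <;> simp [hj, hi, hb]
          have ha := hadm b fun j => if j = i then b₀ else !b₀
          have hle := h.card_obstacles_le e (fun j => if j = i then b₀ else !b₀) b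
          rw [hKi, card_singleton] at hle
          rw [hKi] at ha ⊢
          exact ha.linkable_singleton (by omega)
        · refine hhalf _ _ hmem (Ne.symm hb) fun ht => ?_
          obtain ⟨j, hj, a, ha⟩ := mem_terminals.mp ht
          obtain ⟨hj, hjr⟩ := mem_filter.mp hj
          obtain ⟨rfl, -⟩ := h.inj j hj i hi a false ha
          simp at hjr
          exact hb hjr.symm
    · rcases Nat.lt_or_ge 0 #K with hK' | hK'
      · obtain ⟨i, rfl⟩ := card_eq_one.mp (by omega : #K = 1)
        rw [card_singleton] at hcard
        exact h.linkable_singleton (by omega)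
      · obtain rfl : K = ∅ := card_eq_zero.mp (by omega)
        exact ⟨fun _ => ∅, by simp, by simp, by simp⟩

end Linkage

end Cube

theorem cube_half_linked (d : ℕ) (hd : 1 ≤ d) :
    IsLinked (cubeGraph d) (d / 2) := by
  classical
  refine ⟨?_, fun s t hst => ?_⟩
  · have := Nat.lt_two_pow_self (n := d)
    rw [Nat.card_eq_fintype_card, Fintype.card_fun, Fintype.card_bool, Fintype.card_fin]
    omega
  · have hadm : Cube.Admissible univ (fun _ => false) univ (fun i a => if a then t i else s i)
        (∅ : Finset (Fin d → Bool)) := by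
      refine ⟨fun _ _ _ i hi => absurd (mem_univ i) hi, by simp, by simp, ?_⟩
      intro i _ j _ a b hab
      have := @hst (if a then .inr i else .inl i) (if b then .inr j else .inl j)
        (by cases a <;> cases b <;> simpa using hab)
      cases a <;> cases b <;> simp_all
    obtain ⟨S, hS, -, hdisj⟩ := hadm.linkable (by simp; omega)
    choose P hP using fun i => hS i (mem_univ i)
    refine ⟨fun i => (P i).bypass, fun i => (P i).bypass_isPath, fun i j hij v hvi hvj => ?_⟩
    exact Set.disjoint_left.mp (hdisj (mem_coe.mpr (mem_univ i)) (mem_coe.mpr (mem_univ j)) hij)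
      (hP i v ((P i).support_bypass_subset_support hvi))
      (hP j v ((P j).support_bypass_subset_support hvj))
end

section
/- Let d ≥ 1 and let Z be a nonempty finite set of vertices of the hypercube Q_d (i.e., a nonempty set of 0/1-vectors of length d). Then the number of coordinates i ∈ Fin d for which there exists some z ∈ Z whose flip in coordinate i also belongs to Z is at most |Z| − 1. -/
/-- The embedding of the vertices of the cube as 0/1-vectors in `ℚ ^ d`. -/
def cubeVector {d : ℕ} (z : Fin d → Bool) : Fin d → ℚ := fun i => if z i then 1 else 0

theorem cubeVector_update_sub {d : ℕ} (z : Fin d → Bool) (i : Fin d) :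
    cubeVector (Function.update z i (!(z i))) - cubeVector z =
      Pi.single i (if z i then (-1 : ℚ) else 1) := by
  ext j
  by_cases hj : j = i
  · subst hj
    cases h : z j <;> simp [cubeVector, h]
  · simp [cubeVector, hj]

theorem single_one_mem_vectorSpan {d : ℕ} {Z : Finset (Fin d → Bool)} {z : Fin d → Bool}
    {i : Fin d} (hz : z ∈ Z) (hf : Function.update z i (!(z i)) ∈ Z) :
    (Pi.single i 1 : Fin d → ℚ) ∈ vectorSpan ℚ (Z.image cubeVector : Set (Fin d → ℚ)) := by
  have h := vsub_mem_vectorSpan ℚ (s := (Z.image cubeVector : Set (Fin d → ℚ)))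
    (Finset.mem_coe.2 (Finset.mem_image_of_mem cubeVector hf))
    (Finset.mem_coe.2 (Finset.mem_image_of_mem cubeVector hz))
  rw [vsub_eq_sub, cubeVector_update_sub] at h
  cases hzi : z i
  · simpa [hzi] using h
  · simpa [hzi, Pi.single_neg] using h

theorem directions_bound (d : ℕ) (hd : 1 ≤ d) (Z : Finset (Fin d → Bool))
    (hZ : Z.Nonempty) :
    {i : Fin d | ∃ z ∈ Z, Function.update z i (!(z i)) ∈ Z}.ncard ≤ Z.card - 1 := by
  classical
  set S := {i : Fin d | ∃ z ∈ Z, Function.update z i (!(z i)) ∈ Z}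
  have hli : LinearIndependent ℚ (fun i : S => (Pi.single i.1 1 : Fin d → ℚ)) := by
    simpa [Function.comp_def] using
      (Pi.basisFun ℚ (Fin d)).linearIndependent.comp (Subtype.val : S → Fin d)
        Subtype.val_injective
  rw [← Nat.card_coe_set_eq, Nat.card_eq_fintype_card, ← finrank_span_eq_card hli]
  refine (Submodule.finrank_mono (Submodule.span_le.2 ?_)).trans
    (finrank_vectorSpan_image_finset_le ℚ cubeVector Z
      (Nat.sub_add_cancel hZ.card_pos).symm)
  rintro _ ⟨⟨i, z, hz, hf⟩, rfl⟩
  exact single_one_mem_vectorSpan hz hf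
end

section
/- Let d ≥ 1 and let S be a set of exactly d vertices of the hypercube graph Q_d that separates two vertices a and b of Q_d not in S (i.e., every path from a to b in Q_d contains a vertex of S). Then there exists a vertex v of Q_d such that S is exactly the set of the d neighbours of v. -/
/-- The vertex of the cube obtained from `x` by changing its `i`-th coordinate. -/
def cubeFlip {n : ℕ} (x : Fin n → Bool) (i : Fin n) : Fin n → Bool :=
  Function.update x i (!x i)

theorem cubeFlip_apply_self {n : ℕ} (x : Fin n → Bool) (i : Fin n) : cubeFlip x i i = !x i := by
  simp [cubeFlip]

theorem cubeFlip_ne {n : ℕ} (x : Fin n → Bool) (i : Fin n) : cubeFlip x i ≠ x := by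
  intro h
  have := congrFun h i
  simp [cubeFlip] at this

theorem cubeFlip_injective {n : ℕ} (x : Fin n → Bool) : Function.Injective (cubeFlip x) := by
  intro i j h
  by_contra hij
  have := congrFun h i
  simp [cubeFlip, Function.update_of_ne hij] at this

theorem cubeFlip_cons_succ {n : ℕ} (c : Bool) (x : Fin n → Bool) (i : Fin n) :
    cubeFlip (Fin.cons c x : Fin (n + 1) → Bool) i.succ = Fin.cons c (cubeFlip x i) := by
  simp [cubeFlip, Fin.cons_update]

theorem cubeFlip_cons_zero {n : ℕ} (c : Bool) (x : Fin n → Bool) :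
    cubeFlip (Fin.cons c x : Fin (n + 1) → Bool) 0 = Fin.cons (!c) x := by
  simp [cubeFlip]

theorem cubeGraph_adj_iff {n : ℕ} (x y : Fin n → Bool) :
    (cubeGraph n).Adj x y ↔ ∃ i, cubeFlip x i = y := by
  change hammingDist x y = 1 ↔ _
  rw [hammingDist, Finset.card_eq_one]
  refine exists_congr fun i => ⟨fun h => ?_, ?_⟩
  · have key : ∀ j, x j ≠ y j ↔ j = i := fun j => by
      have := congrArg (j ∈ ·) h
      simpa using this
    funext j
    by_cases hj : j = i
    · subst hj
      have := (key j).2 rfl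
      rw [cubeFlip_apply_self]
      revert this
      cases x j <;> cases y j <;> simp
    · rw [cubeFlip, Function.update_of_ne hj]
      by_contra h'
      exact hj ((key j).1 h')
  · rintro rfl
    ext j
    rw [Finset.mem_filter, Finset.mem_singleton]
    by_cases hj : j = i
    · subst hj
      simp [cubeFlip]
    · simp [cubeFlip, hj]

/-- `f` takes equivalent values at the ends of every edge of the cube that avoids `S`. -/
def CubeLocallyConst {n : ℕ} (S : Finset (Fin n → Bool)) (f : (Fin n → Bool) → Prop) : Prop :=
  ∀ x i, x ∉ S → cubeFlip x i ∉ S → (f x ↔ f (cubeFlip x i))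

/-- `f` takes equivalent values at all vertices of the cube outside `S`. -/
def CubeConst {n : ℕ} (S : Finset (Fin n → Bool)) (f : (Fin n → Bool) → Prop) : Prop :=
  ∀ x y, x ∉ S → y ∉ S → (f x ↔ f y)

/-- The trace of `S` on the facet of the cube where the first coordinate is `c`. -/
def cubeFacet {n : ℕ} (S : Finset (Fin (n + 1) → Bool)) (c : Bool) : Finset (Fin n → Bool) :=
  Finset.univ.filter fun x => (Fin.cons c x : Fin (n + 1) → Bool) ∈ S

theorem mem_cubeFacet {n : ℕ} {S : Finset (Fin (n + 1) → Bool)} {c : Bool} {x : Fin n → Bool} :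
    x ∈ cubeFacet S c ↔ (Fin.cons c x : Fin (n + 1) → Bool) ∈ S := by
  simp [cubeFacet]

theorem card_cubeFacet_add {n : ℕ} (S : Finset (Fin (n + 1) → Bool)) (c : Bool) :
    (cubeFacet S c).card + (cubeFacet S (!c)).card = S.card := by
  have key : ∀ c, (cubeFacet S c).card = (S.filter fun z => z 0 = c).card := fun c => by
    rw [← Finset.card_image_of_injective (cubeFacet S c)
      (Fin.cons_right_injective (α := fun _ : Fin (n + 1) => Bool) c)]
    congr 1
    ext z
    simp only [Finset.mem_image, mem_cubeFacet, Finset.mem_filter]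
    constructor
    · rintro ⟨x, hx, rfl⟩
      exact ⟨hx, by simp⟩
    · rintro ⟨hz, rfl⟩
      exact ⟨Fin.tail z, by simpa using hz, by simp⟩
  rw [key, key, ← Finset.card_filter_add_card_filter_not (s := S) (fun z => z 0 = c)]
  congr 3
  ext z
  cases z 0 <;> cases c <;> simp

theorem CubeLocallyConst.facet {n : ℕ} {S : Finset (Fin (n + 1) → Bool)}
    {f : (Fin (n + 1) → Bool) → Prop} (h : CubeLocallyConst S f) (c : Bool) :
    CubeLocallyConst (cubeFacet S c) fun x => f (Fin.cons c x) := by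
  intro x i hx hxi
  rw [mem_cubeFacet] at hx hxi
  beta_reduce
  rw [← cubeFlip_cons_succ] at hxi ⊢
  exact h _ _ hx hxi

/-- A vertex outside `S` agrees with its projection to a facet. -/
theorem CubeLocallyConst.iff_cons_tail {n : ℕ} {S : Finset (Fin (n + 1) → Bool)}
    {f : (Fin (n + 1) → Bool) → Prop} (h : CubeLocallyConst S f) (c : Bool)
    {z : Fin (n + 1) → Bool} (hz : z ∉ S) (hc : Fin.tail z ∉ cubeFacet S c) :
    f z ↔ f (Fin.cons c (Fin.tail z)) := by
  rw [mem_cubeFacet] at hc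
  obtain ⟨b, x, rfl⟩ : ∃ (b : Bool) (x : Fin n → Bool), z = (Fin.cons b x : Fin (n + 1) → Bool) :=
    ⟨z 0, Fin.tail z, by simp⟩
  rw [Fin.tail_cons] at hc ⊢
  by_cases hb : b = c
  · rw [hb]
  · obtain rfl : c = !b := by revert hb; cases b <;> cases c <;> simp
    rw [← cubeFlip_cons_zero] at hc ⊢
    exact h _ _ hz hc

theorem CubeLocallyConst.const_of_facet_empty {n : ℕ} {S : Finset (Fin (n + 1) → Bool)}
    {f : (Fin (n + 1) → Bool) → Prop} (h : CubeLocallyConst S f) {c : Bool}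
    (hc : cubeFacet S c = ∅) (hconst : CubeConst (cubeFacet S c) fun x => f (Fin.cons c x)) :
    CubeConst S f := by
  intro x y hx hy
  rw [h.iff_cons_tail c hx (by simp [hc]), h.iff_cons_tail c hy (by simp [hc])]
  exact hconst _ _ (by simp [hc]) (by simp [hc])

theorem CubeLocallyConst.const_of_facets {n : ℕ} {S : Finset (Fin (n + 1) → Bool)}
    {f : (Fin (n + 1) → Bool) → Prop} (h : CubeLocallyConst S f) (hS : S.card < 2 ^ n)
    (hconst : ∀ c, CubeConst (cubeFacet S c) fun x => f (Fin.cons c x)) :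
    CubeConst S f := by
  obtain ⟨w, hw⟩ : ∃ w, w ∉ cubeFacet S false ∪ cubeFacet S true := by
    by_contra! hall
    have h1 : (cubeFacet S false ∪ cubeFacet S true) = Finset.univ :=
      Finset.eq_univ_iff_forall.2 hall
    have h2 := Finset.card_union_le (cubeFacet S false) (cubeFacet S true)
    have h3 := card_cubeFacet_add S false
    rw [h1, Finset.card_univ] at h2
    simp at h2 h3
    omega
  simp only [Finset.mem_union, not_or] at hw
  have hw' : ∀ c, w ∉ cubeFacet S c := fun c => by cases c <;> tauto
  have key : ∀ z, z ∉ S → (f z ↔ f (Fin.cons false w)) := fun z hz => by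
    have h1 : f z ↔ f (Fin.cons (z 0) w) := by
      have := hconst (z 0) (Fin.tail z) w (by simpa [mem_cubeFacet] using hz) (hw' _)
      simpa using this
    have hm : (Fin.cons (z 0) w : Fin (n + 1) → Bool) ∉ S := by
      rw [← mem_cubeFacet]; exact hw' _
    have h2 := h.iff_cons_tail false hm (by simpa using hw' false)
    rw [h1, h2, Fin.tail_cons]
  exact fun x y hx hy => (key x hx).trans (key y hy).symm

/-- The `n`-dimensional cube stays connected after the removal of fewer than `n` vertices. -/
theorem CubeLocallyConst.const_of_card_lt {n : ℕ} {S : Finset (Fin n → Bool)}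
    {f : (Fin n → Bool) → Prop} (h : CubeLocallyConst S f) (hS : S.card < n) :
    CubeConst S f := by
  induction n with
  | zero => omega
  | succ n ih =>
    by_cases he : ∃ c, cubeFacet S c = ∅
    · obtain ⟨c, hc⟩ := he
      refine h.const_of_facet_empty hc ?_
      rcases Nat.eq_zero_or_pos n with rfl | hn
      · intro x y _ _
        rw [Subsingleton.elim x y]
      · exact ih (h.facet c) (by simpa [hc] using hn)
    · push Not at he
      refine h.const_of_facets (by have := Nat.lt_two_pow_self (n := n); omega)
        fun c => ih (h.facet c) ?_
      have h1 := card_cubeFacet_add S c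
      have h2 := (he (!c)).card_pos
      omega

/-- A set of `n` vertices disconnecting the `n`-dimensional cube isolates some vertex. -/
theorem CubeLocallyConst.exists_isolated {n : ℕ} {S : Finset (Fin n → Bool)}
    {f : (Fin n → Bool) → Prop} (h : CubeLocallyConst S f) (hS : S.card = n)
    (hne : ¬ CubeConst S f) : ∃ v, ∀ i, cubeFlip v i ∈ S := by
  by_cases hsmall : n ≤ 2
  · simp only [CubeConst, not_forall] at hne
    obtain ⟨x, y, hx, hy, hxy⟩ := hne
    have hxy' : x ≠ y := by
      rintro rfl
      exact hxy Iff.rfl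
    have hpow : 2 ^ n ≤ n + 2 := by interval_cases n <;> simp
    have hSeq : S = {x, y}ᶜ := by
      refine Finset.eq_of_subset_of_card_le ?_ ?_
      · intro z hz
        simp only [Finset.mem_compl, Finset.mem_insert, Finset.mem_singleton, not_or]
        exact ⟨fun e => hx (e ▸ hz), fun e => hy (e ▸ hz)⟩
      · rw [Finset.card_compl, Finset.card_pair hxy']
        simp
        omega
    refine ⟨x, fun i => ?_⟩
    by_contra hi
    have hf := h x i hx hi
    rw [hSeq] at hi
    simp only [Finset.mem_compl, Finset.mem_insert, Finset.mem_singleton, not_not] at hi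
    rcases hi with hi | hi
    · exact cubeFlip_ne x i hi
    · exact hxy (hi ▸ hf)
  obtain ⟨m, rfl⟩ : ∃ m, n = m + 1 := ⟨n - 1, by omega⟩
  have hm : 2 ≤ m := by omega
  have hpos : ∀ c, 0 < (cubeFacet S c).card := fun c => by
    rw [Finset.card_pos, Finset.nonempty_iff_ne_empty]
    intro hc
    exact hne (h.const_of_facet_empty hc ((h.facet c).const_of_card_lt (by simp [hc]; omega)))
  have hpow : m + 1 < 2 ^ m := by
    clear * - hm
    induction m, hm using Nat.le_induction with
    | base => simp
    | succ k _ ih => rw [pow_succ]; omega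
  obtain ⟨c, hc⟩ : ∃ c, m ≤ (cubeFacet S (!c)).card := by
    by_contra! hlt
    refine hne (h.const_of_facets (by omega) fun c => (h.facet c).const_of_card_lt ?_)
    simpa using hlt (!c)
  have hsum := card_cubeFacet_add S c
  have hc1 : (cubeFacet S c).card = 1 := by
    have := hpos c
    omega
  have hconst := (h.facet c).const_of_card_lt (by omega)
  obtain ⟨w, hw⟩ := Finset.card_eq_one.1 hc1
  have key : ∀ y z, y ∉ S → z ∉ S → Fin.tail y ≠ w → Fin.tail z ≠ w → (f y ↔ f z) := by
    intro y z hy hz hyw hzw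
    have hy' : Fin.tail y ∉ cubeFacet S c := by simpa [hw] using hyw
    have hz' : Fin.tail z ∉ cubeFacet S c := by simpa [hw] using hzw
    rw [h.iff_cons_tail c hy hy', h.iff_cons_tail c hz hz']
    exact hconst _ _ hy' hz'
  have hwS : (Fin.cons c w : Fin (m + 1) → Bool) ∈ S := by
    rw [← mem_cubeFacet, hw]
    simp
  have huniq : ∀ z, z ∉ S → Fin.tail z = w → z = (Fin.cons (!c) w : Fin (m + 1) → Bool) := by
    rintro z hz rfl
    have h0 : z 0 ≠ c := by
      rintro rfl
      exact hz (by simpa using hwS)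
    have h1 : z 0 = !c := by revert h0; cases z 0 <;> cases c <;> simp
    rw [← h1, Fin.cons_self_tail]
  refine ⟨Fin.cons (!c) w, fun i => ?_⟩
  by_contra hi
  set v : Fin (m + 1) → Bool := Fin.cons (!c) w with hv
  have hiw : Fin.tail (cubeFlip v i) ≠ w := fun e => cubeFlip_ne v i (huniq _ hi e)
  refine hne ?_
  have key' : ∀ z, z ∉ S → (f z ↔ f (cubeFlip v i)) := fun z hz => by
    by_cases hzw : Fin.tail z = w
    · obtain rfl := huniq z hz hzw
      exact h _ _ hz hi
    · exact key _ _ hz hi hzw hiw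
  exact fun x y hx hy => (key' x hx).trans (key' y hy).symm

theorem cubeGraph_neighborSet_eq {n : ℕ} (v : Fin n → Bool) :
    (cubeGraph n).neighborSet v = Set.range (cubeFlip v) := by
  ext y
  exact cubeGraph_adj_iff v y

theorem ncard_neighborSet_cubeGraph {n : ℕ} (v : Fin n → Bool) :
    ((cubeGraph n).neighborSet v).ncard = n := by
  rw [cubeGraph_neighborSet_eq, ← Set.image_univ,
    Set.ncard_image_of_injective _ (cubeFlip_injective v), Set.ncard_univ, Nat.card_fin]

theorem cube_separator_neighbours (d : ℕ) (hd : 1 ≤ d) (S : Set (Fin d → Bool))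
    (hScard : S.ncard = d) (a b : Fin d → Bool) (ha : a ∉ S) (hb : b ∉ S)
    (hsep : ∀ p : (cubeGraph d).Walk a b, p.IsPath → ∃ v ∈ p.support, v ∈ S) :
    ∃ v : Fin d → Bool, S = (cubeGraph d).neighborSet v := by
  classical
  let f : (Fin d → Bool) → Prop := fun x => ∃ p : (cubeGraph d).Walk a x, ∀ v ∈ p.support, v ∉ S
  have extend : ∀ x y, (cubeGraph d).Adj x y → y ∉ S → f x → f y := by
    rintro x y hxy hy ⟨p, hp⟩
    refine ⟨p.concat hxy, fun v hv => ?_⟩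
    rw [SimpleGraph.Walk.support_concat] at hv
    simp only [List.mem_append, List.mem_singleton] at hv
    rcases hv with hv | rfl
    · exact hp v hv
    · exact hy
  have hloc : CubeLocallyConst S.toFinset f := by
    intro x i hx hxi
    rw [Set.mem_toFinset] at hx hxi
    have hadj : (cubeGraph d).Adj x (cubeFlip x i) := (cubeGraph_adj_iff _ _).2 ⟨i, rfl⟩
    exact ⟨extend _ _ hadj hxi, extend _ _ hadj.symm hx⟩
  have hfa : f a := ⟨.nil, by simpa using ha⟩
  have hfb : ¬ f b := by
    rintro ⟨p, hp⟩
    obtain ⟨v, hv, hvS⟩ := hsep p.bypass p.bypass_isPath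
    exact hp v (p.support_bypass_subset_support hv) hvS
  obtain ⟨v, hv⟩ := hloc.exists_isolated (by rw [← Set.ncard_eq_toFinset_card', hScard])
    fun hconst => hfb ((hconst a b (by simpa using ha) (by simpa using hb)).1 hfa)
  refine ⟨v, (Set.eq_of_subset_of_ncard_le ?_ ?_).symm⟩
  · rw [cubeGraph_neighborSet_eq]
    rintro _ ⟨i, rfl⟩
    simpa using hv i
  · rw [hScard, ncard_neighborSet_cubeGraph]
end

section
/- Let n ≥ 3, let k := ⌊(n+2)/2⌋, and let X be a set of n+2 vertices of the hypercube graph Q_n. Let s_1,t_1,…,s_k,t_k be 2k distinct vertices of X, grouped into the k pairs {s_1,t_1},…,{s_k,t_k}. Then for at least k−1 of the indices i ∈ {1,…,k} there exists an X-valid path from s_i to t_i in Q_n. -/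
/-- The hypercube graph with the edges meeting `S` removed. -/
def cubeAvoid {n : ℕ} (S : Finset (Fin n → Bool)) : SimpleGraph (Fin n → Bool) where
  Adj x y := (cubeGraph n).Adj x y ∧ x ∉ S ∧ y ∉ S
  symm := ⟨fun _ _ h => ⟨h.1.symm, h.2.2, h.2.1⟩⟩
  loopless := ⟨fun _ h => h.1.ne rfl⟩

/-- The trace of `S` on the facet of the cube where the first coordinate is `c`. -/
def facetTrace {n : ℕ} (S : Finset (Fin (n + 1) → Bool)) (c : Bool) : Finset (Fin n → Bool) :=
  Finset.univ.filter fun x => (Fin.cons c x : Fin (n + 1) → Bool) ∈ S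

theorem mem_facetTrace {n : ℕ} {S : Finset (Fin (n + 1) → Bool)} {c : Bool} {x : Fin n → Bool} :
    x ∈ facetTrace S c ↔ (Fin.cons c x : Fin (n + 1) → Bool) ∈ S := by
  simp [facetTrace]

theorem hammingDist_cons {n : ℕ} (c d : Bool) (x y : Fin n → Bool) :
    hammingDist (Fin.cons c x : Fin (n + 1) → Bool) (Fin.cons d y) =
      (if c = d then 0 else 1) + hammingDist x y := by
  simp only [hammingDist, Finset.card_filter, Fin.sum_univ_succ, Fin.cons_zero, Fin.cons_succ]
  by_cases h : c = d <;> simp [h]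

theorem card_facetTrace_add {n : ℕ} (S : Finset (Fin (n + 1) → Bool)) (c : Bool) :
    (facetTrace S c).card + (facetTrace S !c).card = S.card := by
  classical
  have hinj (d : Bool) :
      Function.Injective (fun x : Fin n → Bool => (Fin.cons d x : Fin (n + 1) → Bool)) :=
    Fin.cons_right_injective (α := fun _ => Bool) d
  rw [← Finset.card_image_of_injective (facetTrace S c) (hinj c),
    ← Finset.card_image_of_injective (facetTrace S !c) (hinj !c), ← Finset.card_union_of_disjoint]
  · congr 1
    ext v
    induction v using Fin.consCases with
    | _ d x =>
      simp only [Finset.mem_union, Finset.mem_image, mem_facetTrace, Fin.cons_inj]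
      cases c <;> cases d <;> simp
  · rw [Finset.disjoint_left]
    intro v hv hw
    simp only [Finset.mem_image] at hv hw
    obtain ⟨x, -, rfl⟩ := hv
    obtain ⟨y, -, hy⟩ := hw
    have := (Fin.cons_inj.1 hy).1
    cases c <;> simp at this

theorem reachable_cons {n : ℕ} {S : Finset (Fin (n + 1) → Bool)} {c : Bool} {x y : Fin n → Bool}
    (h : (cubeAvoid (facetTrace S c)).Reachable x y) :
    (cubeAvoid S).Reachable (Fin.cons c x) (Fin.cons c y) := by
  let f : cubeAvoid (facetTrace S c) →g cubeAvoid S :=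
    { toFun := fun x => Fin.cons c x
      map_rel' := by
        rintro u v ⟨h, hu, hv⟩
        refine ⟨?_, by rwa [mem_facetTrace] at hu, by rwa [mem_facetTrace] at hv⟩
        simpa [cubeGraph, hammingDist_cons] using h }
  exact h.map f

theorem reachable_cons_not {n : ℕ} {S : Finset (Fin (n + 1) → Bool)} {c : Bool} {x : Fin n → Bool}
    (h : x ∉ facetTrace S c) (h' : x ∉ facetTrace S !c) :
    (cubeAvoid S).Reachable (Fin.cons (!c) x) (Fin.cons c x) := by
  refine SimpleGraph.Adj.reachable ⟨?_, by rwa [mem_facetTrace] at h', by rwa [mem_facetTrace] at h⟩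
  simp [cubeGraph, hammingDist_cons]

theorem exists_notMem_facetTrace {n : ℕ} {S : Finset (Fin (n + 1) → Bool)} (hS : S.card < 2 ^ n)
    (c : Bool) : ∃ x, x ∉ facetTrace S c ∧ x ∉ facetTrace S !c := by
  classical
  have hlt : (facetTrace S c ∪ facetTrace S !c).card <
      (Finset.univ : Finset (Fin n → Bool)).card := by
    refine (Finset.card_union_le _ _).trans_lt ?_
    rw [card_facetTrace_add]
    simpa using hS
  obtain ⟨x, -, hx⟩ := Finset.exists_mem_notMem_of_card_lt_card hlt
  exact ⟨x, by simpa [not_or] using hx⟩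

/-- If a facet minus `S` is connected, then any two vertices that can escape to it are joined. -/
theorem reachable_of_facet {n : ℕ} {S : Finset (Fin (n + 1) → Bool)} {c : Bool}
    (hc : ∀ x y, x ∉ facetTrace S c → y ∉ facetTrace S c →
      (cubeAvoid (facetTrace S c)).Reachable x y)
    {a b : Fin (n + 1) → Bool}
    (ha : ∃ x, x ∉ facetTrace S c ∧ (cubeAvoid S).Reachable a (Fin.cons c x))
    (hb : ∃ x, x ∉ facetTrace S c ∧ (cubeAvoid S).Reachable b (Fin.cons c x)) :
    (cubeAvoid S).Reachable a b := by
  obtain ⟨x, hx, hax⟩ := ha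
  obtain ⟨y, hy, hby⟩ := hb
  exact hax.trans ((reachable_cons (hc x y hx hy)).trans hby.symm)

theorem exists_card_facetTrace_le {n : ℕ} (S : Finset (Fin (n + 1) → Bool)) :
    ∃ c, (facetTrace S c).card ≤ (facetTrace S !c).card := by
  rcases le_total (facetTrace S true).card (facetTrace S false).card with h | h
  · exact ⟨true, h⟩
  · exact ⟨false, h⟩

/-- The hypercube `Q_n` stays connected after deleting at most `n - 1` vertices. -/
theorem cubeAvoid_reachable {n : ℕ} (S : Finset (Fin n → Bool)) (hS : S.card ≤ n - 1)
    (a b : Fin n → Bool) (ha : a ∉ S) (hb : b ∉ S) : (cubeAvoid S).Reachable a b := by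
  induction n with
  | zero => rw [Subsingleton.elim a b]
  | succ n ih =>
    obtain ⟨c, hc⟩ := exists_card_facetTrace_le S
    have hsum := card_facetTrace_add S c
    have key : ∀ v, v ∉ S →
        ∃ x, x ∉ facetTrace S c ∧ (cubeAvoid S).Reachable v (Fin.cons c x) := by
      intro v hv
      induction v using Fin.consCases with
      | _ d y =>
        rw [← mem_facetTrace] at hv
        obtain rfl | rfl : d = c ∨ d = !c := by cases c <;> cases d <;> simp
        · exact ⟨y, hv, .rfl⟩
        by_cases hd : (facetTrace S !c).card ≤ n - 1
        · obtain ⟨x, hx, hx'⟩ := exists_notMem_facetTrace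
            (hS.trans_lt (by simpa using n.lt_two_pow_self)) c
          exact ⟨x, hx, (reachable_cons (ih _ hd y x hv hx')).trans (reachable_cons_not hx hx')⟩
        · have hy : y ∉ facetTrace S c := by
            rw [Finset.card_eq_zero.1 (show (facetTrace S c).card = 0 by lia)]
            simp
          exact ⟨y, hy, reachable_cons_not hy hv⟩
    exact reachable_of_facet (ih _ (by lia)) (key a ha) (key b hb)

/-- After deleting at most `n` vertices of `Q_n`, any two remaining vertices that are not
isolated are joined. -/
theorem cubeAvoid_reachable_of_adj {n : ℕ} (hn : 3 ≤ n) (S : Finset (Fin n → Bool))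
    (hS : S.card ≤ n) (a b : Fin n → Bool) (ha : ∃ v, (cubeAvoid S).Adj a v)
    (hb : ∃ v, (cubeAvoid S).Adj b v) : (cubeAvoid S).Reachable a b := by
  obtain _ | n := n
  · lia
  obtain ⟨c, hc⟩ := exists_card_facetTrace_le S
  have hsum := card_facetTrace_add S c
  have hpow : n + 1 < 2 ^ n := by
    obtain ⟨m, rfl⟩ := Nat.exists_eq_add_of_le (show 2 ≤ n by lia)
    have := m.lt_two_pow_self
    rw [pow_add]
    lia
  have key : ∀ v, (∃ w, (cubeAvoid S).Adj v w) →
      ∃ x, x ∉ facetTrace S c ∧ (cubeAvoid S).Reachable v (Fin.cons c x) := by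
    rintro v ⟨w, hvw⟩
    have hv := hvw.2.1
    have hw := hvw.2.2
    induction v using Fin.consCases with
    | _ d y =>
    induction w using Fin.consCases with
    | _ e z =>
      rw [← mem_facetTrace] at hv hw
      obtain rfl | rfl : d = c ∨ d = !c := by cases c <;> cases d <;> simp
      · exact ⟨y, hv, .rfl⟩
      obtain rfl | rfl : e = c ∨ e = !c := by cases c <;> cases e <;> simp
      · exact ⟨z, hw, hvw.reachable⟩
      by_cases hd : (facetTrace S !c).card ≤ n - 1
      · obtain ⟨x, hx, hx'⟩ := exists_notMem_facetTrace (hS.trans_lt hpow) c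
        exact ⟨x, hx, (reachable_cons (cubeAvoid_reachable _ hd y x hv hx')).trans
          (reachable_cons_not hx hx')⟩
      by_cases hy : y ∈ facetTrace S c
      · have hz : z ∉ facetTrace S c := by
          intro hz
          have hyz := Finset.card_le_one.1 (show (facetTrace S c).card ≤ 1 by lia) y hy z hz
          exact hvw.ne (by rw [hyz])
        exact ⟨z, hz, hvw.reachable.trans (reachable_cons_not hz hw)⟩
      · exact ⟨y, hy, reachable_cons_not hy hv⟩
  exact reachable_of_facet (cubeAvoid_reachable _ (by lia)) (key a ha) (key b hb)

theorem exists_isPath_of_cubeAvoid_reachable {n : ℕ} {S : Finset (Fin n → Bool)}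
    {a b : Fin n → Bool} (ha : a ∉ S) (h : (cubeAvoid S).Reachable a b) :
    ∃ p : (cubeGraph n).Walk a b, p.IsPath ∧ ∀ v ∈ p.support, v ∉ S := by
  obtain ⟨p, hp⟩ := h.exists_isPath
  have hle : cubeAvoid S ≤ cubeGraph n := fun _ _ h => h.1
  refine ⟨p.mapLe hle, (SimpleGraph.Walk.isPath_mapLe hle).2 hp, ?_⟩
  rw [SimpleGraph.Walk.support_mapLe_eq_support]
  clear hp h
  induction p with
  | nil => simpa using ha
  | cons hadj p ih =>
    simp only [SimpleGraph.Walk.support_cons, List.mem_cons, forall_eq_or_imp]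
    exact ⟨ha, ih hadj.2.2⟩

/-- Flipping one coordinate of a vertex of the cube gives an adjacent vertex. -/
theorem cubeGraph_adj_flip {n : ℕ} (a : Fin n → Bool) (i : Fin n) :
    (cubeGraph n).Adj a (Function.update a i !(a i)) := by
  change hammingDist _ _ = 1
  rw [hammingDist, Finset.card_eq_one]
  refine ⟨i, ?_⟩
  ext j
  by_cases h : j = i
  · subst h; simp
  · simp [h]

/-- A vertex of `Q_n` whose neighbours all lie in a set of at most `n` vertices is adjacent to
every vertex of that set. -/
theorem cubeGraph_adj_of_forall_adj_mem {n : ℕ} {S : Finset (Fin n → Bool)} (hS : S.card ≤ n)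
    {a : Fin n → Bool} (h : ∀ v, (cubeGraph n).Adj a v → v ∈ S) {v : Fin n → Bool} (hv : v ∈ S) :
    (cubeGraph n).Adj a v := by
  classical
  have hinj : Function.Injective fun i => Function.update a i !(a i) := by
    intro i j hij
    by_contra hne
    have := congrFun hij i
    simp [hne] at this
  have hsub : Finset.univ.image (fun i => Function.update a i !(a i)) ⊆ S := by
    intro w hw
    obtain ⟨i, -, rfl⟩ := Finset.mem_image.1 hw
    exact h _ (cubeGraph_adj_flip a i)
  have heq := Finset.eq_of_subset_of_card_le hsub (by
    rw [Finset.card_image_of_injective _ hinj]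
    simpa using hS)
  rw [← heq] at hv
  obtain ⟨i, -, rfl⟩ := Finset.mem_image.1 hv
  exact cubeGraph_adj_flip a i

theorem cubeGraph_not_triangle {n : ℕ} {a b c : Fin n → Bool} (hab : (cubeGraph n).Adj a b)
    (hbc : (cubeGraph n).Adj b c) : ¬ (cubeGraph n).Adj a c := by
  intro hac
  obtain ⟨i, hi⟩ := Finset.card_eq_one.1
    (show (Finset.univ.filter fun i => a i ≠ b i).card = 1 from hab)
  obtain ⟨j, hj⟩ := Finset.card_eq_one.1
    (show (Finset.univ.filter fun i => b i ≠ c i).card = 1 from hbc)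
  obtain ⟨k, hk⟩ := Finset.card_eq_one.1
    (show (Finset.univ.filter fun i => a i ≠ c i).card = 1 from hac)
  simp only [Finset.ext_iff, Finset.mem_filter, Finset.mem_univ, true_and,
    Finset.mem_singleton] at hi hj hk
  have hbool : ∀ x y z : Bool, x ≠ z → (x ≠ y ↔ ¬ y ≠ z) := by decide
  have hiff : k = i ↔ ¬ k = j := by
    rw [← hi, ← hj]
    exact hbool _ _ _ ((hk k).2 rfl)
  have hboth : ∀ l, l = k ∨ (l = i ↔ l = j) := by
    intro l
    rw [← hi, ← hj, ← hk]
    generalize a l = x, b l = y, c l = z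
    revert x y z
    decide
  have hki := hboth i
  have hkj := hboth j
  grind

/-- If `n` vertices separate two vertices of `Q_n`, they are the neighbours of one of the two. -/
theorem exists_forall_adj_of_not_reachable {n : ℕ} (hn : 3 ≤ n) {S : Finset (Fin n → Bool)}
    (hS : S.card ≤ n) {a b : Fin n → Bool} (ha : a ∉ S) (hb : b ∉ S)
    (h : ¬ (cubeAvoid S).Reachable a b) :
    ∃ u, (u = a ∨ u = b) ∧ ∀ v ∈ S, (cubeGraph n).Adj u v := by
  by_contra! hcon
  have key : ∀ u, u = a ∨ u = b → ∃ v, (cubeAvoid S).Adj u v := by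
    intro u hu
    by_contra! hiso
    obtain ⟨v, hv, hnadj⟩ := hcon u hu
    refine hnadj (cubeGraph_adj_of_forall_adj_mem hS (fun w hw => ?_) hv)
    by_contra hwS
    exact hiso w ⟨hw, by rcases hu with rfl | rfl <;> assumption, hwS⟩
  exact h (cubeAvoid_reachable_of_adj hn S hS a b (key a (.inl rfl)) (key b (.inr rfl)))

theorem terminals_in_facet (n : ℕ) (hn : 3 ≤ n) (X : Finset (Fin n → Bool))
    (hX : X.card = n + 2)
    (s t : Fin ((n + 2) / 2) → (Fin n → Bool))
    (hinj : Function.Injective (Sum.elim s t))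
    (hmem : ∀ i, s i ∈ X ∧ t i ∈ X) :
    ∃ I : Finset (Fin ((n + 2) / 2)), (n + 2) / 2 - 1 ≤ I.card ∧
      ∀ i ∈ I, ∃ p : (cubeGraph n).Walk (s i) (t i), p.IsPath ∧
        ∀ v ∈ p.support, v ∈ X → v = s i ∨ v = t i := by
  classical
  have hs : Function.Injective s := hinj.comp Sum.inl_injective
  have ht : Function.Injective t := hinj.comp Sum.inr_injective
  have hst : ∀ i j, s i ≠ t j := fun i j h => Sum.inl_ne_inr (hinj (a₁ := .inl i) (a₂ := .inr j) h)
  let S i := X \ {s i, t i}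
  have hcard : ∀ i, (S i).card ≤ n := by
    intro i
    have hsub : {s i, t i} ⊆ X := by simp [Finset.insert_subset_iff, hmem i]
    rw [Finset.card_sdiff_of_subset hsub, hX, Finset.card_pair (hst i i)]
    lia
  let J := Finset.univ.filter fun i => ¬ (cubeAvoid (S i)).Reachable (s i) (t i)
  have hJ : J.card ≤ 1 := by
    rw [Finset.card_le_one]
    intro i hi j hj
    by_contra hij
    obtain ⟨a, ha, haS⟩ := exists_forall_adj_of_not_reachable hn (hcard i) (by simp [S])
      (by simp [S]) (Finset.mem_filter.1 hi).2
    obtain ⟨b, hb, hbS⟩ := exists_forall_adj_of_not_reachable hn (hcard j) (by simp [S])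
      (by simp [S]) (Finset.mem_filter.1 hj).2
    have hlt : ({s i, t i, s j, t j} : Finset (Fin n → Bool)).card < X.card :=
      Finset.card_le_four.trans_lt (by lia)
    obtain ⟨x, hxX, hx⟩ := Finset.exists_mem_notMem_of_card_lt_card hlt
    simp only [Finset.mem_insert, Finset.mem_singleton, not_or] at hx
    have hbi : b ∈ S i := by
      have h1 := hs.ne (Ne.symm hij)
      have h2 := ht.ne (Ne.symm hij)
      have h3 := hst j i
      have h4 := (hst i j).symm
      rcases hb with rfl | rfl <;> simp [S, hmem j, *]
    exact cubeGraph_not_triangle (haS b hbi) (hbS x (by simp [S, hxX, hx]))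
      (haS x (by simp [S, hxX, hx]))
  refine ⟨Jᶜ, ?_, fun i hi => ?_⟩
  · rw [Finset.card_compl, Fintype.card_fin]
    lia
  · have hr : (cubeAvoid (S i)).Reachable (s i) (t i) := by
      simpa [J] using hi
    obtain ⟨p, hp, hpS⟩ := exists_isPath_of_cubeAvoid_reachable (by simp [S]) hr
    refine ⟨p, hp, fun v hv hvX => ?_⟩
    have := hpS v hv
    simp only [S, Finset.mem_sdiff, hvX, Finset.mem_insert, Finset.mem_singleton] at this
    tauto
end

section
/- Let d ≥ 2 with d ≠ 3, let v be a vertex of the hypercube graph Q_{d+1}, and let v° be the antipodal vertex of v (the vertex differing from v in every coordinate). Then the subgraph of Q_{d+1} induced on the vertices other than v and v° is ⌊(d+1)/2⌋-linked. -/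
open Finset

section Linkages

variable {V W κ : Type}

/-- The vertices `x` and `y` are joined by a walk of `G` inside the vertex set `S`. -/
def ConnIn (G : SimpleGraph V) (S : Set V) (x y : V) : Prop :=
  ∃ w : G.Walk x y, ∀ z ∈ w.support, z ∈ S

namespace ConnIn

variable {G : SimpleGraph V} {S S' : Set V} {x y z : V}

theorem refl (hx : x ∈ S) : ConnIn G S x x := ⟨.nil, by simpa using hx⟩

theorem symm : ConnIn G S x y → ConnIn G S y x := fun ⟨w, hw⟩ => ⟨w.reverse, by simpa using hw⟩

theorem trans : ConnIn G S x y → ConnIn G S y z → ConnIn G S x z := fun ⟨w, hw⟩ ⟨w', hw'⟩ =>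
  ⟨w.append w', fun u hu => by
    rcases SimpleGraph.Walk.mem_support_append_iff _ _ |>.1 hu with h | h
    exacts [hw u h, hw' u h]⟩

theorem mono (h : S ⊆ S') : ConnIn G S x y → ConnIn G S' x y := fun ⟨w, hw⟩ =>
  ⟨w, fun z hz => h (hw z hz)⟩

theorem of_adj (h : G.Adj x y) (hx : x ∈ S) (hy : y ∈ S) : ConnIn G S x y :=
  ⟨h.toWalk, by simp [hx, hy]⟩

theorem left_mem : ConnIn G S x y → x ∈ S := fun ⟨w, hw⟩ => hw x w.start_mem_support

theorem right_mem : ConnIn G S x y → y ∈ S := fun ⟨w, hw⟩ => hw y w.end_mem_support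

theorem map {H : SimpleGraph W} {R : Set W} (f : G →g H) (hf : ∀ z ∈ S, f z ∈ R) :
    ConnIn G S x y → ConnIn H R (f x) (f y) := fun ⟨w, hw⟩ =>
  ⟨w.map f, fun z hz => by
    rw [SimpleGraph.Walk.support_map, List.mem_map] at hz
    obtain ⟨u, hu, rfl⟩ := hz
    exact hf u (hw u hu)⟩

/-- A walk from `x` either avoids `u` or reaches a neighbour of `u` before meeting `u`. -/
theorem avoid_or_reach {u : V} (hxu : x ≠ u) (h : ConnIn G S x y) :
    ConnIn G (S \ {u}) x y ∨ u ∈ S ∧ ∃ z, G.Adj z u ∧ ConnIn G (S \ {u}) x z := by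
  obtain ⟨w, hw⟩ := h
  induction w with
  | nil => exact .inl (.refl ⟨hw _ (by simp), hxu⟩)
  | @cons a b c hab w ih =>
    have ha : a ∈ S \ {u} := ⟨hw a (by simp), hxu⟩
    by_cases hbu : b = u
    · subst hbu
      exact .inr ⟨hw b (by simp), a, hab, .refl ha⟩
    · have hb : b ∈ S \ {u} := ⟨hw b (by simp), hbu⟩
      have hstep : ConnIn G (S \ {u}) a b := .of_adj hab ha hb
      rcases ih hbu fun z hz => hw z (by simp [hz]) with h | ⟨hu, z, hz, h⟩
      · exact .inl (hstep.trans h)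
      · exact .inr ⟨hu, z, hz, hstep.trans h⟩

/-- Both endpoints of a walk through `u` reach neighbours of `u` other than `u` itself. -/
theorem avoid_or_reach_both {u : V} (hx : x ≠ u) (hy : y ≠ u) (h : ConnIn G S x y) :
    ConnIn G (S \ {u}) x y ∨ u ∈ S ∧
      ∃ x' y', G.Adj x' u ∧ G.Adj y' u ∧ ConnIn G (S \ {u}) x x' ∧ ConnIn G (S \ {u}) y y' := by
  rcases h.avoid_or_reach hx with h' | ⟨hu, x', hx', hc⟩
  · exact .inl h'
  rcases h.symm.avoid_or_reach hy with h' | ⟨-, y', hy', hc'⟩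
  · exact .inl h'.symm
  · exact .inr ⟨hu, x', y', hx', hy', hc, hc'⟩

end ConnIn

/-- The terminal sets `T k` are joined up inside pairwise disjoint vertex sets. -/
def Linkable (G : SimpleGraph V) (T : κ → Finset V) : Prop :=
  ∃ C : κ → Set V, (∀ k l x, x ∈ C k → x ∈ C l → k = l) ∧
    ∀ k, ∀ x ∈ T k, ∀ y ∈ T k, ConnIn G (C k) x y

/-- A family of pairwise disjoint sets of at most two terminals each. -/
structure IsConfig (T : κ → Finset V) : Prop where
  disj : ∀ k l x, x ∈ T k → x ∈ T l → k = l
  card_le : ∀ k, #(T k) ≤ 2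

theorem IsConfig.mono {T U : κ → Finset V} (hT : IsConfig T) (h : ∀ k, U k ⊆ T k) : IsConfig U where
  disj k l x hk hl := hT.disj k l x (h k hk) (h l hl)
  card_le k := (card_le_card (h k)).trans (hT.card_le k)

/-- Every configuration with at most `N` terminals in `G` is linkable. A terminal set with a single
element acts as a forbidden vertex for the others. -/
def HasLinkages (G : SimpleGraph V) (N : ℕ) : Prop :=
  ∀ (κ : Type) [Fintype κ] (T : κ → Finset V), IsConfig T → ∑ k, #(T k) ≤ N → Linkable G T

theorem linkable_of_forall_eq_empty {H : SimpleGraph V} {T : κ → Finset V} (h : ∀ k, T k = ∅) :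
    Linkable H T :=
  ⟨fun _ => ∅, by simp, by simp [h]⟩

theorem Linkable.of_iso {G : SimpleGraph V} {H : SimpleGraph W} (e : G ≃g H) {T : κ → Finset V}
    (h : Linkable H fun k => (T k).map e.toEquiv.toEmbedding) : Linkable G T := by
  obtain ⟨C, hC, hT⟩ := h
  refine ⟨fun k => e ⁻¹' C k, fun k l x => hC k l (e x), fun k x hx y hy => ?_⟩
  have := (hT k (e x) (mem_map_of_mem _ hx) (e y) (mem_map_of_mem _ hy)).map (R := e ⁻¹' C k)
    e.symm.toHom (by simp)
  simpa using this

theorem HasLinkages.connIn_compl {G : SimpleGraph V} {N : ℕ} (hG : HasLinkages G N) {F : Finset V}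
    (hF : #F + 2 ≤ N) {x y : V} (hx : x ∉ F) (hy : y ∉ F) : ConnIn G {z | z ∉ F} x y := by
  classical
  obtain ⟨C, hC, hT⟩ := hG (Option F) (fun k => k.elim {x, y} fun f => {f.1})
    ⟨by
      rintro (_ | k) (_ | l) z <;> simp only [Option.elim, mem_insert, mem_singleton]
      · simp
      · rintro (rfl | rfl) rfl
        exacts [absurd l.2 hx, absurd l.2 hy]
      · rintro rfl (h | h)
        exacts [absurd (h ▸ k.2) hx, absurd (h ▸ k.2) hy]
      · rintro rfl h
        simp [Subtype.ext h], by
      rintro (_ | k)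
      · exact card_le_two
      · simp⟩
    (by
      rw [Fintype.sum_option]
      simp only [Option.elim, card_singleton, sum_const, card_univ, Fintype.card_coe, smul_eq_mul,
        mul_one]
      have := card_le_two (a := x) (b := y)
      omega)
  refine (hT none x (by simp) y (by simp)).mono fun z hz hzF => ?_
  have := hC none (some ⟨z, hzF⟩) z hz (hT (some ⟨z, hzF⟩) z (by simp) z (by simp)).left_mem
  simp at this

/-- The prism over `G`: two copies of `G` with corresponding vertices joined. -/
abbrev prism (G : SimpleGraph V) : SimpleGraph (Bool × V) := (⊤ : SimpleGraph Bool) □ G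

variable {G : SimpleGraph V}

theorem ConnIn.prism {S : Set V} {R : Set (Bool × V)} {x y : V} (τ : Bool)
    (h : ConnIn G S x y) (hS : ∀ z ∈ S, (τ, z) ∈ R) : ConnIn (prism G) R (τ, x) (τ, y) :=
  h.map (SimpleGraph.boxProdRight (⊤ : SimpleGraph Bool) G τ).toHom hS

theorem connIn_prism_vertical {R : Set (Bool × V)} {x : V} (τ : Bool) (h : (τ, x) ∈ R)
    (h' : (!τ, x) ∈ R) : ConnIn (prism G) R (τ, x) (!τ, x) :=
  .of_adj (by simp [SimpleGraph.boxProd_adj]) h h'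

end Linkages

section Prism

variable {V κ : Type} [DecidableEq V]

/-- The terminals in one of the two copies of the base of a prism. -/
def side (T : κ → Finset (Bool × V)) (τ : Bool) (k : κ) : Finset V :=
  ((T k).filter fun p => p.1 = τ).image Prod.snd

theorem mem_side {T : κ → Finset (Bool × V)} {τ : Bool} {k : κ} {x : V} :
    x ∈ side T τ k ↔ (τ, x) ∈ T k := by
  simp [side]

theorem card_side_add (T : κ → Finset (Bool × V)) (τ : Bool) (k : κ) :
    #(side T τ k) + #(side T (!τ) k) = #(T k) := by
  have h (σ) : #(side T σ k) = #((T k).filter fun p => p.1 = σ) := by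
    apply card_image_of_injOn
    rintro ⟨a, x⟩ hx ⟨b, y⟩ hy h
    simp_all
  rw [h, h, ← card_filter_add_card_filter_not (s := T k) fun p => p.1 = τ]
  congr! 3 with p
  cases p.1 <;> cases τ <;> simp

theorem sum_side_add [Fintype κ] (T : κ → Finset (Bool × V)) (τ : Bool) :
    ∑ k, #(side T τ k) + ∑ k, #(side T (!τ) k) = ∑ k, #(T k) := by
  simp_rw [← sum_add_distrib, card_side_add]

theorem IsConfig.side {T : κ → Finset (Bool × V)} (hT : IsConfig T) (τ : Bool) :
    IsConfig (side T τ) where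
  disj k l x hk hl := hT.disj k l _ (mem_side.1 hk) (mem_side.1 hl)
  card_le k := by
    have := card_side_add T τ k
    have := hT.card_le k
    omega

variable {G : SimpleGraph V}

/-- Linkages in the two copies of the base combine to a linkage in the prism, provided that the two
parts of each terminal set meeting both copies share a common vertex of the base. -/
theorem linkable_prism_of_sides {T : κ → Finset (Bool × V)} (U : Bool → κ → Finset V)
    (hU : ∀ τ, Linkable G (U τ)) (hsub : ∀ τ k x, (τ, x) ∈ T k → x ∈ U τ k)
    (hmeet : ∀ k, (∀ τ, (side T τ k).Nonempty) → ∃ z, ∀ τ, z ∈ U τ k) :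
    Linkable (prism G) T := by
  choose C hC hCU using hU
  refine ⟨fun k => {p | p.2 ∈ C p.1 k}, fun k l p => hC p.1 k l p.2, ?_⟩
  rintro k ⟨τ, x⟩ hx ⟨σ, y⟩ hy
  by_cases h : σ = τ
  · subst h
    exact (hCU σ k x (hsub _ _ _ hx) y (hsub _ _ _ hy)).prism σ fun z hz => hz
  · obtain rfl : σ = !τ := by cases σ <;> cases τ <;> simp_all
    obtain ⟨z, hz⟩ := hmeet k fun ρ => by
      by_cases hρ : ρ = τ
      · subst hρ
        exact ⟨x, mem_side.2 hx⟩
      · obtain rfl : ρ = !τ := by cases ρ <;> cases τ <;> simp_all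
        exact ⟨y, mem_side.2 hy⟩
    refine ((hCU τ k x (hsub _ _ _ hx) z (hz _)).prism τ fun z hz => hz).trans
      (.trans (connIn_prism_vertical τ ?_ ?_)
        ((hCU (!τ) k z (hz _) y (hsub _ _ _ hy)).prism (!τ) fun z hz => hz))
    · exact (hCU τ k z (hz _) z (hz _)).left_mem
    · exact (hCU (!τ) k z (hz _) z (hz _)).left_mem

/-- The terminal set `T k` meets both copies of the base. -/
def Crosses (T : κ → Finset (Bool × V)) (k : κ) : Prop := ∀ τ, (side T τ k).Nonempty

open Classical in
/-- Projecting each crossing terminal set `T k` to the copy `g k` of the base. -/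
theorem linkable_prism_of_assignment [Fintype κ] {N : ℕ} (hG : HasLinkages G N)
    {T : κ → Finset (Bool × V)} (hT : IsConfig T) (g : κ → Bool)
    (hg : ∀ τ k l x, k ≠ l → Crosses T k → (τ, x) ∈ T k → (!τ, x) ∈ T l → g k = τ)
    (hcard : ∀ τ, ∑ k, #(side T τ k) + #{k | Crosses T k ∧ g k = τ} ≤ N) :
    Linkable (prism G) T := by
  let U (τ : Bool) (k : κ) : Finset V :=
    side T τ k ∪ if Crosses T k ∧ g k = τ then side T (!τ) k else ∅
  have mem_U {τ k x} : x ∈ U τ k ↔ (τ, x) ∈ T k ∨ (Crosses T k ∧ g k = τ) ∧ (!τ, x) ∈ T k := by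
    by_cases h : Crosses T k ∧ g k = τ <;> simp [U, h, mem_side]
  refine linkable_prism_of_sides U (fun τ => hG κ (U τ) ⟨?_, fun k => ?_⟩ ?_)
    (fun τ k x hx => mem_U.2 (.inl hx)) fun k hk => ?_
  · intro k l x hk hl
    by_contra hkl
    rcases mem_U.1 hk with hk | ⟨⟨hck, hgk⟩, hk⟩ <;> rcases mem_U.1 hl with hl | ⟨⟨hcl, hgl⟩, hl⟩
    · exact hkl (hT.disj k l _ hk hl)
    · have := hg (!τ) l k x (Ne.symm hkl) hcl hl (by simpa using hk)
      simp [hgl] at this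
    · have := hg (!τ) k l x hkl hck hk (by simpa using hl)
      simp [hgk] at this
    · exact hkl (hT.disj k l _ hk hl)
  · refine (card_union_le _ _).trans ?_
    have := card_side_add T τ k
    have := hT.card_le k
    split_ifs
    · omega
    · simp only [card_empty]; omega
  · refine le_trans ?_ (hcard τ)
    rw [card_filter, ← sum_add_distrib]
    refine sum_le_sum fun k _ => (card_union_le _ _).trans ?_
    split_ifs with h
    · have := card_side_add T τ k
      have := hT.card_le k
      have := (h.1 τ).card_pos
      omega
    · simp
  · obtain ⟨x, hx⟩ := hk (!g k)
    refine ⟨x, fun τ => mem_U.2 ?_⟩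
    by_cases h : g k = τ
    · exact .inr ⟨⟨hk, h⟩, by rwa [← h, ← mem_side]⟩
    · refine .inl ?_
      have : τ = !g k := by cases τ <;> cases h' : g k <;> simp_all
      rwa [this, ← mem_side]


open Classical in
/-- The crossing terminal sets with a terminal in the copy `τ` whose counterpart in the other copy
is a terminal of another set. -/
noncomputable def forced [Fintype κ] (T : κ → Finset (Bool × V)) (τ : Bool) : Finset κ :=
  {k | Crosses T k ∧ ∃ x l, k ≠ l ∧ (τ, x) ∈ T k ∧ (!τ, x) ∈ T l}

open Classical in
theorem linkable_prism_of_forced [Fintype κ] {N : ℕ} (hG : HasLinkages G N)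
    {T : κ → Finset (Bool × V)} (hT : IsConfig T)
    (hdisj : Disjoint (forced T false) (forced T true))
    (hside : ∀ τ, ∑ k, #(side T τ k) + #(forced T τ) ≤ N)
    (hcard : ∑ k, #(T k) + #{k | Crosses T k} ≤ 2 * N) : Linkable (prism G) T := by
  set K : Finset κ := {k | Crosses T k} with hK
  have hfK (τ) : forced T τ ⊆ K := fun k hk => by
    simp only [forced, mem_filter, mem_univ, true_and] at hk
    simpa [hK] using hk.1
  have hsum := sum_side_add T false
  simp only [Bool.not_false] at hsum
  have h₀ := hside false
  have h₁ := hside true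
  have hle : forced T false ⊆ K \ forced T true :=
    subset_sdiff.2 ⟨hfK _, hdisj⟩
  have hKcard := card_sdiff_add_card_eq_card (hfK true)
  obtain ⟨S, hfS, hSK, hS⟩ := exists_subsuperset_card_eq hle
    (n := min (N - ∑ k, #(side T false k)) #(K \ forced T true))
    (le_min (by omega) (card_le_card hle)) (min_le_right _ _)
  have hSK' : S ⊆ K := hSK.trans sdiff_subset
  have hS' := card_sdiff_add_card_eq_card hSK'
  refine linkable_prism_of_assignment hG hT (fun k => decide (k ∉ S)) (fun τ k l x hkl hc hk hl => ?_)
    fun τ => ?_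
  · have hkf : k ∈ forced T τ := by
      simp only [forced, mem_filter, mem_univ, true_and]
      exact ⟨hc, x, l, hkl, hk, hl⟩
    cases τ
    · simpa using hfS hkf
    · simp only [decide_eq_true_eq]
      exact fun h => (mem_sdiff.1 (hSK h)).2 hkf
  · cases τ
    · have : ({k | Crosses T k ∧ decide (k ∉ S) = false} : Finset κ) ⊆ S := fun k hk => by
        simpa using (mem_filter.1 hk).2.2
      have := card_le_card this
      omega
    · have : ({k | Crosses T k ∧ decide (k ∉ S) = true} : Finset κ) ⊆ K \ S := fun k hk => by
        simpa [hK] using hk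
      have := card_le_card this
      omega

theorem mem_forced [Fintype κ] {T : κ → Finset (Bool × V)} {τ : Bool} {k : κ} :
    k ∈ forced T τ ↔ Crosses T k ∧ ∃ x l, k ≠ l ∧ (τ, x) ∈ T k ∧ (!τ, x) ∈ T l := by
  simp [forced]

theorem disjoint_forced [Fintype κ] {T : κ → Finset (Bool × V)}
    (h : ∀ k l l' x x', k ≠ l → k ≠ l' → (false, x) ∈ T k → (true, x) ∈ T l → (true, x') ∈ T k →
      (false, x') ∉ T l') : Disjoint (forced T false) (forced T true) := by
  classical
  refine Finset.disjoint_left.2 fun k hk hk' => ?_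
  obtain ⟨-, x, l, hkl, hxk, hxl⟩ := mem_forced.1 hk
  obtain ⟨-, x', l', hkl', hxk', hxl'⟩ := mem_forced.1 hk'
  exact h k l l' x x' hkl hkl' hxk hxl hxk' hxl'

theorem Crosses.two_le {T : κ → Finset (Bool × V)} {k : κ} (h : Crosses T k) : 2 ≤ #(T k) := by
  have := card_side_add T false k
  have := (h false).card_pos
  have := (h true).card_pos
  simp only [Bool.not_false] at *
  omega

open Classical in
theorem two_mul_card_crosses_add_sum_le [Fintype κ] (T : κ → Finset (Bool × V)) (s : Finset κ)
    (hs : ∀ k ∈ s, ¬Crosses T k) : 2 * #{k | Crosses T k} + ∑ k ∈ s, #(T k) ≤ ∑ k, #(T k) := by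
  have hd : Disjoint ({k | Crosses T k} : Finset κ) s :=
    Finset.disjoint_left.2 fun k hk hks => hs k hks (by simpa using hk)
  have := sum_le_sum_of_subset (f := fun k => #(T k))
    (subset_univ (({k | Crosses T k} : Finset κ).disjUnion s hd))
  rw [sum_disjUnion] at this
  refine le_trans (Nat.add_le_add_right ?_ _) this
  rw [mul_comm, ← smul_eq_mul]
  exact card_nsmul_le_sum _ _ _ fun k hk => Crosses.two_le (by simpa using hk)

theorem two_le_sum_side_of_mem [Fintype κ] {T : κ → Finset (Bool × V)} {τ : Bool} {k l : κ}
    (hkl : k ≠ l) (hk : (side T τ k).Nonempty) (hl : (side T τ l).Nonempty) :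
    2 ≤ ∑ k, #(side T τ k) := by
  classical
  have := sum_le_sum_of_subset (f := fun k => #(side T τ k)) (subset_univ {k, l})
  rw [sum_pair hkl] at this
  have := hk.card_pos
  have := hl.card_pos
  omega

/-- A configuration one larger than `G` allows, meeting both copies of `G`, is linkable in the prism
if terminals with the same projection all project to the same vertex. -/
theorem linkable_prism_of_one_edge [Fintype κ] {N : ℕ} (hG : HasLinkages G N) (hN : 3 ≤ N)
    {T : κ → Finset (Bool × V)} (hT : IsConfig T) (y : V)
    (hy : ∀ τ k l x, k ≠ l → (τ, x) ∈ T k → (!τ, x) ∈ T l → x = y)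
    (hside : ∀ τ, 1 ≤ ∑ k, #(side T τ k)) (hcard : ∑ k, #(T k) ≤ N + 1) :
    Linkable (prism G) T := by
  classical
  refine linkable_prism_of_forced hG hT (disjoint_forced ?_) (fun τ => ?_) ?_
  · intro k l l' x x' hkl hkl' hk hl hk' hl'
    obtain rfl := hy false k l x hkl hk hl
    obtain rfl := hy true k l' x' hkl' hk' hl'
    exact hkl (hT.disj _ _ _ hk' hl)
  · have hsum := sum_side_add T τ
    rcases (forced T τ).eq_empty_or_nonempty with h | ⟨k, hk⟩
    · have := hside (!τ)
      rw [h, card_empty]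
      omega
    · obtain ⟨hc, x, l, hkl, hxk, hxl⟩ := mem_forced.1 hk
      have h1 : #(forced T τ) ≤ 1 := card_le_one_iff.2 fun {a b} ha hb => by
        obtain ⟨-, x, l, hal, hxa, hxl⟩ := mem_forced.1 ha
        obtain ⟨-, x', l', hbl, hxb, hxl'⟩ := mem_forced.1 hb
        obtain rfl := hy _ _ _ _ hal hxa hxl
        obtain rfl := hy _ _ _ _ hbl hxb hxl'
        exact hT.disj _ _ _ hxa hxb
      have := two_le_sum_side_of_mem hkl (hc (!τ)) ⟨x, mem_side.2 hxl⟩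
      omega
  · have := two_mul_card_crosses_add_sum_le T ∅ (by simp)
    simp only [sum_empty] at this
    omega

/-- A configuration one larger than `G` allows, contained in one copy of `G`, is linkable in the
prism. -/
theorem linkable_prism_of_one_side [Fintype κ] {N : ℕ} (hG : HasLinkages G N) (hN : 4 ≤ N)
    {T : κ → Finset (Bool × V)} (hT : IsConfig T) (τ : Bool) (hτ : ∀ k p, p ∈ T k → p.1 = τ)
    (hcard : ∑ k, #(T k) ≤ N + 1) : Linkable (prism G) T := by
  classical
  by_cases hE : ∀ k, T k = ∅
  · exact linkable_of_forall_eq_empty hE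
  push Not at hE
  obtain ⟨k₀, ⟨σ, u⟩, hu⟩ := hE
  obtain rfl := hτ k₀ _ hu
  have hS : IsConfig (side T σ) := hT.side σ
  have hsum : ∑ k, #(side T σ k) ≤ N + 1 := by
    have := sum_side_add T σ
    omega
  obtain ⟨C, hC, hCT⟩ := hG κ (fun k => (side T σ k).erase u) (hS.mono fun k => erase_subset _ _)
    (by
      have : ∑ k, #((side T σ k).erase u) < ∑ k, #(side T σ k) :=
        sum_lt_sum (fun k _ => card_erase_le)
          ⟨k₀, mem_univ _, card_erase_lt_of_mem (mem_side.2 hu)⟩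
      omega)
  obtain ⟨k₁, hk₁⟩ : ∃ k₁, ∀ k, k ≠ k₀ → k ≠ k₁ → u ∉ C k := by
    by_cases h : ∃ k₁, u ∈ C k₁
    · obtain ⟨k₁, h₁⟩ := h
      exact ⟨k₁, fun k _ hk hu => hk (hC k k₁ u hu h₁)⟩
    · exact ⟨k₀, fun k _ _ hu => h ⟨k, hu⟩⟩
  let P (k : κ) : Prop := k = k₀ ∨ k = k₁
  obtain ⟨D, hD, hDT⟩ := hG κ (fun k => if P k then side T σ k else ∅)
    (hS.mono fun k => by split_ifs <;> simp)
    (by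
      rw [← sum_filter_add_sum_filter_not univ P]
      have h0 : ∑ k with ¬P k, #(if P k then side T σ k else ∅) = 0 :=
        sum_eq_zero fun k hk => by simp [(mem_filter.1 hk).2]
      have h1 : ∑ k with P k, #(if P k then side T σ k else ∅) ≤ ∑ k ∈ {k₀, k₁}, 2 :=
        (sum_le_sum fun k hk => by
          rw [if_pos (mem_filter.1 hk).2]; exact hS.card_le k).trans
          (sum_le_sum_of_subset fun k hk => by simpa [P] using hk)
      have h2 := card_le_two (a := k₀) (b := k₁)
      simp only [sum_const, smul_eq_mul] at h1
      omega)
  have hCmem {k x} (hx : x ∈ side T σ k) (hxu : x ≠ u) : x ∈ C k :=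
    (hCT k x (by simp [*]) x (by simp [*])).left_mem
  have hsep {k l x} (hk : P k) (hl : ¬P l) (hx : x ∈ side T σ k) : x ∉ C l := fun hxl => by
    by_cases hxu : x = u
    · subst hxu
      simp only [P, not_or] at hl
      exact hk₁ l hl.1 hl.2 hxl
    · exact hl (hC k l x (hCmem hx hxu) hxl ▸ hk)
  refine ⟨fun k => {p | if P k then (p.1 = σ ∧ p.2 ∈ side T σ k) ∨ (p.1 = !σ ∧ p.2 ∈ D k)
    else p.1 = σ ∧ p.2 ∈ C k}, ?_, ?_⟩
  · rintro k l ⟨ρ, x⟩ hk hl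
    by_cases hPk : P k <;> by_cases hPl : P l <;>
      simp only [hPk, hPl, if_true, if_false, Set.mem_ofPred_eq] at hk hl
    · rcases hk with ⟨rfl, hk⟩ | ⟨rfl, hk⟩ <;> rcases hl with ⟨h, hl⟩ | ⟨h, hl⟩
      · exact hS.disj _ _ _ hk hl
      · simp at h
      · simp at h
      · exact hD _ _ _ hk hl
    · rcases hk with ⟨rfl, hk⟩ | ⟨rfl, hk⟩
      · exact absurd hl.2 (hsep hPk hPl hk)
      · simp at hl
    · rcases hl with ⟨rfl, hl⟩ | ⟨rfl, hl⟩
      · exact absurd hk.2 (hsep hPl hPk hl)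
      · simp at hk
    · exact hC _ _ _ hk.2 hl.2
  · rintro k ⟨ρ, x⟩ hx ⟨ρ', y⟩ hy
    obtain rfl := hτ k _ hx
    obtain rfl := hτ k _ hy
    dsimp only at *
    have hx' := mem_side.2 hx
    have hy' := mem_side.2 hy
    by_cases hPk : P k
    · have hDk := hDT k x (by simpa [hPk]) y (by simpa [hPk])
      refine (connIn_prism_vertical _ ?_ ?_).trans
        (.trans (hDk.prism (!ρ') fun z hz => by simp [hPk, hz])
          (connIn_prism_vertical _ ?_ ?_).symm) <;>
        simp only [hPk, if_true, Set.mem_ofPred_eq, hx', hy', and_self, true_or,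
          hDk.left_mem, hDk.right_mem, or_true]
    · have hu' {z} (hz : (ρ', z) ∈ T k) : z ≠ u := by
        rintro rfl
        exact hPk (.inl (hT.disj _ _ _ hz hu))
      refine (hCT k x (by simp [hx', hu' hx]) y (by simp [hy', hu' hy])).prism ρ' fun z hz => ?_
      simp [hPk, hz]

/-- Two far apart forbidden vertices `(τ, u)` and `(!τ, w)` in the two copies of the base, all
other terminals being in the copy `τ`. -/
theorem linkable_prism_of_two_forbidden_one_side [Fintype κ] {N : ℕ} (hG : HasLinkages G N)
    (hN : 3 ≤ N) {T : κ → Finset (Bool × V)} (hT : IsConfig T) {τ : Bool} {u w : V}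
    (hadj : ¬G.Adj w u) {a b : κ} (hab : a ≠ b) (ha : T a = {(τ, u)}) (hb : T b = {(!τ, w)})
    (hτ : ∀ k p, k ≠ b → p ∈ T k → p.1 = τ) (hcard : ∑ k, #(T k) ≤ N + 2) :
    Linkable (prism G) T := by
  classical
  obtain ⟨C, hC, hCT⟩ := hG κ (fun k => if k = a ∨ k = b then ∅ else side T τ k)
    ((hT.side τ).mono fun k => by split_ifs <;> simp)
    (by
      have h : ∑ k, (#(if k = a ∨ k = b then ∅ else side T τ k) + if k = a ∨ k = b then 1 else 0)
          ≤ ∑ k, #(T k) := sum_le_sum fun k _ => by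
        split_ifs with h
        · rcases h with rfl | rfl <;> simp [ha, hb]
        · have := card_side_add T τ k
          omega
      rw [sum_add_distrib, ← card_filter] at h
      have : #{k | k = a ∨ k = b} = 2 := by
        rw [← card_pair hab]; congr 1; ext; simp
      omega)
  refine ⟨fun k => {p | if k = a then p = (τ, u) else if k = b then p = (!τ, w) else
    (p.1 = τ ∧ p.2 ∈ C k \ {u}) ∨ (p.1 = !τ ∧ u ∈ C k ∧ p.2 ≠ w)}, ?_, ?_⟩
  · rintro k l ⟨ρ, x⟩ hk hl
    simp only [Set.mem_ofPred_eq] at hk hl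
    split_ifs at hk hl <;> grind
  · intro k
    by_cases hka : k = a
    · subst hka
      simp only [ha, mem_singleton]
      rintro _ rfl _ rfl
      exact .refl (by simp)
    by_cases hkb : k = b
    · subst hkb
      simp only [hb, mem_singleton]
      rintro _ rfl _ rfl
      exact .refl (by simp [hka])
    rintro ⟨ρ, x⟩ hx ⟨ρ', y⟩ hy
    obtain rfl := hτ k _ hkb hx
    obtain rfl := hτ k _ hkb hy
    dsimp only at *
    have hu {z} (hz : (ρ', z) ∈ T k) : z ≠ u := by
      rintro rfl
      exact hka (hT.disj _ _ _ hz (by simp [ha]))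
    set E : Set (Bool × V) := {p | if k = a then p = (ρ', u) else if k = b then p = (!ρ', w) else
      (p.1 = ρ' ∧ p.2 ∈ C k \ {u}) ∨ (p.1 = !ρ' ∧ u ∈ C k ∧ p.2 ≠ w)} with hE
    have hE₁ {z} (hz : z ∈ C k \ {u}) : (ρ', z) ∈ E := by
      have hzu : z ≠ u := hz.2
      simp [hE, hka, hkb, hz.1, hzu]
    have hE₂ (hu : u ∈ C k) {z} (hz : z ≠ w) : (!ρ', z) ∈ E := by
      simp [hE, hka, hkb, hu, hz]
    rcases (hCT k x (by simp [hka, hkb, mem_side, hx]) y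
      (by simp [hka, hkb, mem_side, hy])).avoid_or_reach_both (hu hx) (hu hy) with
      h | ⟨huC, x', y', hx', hy', hxx', hyy'⟩
    · exact h.prism _ fun z => hE₁
    · have hw {z} (hz : G.Adj z u) : z ≠ w := by
        rintro rfl
        exact hadj hz
      have hxy : ConnIn G {z | z ∉ ({w} : Finset V)} x' y' :=
        hG.connIn_compl (by simpa) (by simpa using hw hx') (by simpa using hw hy')
      have hv {z} (hz : z ∈ C k \ {u}) (hzu : G.Adj z u) :
          ConnIn (prism G) E (ρ', z) (!ρ', z) :=
        connIn_prism_vertical _ (hE₁ hz) (hE₂ huC (hw hzu))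
      exact (hxx'.prism _ fun z => hE₁).trans <| (hv hxx'.right_mem hx').trans <|
        (hxy.prism _ fun z hz => hE₂ huC (by simpa using hz)).trans <|
        (hv hyy'.right_mem hy').symm.trans (hyy'.prism _ fun z => hE₁).symm

set_option maxHeartbeats 1000000 in
/-- Two far apart forbidden vertices `(τ, u)` and `(!τ, w)` in the two copies of the base, all
other terminals but one being in the copy `!τ`. -/
theorem linkable_prism_of_two_forbidden_one_terminal [Fintype κ] {N : ℕ} (hG : HasLinkages G N)
    (hN : 4 ≤ N) {T : κ → Finset (Bool × V)} (hT : IsConfig T) {τ : Bool} {u w : V}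
    (hadj : ¬G.Adj w u) {a b : κ} (hab : a ≠ b) (ha : T a = {(τ, u)}) (hb : T b = {(!τ, w)})
    {c : κ} {s : V} (hca : c ≠ a) (hcs : (τ, s) ∈ T c)
    (hs : ∀ k x, k ≠ a → (τ, x) ∈ T k → x = s)
    (hsT : ∀ k, k ≠ b → k ≠ c → (!τ, s) ∉ T k)
    (hcard : ∑ k, #(T k) ≤ N + 2) : Linkable (prism G) T := by
  classical
  have hcb : c ≠ b := by
    rintro rfl
    simp [hb] at hcs
  have hsu : s ≠ u := by
    rintro rfl
    exact hca (hT.disj _ _ _ hcs (by simp [ha]))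
  have hsc {k} (hk : (τ, s) ∈ T k) : k = c := hT.disj _ _ _ hk hcs
  have hcard_c := card_side_add T τ c
  have hside_c : side T τ c = {s} := by
    ext z
    rw [mem_side, mem_singleton]
    exact ⟨hs c z hca, fun h => h ▸ hcs⟩
  obtain ⟨C, hC, hCT⟩ := hG κ (fun k => if k = a ∨ k = b then ∅ else
      side T (!τ) k ∪ if k = c then {s} else ∅)
    ⟨fun k l x hk hl => by
      have h1 := (hT.side (!τ)).disj k l x
      have h2 := hsT k
      have h3 := hsT l
      simp only [mem_side] at h1
      split_ifs at hk hl <;> simp only [mem_union, mem_side, mem_singleton, notMem_empty,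
        or_false] at hk hl <;> grind, fun k => by
      split_ifs with h1 h2
      · simp
      · subst h2
        refine (card_union_le _ _).trans ?_
        have := hT.card_le k
        rw [hside_c, card_singleton] at hcard_c
        rw [card_singleton]
        omega
      · simpa using (hT.side (!τ)).card_le k⟩
    (by
      have h : ∑ k, (#(if k = a ∨ k = b then ∅ else side T (!τ) k ∪ if k = c then {s} else ∅) +
          if k = a ∨ k = b then 1 else 0) ≤ ∑ k, #(T k) := sum_le_sum fun k _ => by
        split_ifs with h1 h2
        · rcases h1 with rfl | rfl <;> simp [ha, hb]
        · subst h2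
          have := card_union_le (side T (!τ) k) {s}
          rw [hside_c, card_singleton] at hcard_c
          rw [card_singleton] at this
          omega
        · have := card_side_add T τ k
          rw [union_empty]
          omega
      rw [sum_add_distrib, ← card_filter] at h
      have : #{k | k = a ∨ k = b} = 2 := by
        rw [← card_pair hab]; congr 1; ext; simp
      omega)
  let E (k : κ) : Set (Bool × V) := {p | if k = a then p = (τ, u) else if k = b then p = (!τ, w) else
    (p.1 = !τ ∧ p.2 ∈ C k \ {w}) ∨
      (p.1 = τ ∧ p.2 ≠ u ∧ ((k = c ∧ p.2 = s) ∨ (w ∈ C k ∧ (k ≠ c → p.2 ≠ s))))}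
  have hE₁ {k} (hka : k ≠ a) (hkb : k ≠ b) {z} (hz : z ∈ C k \ {w}) : (!τ, z) ∈ E k := by
    have hzw : z ≠ w := hz.2
    simp [E, hka, hkb, hz.1, hzw]
  have hE₂ {k} (hka : k ≠ a) (hkb : k ≠ b) (hw : w ∈ C k) {z} (hzu : z ≠ u)
      (hzs : k ≠ c → z ≠ s) : (τ, z) ∈ E k := by
    simp only [E, hka, hkb, if_false, Set.mem_ofPred_eq]
    exact .inr ⟨trivial, hzu, .inr ⟨hw, hzs⟩⟩
  have hsE : (τ, s) ∈ E c := by simp [E, hca, hcb, hsu]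
  have hnw {z} (hz : G.Adj z w) : z ≠ u := by
    rintro rfl
    exact hadj hz.symm
  have hTw {k z} (hkb : k ≠ b) (hz : (!τ, z) ∈ T k) : z ≠ w := by
    rintro rfl
    exact hkb (hT.disj _ _ _ hz (by simp [hb]))
  have hsC : s ∈ C c := (hCT c s (by simp [hca, hcb]) s (by simp [hca, hcb])).left_mem
  refine ⟨E, ?_, ?_⟩
  · rintro k l ⟨ρ, x⟩ hk hl
    simp only [E, Set.mem_ofPred_eq] at hk hl
    clear hCT hsc hs hsT hE₁ hE₂ hsE hcard hTw hnw hcard_c hside_c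
    by_cases hka : k = a
    · subst hka
      by_cases hla : l = k <;> by_cases hlb : l = b <;> simp_all
    by_cases hla : l = a
    · subst hla
      by_cases hkb : k = b <;> simp_all
    by_cases hkb : k = b
    · subst hkb
      by_cases hlb : l = k <;> simp_all
    by_cases hlb : l = b
    · subst hlb
      simp_all
    simp only [hka, hla, hkb, hlb, if_false] at hk hl
    rcases hk with ⟨rfl, hk⟩ | ⟨rfl, -, hk⟩ <;> rcases hl with ⟨h, hl⟩ | ⟨h, -, hl⟩
    · exact hC _ _ _ hk.1 hl.1
    · simp at h
    · simp at h
    · by_contra hkl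
      rcases hk with hk | hk <;> rcases hl with hl | hl
      · exact hkl (hk.1.trans hl.1.symm)
      · exact hl.2 (fun h => hkl (hk.1.trans h.symm)) hk.2
      · exact hk.2 (fun h => hkl (h.trans hl.1.symm)) hl.2
      · exact hkl (hC _ _ _ hk.1 hl.1)
  · intro k
    by_cases hka : k = a
    · subst hka
      simp only [ha, mem_singleton]
      rintro _ rfl _ rfl
      exact .refl (by simp [E])
    by_cases hkb : k = b
    · subst hkb
      simp only [hb, mem_singleton]
      rintro _ rfl _ rfl
      exact .refl (by simp [E, hka])
    by_cases hkc : k = c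
    · subst hkc
      suffices h : ∀ p ∈ T k, ConnIn (prism G) (E k) p (τ, s) from
        fun x hx y hy => (h x hx).trans (h y hy).symm
      rintro ⟨ρ, x⟩ hx
      by_cases hρ : ρ = τ
      · subst hρ
        rw [hs k x hka hx]
        exact .refl hsE
      obtain rfl : ρ = !τ := by cases ρ <;> cases τ <;> simp_all
      have hv {z} (hz : z ∈ C k \ {w}) (hz' : (τ, z) ∈ E k) :
          ConnIn (prism G) (E k) (!τ, z) (τ, z) := by
        simpa using (connIn_prism_vertical τ hz' (hE₁ hka hkb hz)).symm (G := prism G)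
      rcases (hCT k x (by simp [hka, hkb, mem_side, hx]) s
        (by simp [hka, hkb])).avoid_or_reach (hTw hkb hx) with h | ⟨hwC, y, hy, hxy⟩
      · exact (h.prism _ fun z => hE₁ hka hkb).trans (hv h.right_mem hsE)
      · have hys : ConnIn G {z | z ∉ ({u} : Finset V)} y s :=
          hG.connIn_compl (by simp; omega) (by simpa using hnw hy) (by simpa using hsu)
        exact (hxy.prism _ fun z => hE₁ hka hkb).trans <|
          (hv hxy.right_mem (hE₂ hka hkb hwC (hnw hy) (by simp))).trans <|
          hys.prism _ fun z hz => hE₂ hka hkb hwC (by simpa using hz) (by simp)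
    · rintro ⟨ρ, x⟩ hx ⟨ρ', y⟩ hy
      have hρ {σ z} (hz : (σ, z) ∈ T k) : σ = !τ := by
        by_contra h
        obtain rfl : σ = τ := by cases σ <;> cases τ <;> simp_all
        obtain rfl := hs k z hka hz
        exact hkc (hsc hz)
      obtain rfl := hρ hx
      obtain rfl := hρ hy
      rcases (hCT k x (by simp [hka, hkb, mem_side, hx]) y
        (by simp [hka, hkb, mem_side, hy])).avoid_or_reach_both (hTw hkb hx) (hTw hkb hy) with
        h | ⟨hwC, x', y', hx', hy', hxx', hyy'⟩
      · exact h.prism _ fun z => hE₁ hka hkb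
      · have hns {z} (hz : z ∈ C k \ {w}) : z ≠ s := by
          rintro rfl
          exact hkc (hC _ _ _ hz.1 hsC)
        have hxy : ConnIn G {z | z ∉ ({u, s} : Finset V)} x' y' :=
          hG.connIn_compl (by have := card_le_two (a := u) (b := s); omega)
            (by simp [hnw hx', hns hxx'.right_mem]) (by simp [hnw hy', hns hyy'.right_mem])
        have hv {z} (hz : z ∈ C k \ {w}) (hzw : G.Adj z w) :
            ConnIn (prism G) (E k) (!τ, z) (τ, z) := by
          simpa using (connIn_prism_vertical τ (hE₂ hka hkb hwC (hnw hzw) fun _ => hns hz)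
            (hE₁ hka hkb hz)).symm (G := prism G)
        exact (hxx'.prism _ fun z => hE₁ hka hkb).trans <| (hv hxx'.right_mem hx').trans <|
          (hxy.prism _ fun z hz => by
            simp only [mem_insert, mem_singleton, not_or, Set.mem_ofPred_eq] at hz
            exact hE₂ hka hkb hwC hz.1 fun _ => hz.2).trans <|
          (hv hyy'.right_mem hy').symm.trans (hyy'.prism _ fun z => hE₁ hka hkb).symm

set_option maxHeartbeats 1000000 in
/-- Two far apart forbidden vertices `(τ, u)` and `(!τ, w)` in the two copies of the base, no two
other terminals of different sets being joined by a vertical edge. -/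
theorem linkable_prism_of_two_forbidden [Fintype κ] {N : ℕ} (hG : HasLinkages G N)
    (hN : 6 ≤ N) {T : κ → Finset (Bool × V)} (hT : IsConfig T) {τ : Bool} {u w : V}
    (hadj : ¬G.Adj w u) {a b : κ} (hab : a ≠ b) (ha : T a = {(τ, u)}) (hb : T b = {(!τ, w)})
    (hdeg : ∀ F : Finset V, #F + 2 ≤ N → ∃ x, G.Adj u x ∧ x ∉ F)
    (hedge : ∀ σ k l x, k ≠ l → k ≠ a → k ≠ b → l ≠ a → l ≠ b → (σ, x) ∈ T k → (!σ, x) ∉ T l)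
    (hside : ∀ σ, 3 ≤ ∑ k, #(side T σ k)) (hcard : ∑ k, #(T k) ≤ N + 2) :
    Linkable (prism G) T := by
  classical
  have hca : ¬Crosses T a := fun h => by simpa [ha] using h.two_le
  have hcb : ¬Crosses T b := fun h => by simpa [hb] using h.two_le
  have hside' (σ) : ∑ k, #(side T σ k) + 3 ≤ N + 2 := by
    have := sum_side_add T σ
    have := hside (!σ)
    omega
  have hfτ {k} (hk : k ∈ forced T τ) : (τ, w) ∈ T k := by
    obtain ⟨hc, x, l, hkl, hxk, hxl⟩ := mem_forced.1 hk
    have hka : k ≠ a := fun h => hca (h ▸ hc)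
    have hkb : k ≠ b := fun h => hcb (h ▸ hc)
    by_cases hla : l = a
    · simp [hla, ha] at hxl
    by_cases hlb : l = b
    · simp only [hlb, hb, mem_singleton, Prod.mk.injEq, true_and] at hxl
      exact hxl ▸ hxk
    · exact absurd hxl (hedge τ k l x hkl hka hkb hla hlb hxk)
  have hfτ' {k} (hk : k ∈ forced T (!τ)) : (!τ, u) ∈ T k := by
    obtain ⟨hc, x, l, hkl, hxk, hxl⟩ := mem_forced.1 hk
    have hka : k ≠ a := fun h => hca (h ▸ hc)
    have hkb : k ≠ b := fun h => hcb (h ▸ hc)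
    by_cases hla : l = a
    · simp only [hla, ha, mem_singleton, Prod.mk.injEq, Bool.not_not, true_and] at hxl
      exact hxl ▸ hxk
    by_cases hlb : l = b
    · simp [hlb, hb] at hxl
    · exact absurd hxl (hedge _ k l x hkl hka hkb hla hlb hxk)
  by_cases hk₀ : ∃ k, (τ, w) ∈ T k ∧ (!τ, u) ∈ T k
  · obtain ⟨k₀, hw₀, hu₀⟩ := hk₀
    have hk₀a : k₀ ≠ a := by
      rintro rfl
      simp [ha] at hu₀
    have hk₀b : k₀ ≠ b := by
      rintro rfl
      simp [hb] at hw₀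
    have hTk₀ : T k₀ = {(τ, w), (!τ, u)} :=
      (eq_of_subset_of_card_le (by simp [insert_subset_iff, hw₀, hu₀])
        ((hT.card_le k₀).trans (by rw [card_pair (by simp)]))).symm
    obtain ⟨x₀, hux₀, hx₀⟩ := hdeg
      ((univ.filter fun k => k ∉ ({k₀, a, b} : Finset κ)).biUnion fun k => (T k).image Prod.snd) (by
        have h2 : ∑ k with k ∉ ({k₀, a, b} : Finset κ), #(T k) + ∑ k ∈ {k₀, a, b}, #(T k) =
            ∑ k, #(T k) := by
          rw [add_comm, ← sum_filter_add_sum_filter_not univ (· ∈ ({k₀, a, b} : Finset κ))]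
          congr 2
          ext; simp
        rw [sum_insert (by simp [hk₀a, hk₀b]), sum_pair hab, ha, hb, hTk₀, card_pair (by simp),
          card_singleton, card_singleton] at h2
        have h3 := card_biUnion_le (s := univ.filter fun k => k ∉ ({k₀, a, b} : Finset κ))
          (t := fun k => (T k).image Prod.snd)
        have h4 : ∑ k with k ∉ ({k₀, a, b} : Finset κ), #((T k).image Prod.snd) ≤
          ∑ k with k ∉ ({k₀, a, b} : Finset κ), #(T k) := sum_le_sum fun k _ => card_image_le
        omega)
    have hx₀u : x₀ ≠ u := hux₀.ne'
    have hx₀w : x₀ ≠ w := by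
      rintro rfl
      exact hadj hux₀.symm
    have hne₁ : (!τ, x₀) ≠ (!τ, u) := by simp [hx₀u]
    have hne₂ : (τ, w) ≠ (τ, x₀) := by simp [hx₀w.symm]
    have hnew (σ k) : (σ, x₀) ∉ T k := fun h => by
      by_cases hk : k ∈ ({k₀, a, b} : Finset κ)
      · simp only [mem_insert, mem_singleton] at hk
        rcases hk with rfl | rfl | rfl
        · simp [hTk₀, hx₀u, hx₀w] at h
        · simp [ha, hx₀u] at h
        · simp [hb, hx₀w] at h
      · exact hx₀ (mem_biUnion.2 ⟨k, by simpa using hk, mem_image.2 ⟨_, h, rfl⟩⟩)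
    let T' (K : Option κ) : Finset (Bool × V) := K.elim {(!τ, x₀), (!τ, u)} fun k =>
      if k = k₀ then {(τ, w), (τ, x₀)} else T k
    have hT'n : T' none = {(!τ, x₀), (!τ, u)} := rfl
    have hT'₀ : T' (some k₀) = {(τ, w), (τ, x₀)} := by simp [T']
    have hT's {k} (hk : k ≠ k₀) : T' (some k) = T k := by simp [T', hk]
    have hnone {k p} (hk : k ≠ k₀) (hp : p ∈ T k) : p ∉ T' none := by
      rw [hT'n]
      simp only [mem_insert, mem_singleton]
      rintro (rfl | rfl)
      · exact hnew _ _ hp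
      · exact hk (hT.disj _ _ _ hp hu₀)
    have hsome {k p} (hk : k ≠ k₀) (hp : p ∈ T k) : p ∉ T' (some k₀) := by
      rw [hT'₀]
      simp only [mem_insert, mem_singleton]
      rintro (rfl | rfl)
      · exact hk (hT.disj _ _ _ hp hw₀)
      · exact hnew _ _ hp
    have hdisj' : ∀ p, p ∈ T' none → p ∉ T' (some k₀) := by
      rw [hT'n, hT'₀]
      simp
    have hT' : IsConfig T' := by
      refine ⟨?_, ?_⟩
      · have H (k p) (hk : p ∈ T' (some k)) : p ∉ T' none := fun h => by
          by_cases hkk : k = k₀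
          · subst hkk
            exact hdisj' p h hk
          · exact hnone hkk (hT's hkk ▸ hk) h
        rintro (_ | k) (_ | l) p hk hl
        · rfl
        · exact absurd hk (H l p hl)
        · exact absurd hl (H k p hk)
        · by_cases hkk : k = k₀ <;> by_cases hlk : l = k₀
          · rw [hkk, hlk]
          · rw [hT's hlk] at hl
            exact absurd (hkk ▸ hk) (hsome hlk hl)
          · rw [hT's hkk] at hk
            exact absurd (hlk ▸ hl) (hsome hkk hk)
          · rw [hT's hkk] at hk
            rw [hT's hlk] at hl
            rw [hT.disj _ _ _ hk hl]
      · rintro (_ | k)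
        · exact card_le_two
        · by_cases hkk : k = k₀
          · rw [hkk, hT'₀]
            exact card_le_two
          · rw [hT's hkk]
            exact hT.card_le k
    have hcn : ¬Crosses T' none := fun h => by
      obtain ⟨x, hx⟩ := h τ
      simp [mem_side, hT'n] at hx
    have hc₀ : ¬Crosses T' (some k₀) := fun h => by
      obtain ⟨x, hx⟩ := h (!τ)
      simp [mem_side, hT'₀] at hx
    have hca' : ¬Crosses T' (some a) := fun h => by
      have := h.two_le
      simp [hT's hk₀a.symm, ha] at this
    have hcb' : ¬Crosses T' (some b) := fun h => by
      have := h.two_le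
      simp [hT's hk₀b.symm, hb] at this
    have hforced (σ) : forced T' σ = ∅ := by
      refine eq_empty_iff_forall_notMem.2 fun K hK => ?_
      obtain ⟨hc, x, L, hKL, hxK, hxL⟩ := mem_forced.1 hK
      obtain _ | k := K
      · exact hcn hc
      have hkk : k ≠ k₀ := fun h => hc₀ (h ▸ hc)
      have hka : k ≠ a := fun h => hca' (h ▸ hc)
      have hkb : k ≠ b := fun h => hcb' (h ▸ hc)
      rw [hT's hkk] at hxK
      have hxx : x ≠ x₀ := fun h => hnew σ k (h ▸ hxK)
      obtain _ | l := L
      · simp only [hT'n, mem_insert, mem_singleton, Prod.mk.injEq, hxx, and_false, false_or,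
          Bool.not_inj_iff] at hxL
        obtain ⟨rfl, rfl⟩ := hxL
        exact hka (hT.disj _ _ _ hxK (by simp [ha]))
      by_cases hlk : l = k₀
      · simp only [hlk, hT'₀, mem_insert, mem_singleton, Prod.mk.injEq, hxx, and_false, or_false,
          Bool.not_eq_eq_eq_not] at hxL
        obtain ⟨rfl, rfl⟩ := hxL
        exact hkb (hT.disj _ _ _ hxK (by simp [hb]))
      rw [hT's hlk] at hxL
      by_cases hla : l = a
      · simp only [hla, ha, mem_singleton, Prod.mk.injEq, Bool.not_eq_eq_eq_not] at hxL
        obtain ⟨rfl, rfl⟩ := hxL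
        exact hkk (hT.disj _ _ _ hxK hu₀)
      by_cases hlb : l = b
      · simp only [hlb, hb, mem_singleton, Prod.mk.injEq, Bool.not_inj_iff] at hxL
        obtain ⟨rfl, rfl⟩ := hxL
        exact hkk (hT.disj _ _ _ hxK hw₀)
      exact hedge σ k l x (fun h => hKL (h ▸ rfl)) hka hkb hla hlb hxK hxL
    have hsum (f : Finset (Bool × V) → ℕ) :
        ∑ K, f (T' K) + f (T k₀) = f (T' none) + f (T' (some k₀)) + ∑ k, f (T k) := by
      have h1 := add_sum_erase univ (fun k => f (T k)) (mem_univ k₀)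
      have h2 := add_sum_erase univ (fun k => f (T' (some k))) (mem_univ k₀)
      have h3 : ∑ k ∈ univ.erase k₀, f (T' (some k)) = ∑ k ∈ univ.erase k₀, f (T k) :=
        sum_congr rfl fun k hk => by rw [hT's (ne_of_mem_erase hk)]
      rw [Fintype.sum_option]
      omega
    have hsum_side (σ) : ∑ K, #(side T' σ K) ≤ N := by
      have h1 := hsum fun S => #((S.filter fun p => p.1 = σ).image Prod.snd)
      change ∑ K, #(side T' σ K) + #(side T σ k₀) = #(side T' σ none) + #(side T' σ (some k₀)) +
        ∑ k, #(side T σ k) at h1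
      have h2 := hside' σ
      have h3 : 1 ≤ #(side T σ k₀) := by
        by_cases h : σ = τ
        · subst h
          exact card_pos.2 ⟨w, mem_side.2 hw₀⟩
        · obtain rfl : σ = !τ := by cases σ <;> cases τ <;> simp_all
          exact card_pos.2 ⟨u, mem_side.2 hu₀⟩
      have h4 : #(side T' σ none) + #(side T' σ (some k₀)) ≤ 2 := by
        by_cases h : σ = τ
        · subst h
          have h5 : side T' σ none = ∅ := by ext; simp [mem_side, hT'n]
          have := (hT'.side σ).card_le (some k₀)
          rw [h5, card_empty]
          omega
        · obtain rfl : σ = !τ := by cases σ <;> cases τ <;> simp_all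
          have h5 : side T' (!τ) (some k₀) = ∅ := by ext; simp [mem_side, hT'₀]
          have := (hT'.side (!τ)).card_le none
          rw [h5, card_empty]
          omega
      omega
    have hcard' : ∑ K, #(T' K) ≤ N + 4 := by
      have h1 := hsum card
      rw [hT'n, hT'₀, hTk₀, card_pair hne₁, card_pair hne₂,
        card_pair (by simp)] at h1
      omega
    obtain ⟨C, hC, hCT⟩ := linkable_prism_of_forced hG hT' (by simp [hforced])
      (fun σ => by simpa [hforced] using hsum_side σ) (by
        have h1 := two_mul_card_crosses_add_sum_le T' {none, some k₀, some a, some b} (by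
          simp only [mem_insert, mem_singleton]
          rintro K (rfl | rfl | rfl | rfl) <;> assumption)
        rw [sum_insert (by simp), sum_insert (by simp [hk₀a, hk₀b]), sum_pair (by simpa using hab),
          hT'n, hT'₀, hT's hk₀a.symm, hT's hk₀b.symm, ha, hb, card_pair hne₁,
          card_pair hne₂, card_singleton, card_singleton] at h1
        omega)
    refine ⟨fun k => {p | p ∈ C (some k) ∨ k = k₀ ∧ p ∈ C none}, ?_, fun k => ?_⟩
    · rintro k l p (hk | ⟨rfl, hk⟩) (hl | ⟨rfl, hl⟩)
      · simpa using hC _ _ _ hk hl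
      · simpa using hC _ _ _ hk hl
      · simpa using hC _ _ _ hk hl
      · rfl
    · by_cases hkk : k = k₀
      · subst hkk
        simp only [true_and]
        suffices h : ∀ p ∈ T k, ConnIn (prism G) {p | p ∈ C (some k) ∨ p ∈ C none} p (τ, x₀)
          from fun x hx y hy => (h x hx).trans (h y hy).symm
        rw [hTk₀]
        simp only [mem_insert, mem_singleton]
        have h1 := hCT (some k) (τ, w) (by simp [hT'₀]) (τ, x₀) (by simp [hT'₀])
        have h2 := hCT none (!τ, u) (by simp [hT'n]) (!τ, x₀) (by simp [hT'n])
        rintro p (rfl | rfl)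
        · exact h1.mono fun z hz => .inl hz
        · exact (h2.mono fun z hz => .inr hz).trans
            (connIn_prism_vertical τ (.inl h1.right_mem) (.inr h2.right_mem)).symm
      · intro x hx y hy
        exact (hCT (some k) x (by rwa [hT's hkk]) y (by rwa [hT's hkk])).mono fun z hz => .inl hz
  · refine linkable_prism_of_forced hG hT ?_ (fun σ => ?_) ?_
    · refine Finset.disjoint_left.2 fun k h0 h1 => hk₀ ⟨k, ?_⟩
      cases τ
      exacts [⟨hfτ h0, hfτ' h1⟩, ⟨hfτ h1, hfτ' h0⟩]
    · have h1 : #(forced T σ) ≤ 1 := card_le_one_iff.2 fun {k l} hk hl => by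
        by_cases h : σ = τ
        · subst h
          exact hT.disj _ _ _ (hfτ hk) (hfτ hl)
        · obtain rfl : σ = !τ := by cases σ <;> cases τ <;> simp_all
          exact hT.disj _ _ _ (hfτ' hk) (hfτ' hl)
      have := hside' σ
      omega
    · have h1 := two_mul_card_crosses_add_sum_le T {a, b} (by
        simp only [mem_insert, mem_singleton]
        rintro K (rfl | rfl) <;> assumption)
      rw [sum_pair hab, ha, hb, card_singleton, card_singleton] at h1
      omega

/-- Two far apart forbidden vertices `(τ, u)` and `(!τ, w)` in the two copies of the base, at most
one further terminal being in the copy `τ`. -/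
theorem linkable_prism_of_two_forbidden_of_sum_side_le [Fintype κ] {N : ℕ} (hG : HasLinkages G N)
    (hN : 4 ≤ N) {T : κ → Finset (Bool × V)} (hT : IsConfig T) {τ : Bool} {u w : V}
    (hadj : ¬G.Adj w u) {a b : κ} (hab : a ≠ b) (ha : T a = {(τ, u)}) (hb : T b = {(!τ, w)})
    (hedge : ∀ σ k l x, k ≠ l → k ≠ a → k ≠ b → l ≠ a → l ≠ b → (σ, x) ∈ T k → (!σ, x) ∉ T l)
    (hside : ∑ k, #(side T τ k) ≤ 2) (hcard : ∑ k, #(T k) ≤ N + 2) : Linkable (prism G) T := by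
  classical
  have hle : #((univ.erase a).biUnion (side T τ)) ≤ 1 := by
    have h1 := add_sum_erase univ (fun k => #(side T τ k)) (mem_univ a)
    have h2 : 0 < #(side T τ a) := card_pos.2 ⟨u, mem_side.2 (by simp [ha])⟩
    have h3 := card_biUnion_le (s := univ.erase a) (t := side T τ)
    omega
  have hmem {k x} (hk : k ≠ a) (hx : (τ, x) ∈ T k) : x ∈ (univ.erase a).biUnion (side T τ) :=
    mem_biUnion.2 ⟨k, by simpa using hk, mem_side.2 hx⟩
  by_cases h : ∃ c s, c ≠ a ∧ (τ, s) ∈ T c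
  · obtain ⟨c, s, hca, hcs⟩ := h
    refine linkable_prism_of_two_forbidden_one_terminal hG hN hT hadj hab ha hb hca hcs
      (fun k x hk hx => card_le_one.1 hle x (hmem hk hx) s (hmem hca hcs))
      (fun k hkb hkc hk => ?_) hcard
    by_cases hka : k = a
    · simp [hka, ha] at hk
    · refine hedge τ c k s (Ne.symm hkc) hca ?_ hka hkb hcs hk
      rintro rfl
      simp [hb] at hcs
  · push Not at h
    refine linkable_prism_of_two_forbidden_one_side hG (by omega) hT
      (fun h => hadj h.symm) hab.symm hb (by simpa using ha) (fun k p hk hp => ?_) hcard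
    by_contra hpτ
    have hpτ : p.1 = τ := by simpa using hpτ
    exact h k p.2 hk (hpτ ▸ hp)

end Prism

/-- **Bondy's theorem** on induced subsets: at most `|ι|` vertices of a cube remain distinct after
deleting a suitable coordinate. -/
theorem exists_coordinate_injective {ι : Type*} [Fintype ι] [Nonempty ι] (Y : Finset (ι → Bool))
    (hY : #Y ≤ Fintype.card ι) :
    ∃ i, ∀ x ∈ Y, ∀ y ∈ Y, (∀ j, j ≠ i → x j = y j) → x = y := by
  classical
  by_contra! h
  let r (D : Finset ι) (x : ι → Bool) : ι → Bool := fun j => if j ∈ D then false else x j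
  have key (D : Finset ι) : #(Y.image (r D)) + #D ≤ #Y := by
    induction D using Finset.induction_on with
    | empty => simpa using card_image_le
    | insert i D hi ih =>
      obtain ⟨x, hx, y, hy, hxy, hne⟩ := h i
      have hr (z) : r (insert i D) z = r {i} (r D z) := by
        ext j
        by_cases hj : j = i <;> simp [r, hj]
      have himage : Y.image (r (insert i D)) = (Y.image (r D)).image (r {i}) := by
        rw [image_image]
        exact image_congr fun z _ => hr z
      have hlt : #((Y.image (r D)).image (r {i})) < #(Y.image (r D)) := by
        refine lt_of_le_of_ne card_image_le fun heq => ?_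
        have hinj := card_image_iff.1 heq (mem_coe.2 (mem_image_of_mem (r D) hx))
          (mem_coe.2 (mem_image_of_mem (r D) hy)) (by
            ext j
            by_cases hj : j = i
            · simp [r, hj]
            · simp [r, hj, hxy j hj])
        refine hne (funext fun j => ?_)
        by_cases hj : j = i
        · subst hj
          simpa [r, hi] using congrFun hinj j
        · exact hxy j hj
      rw [himage, card_insert_of_notMem hi]
      omega
  obtain ⟨x, hx, -⟩ := h (Classical.arbitrary ι)
  have h1 := key univ
  have h2 := card_pos.2 ⟨_, mem_image_of_mem (r univ) hx⟩
  rw [card_univ] at h1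
  omega

/-- Splitting off the coordinate `i` exhibits a cube as a prism. -/
def cubeIsoPrism {n : ℕ} (i : Fin (n + 1)) : cubeGraph (n + 1) ≃g prism (cubeGraph n) where
  toEquiv := (Fin.insertNthEquiv (fun _ => Bool) i).symm
  map_rel_iff' {x y} := by
    have h : hammingDist x y = (if x i ≠ y i then 1 else 0) +
        hammingDist (fun j => x (i.succAbove j)) fun j => y (i.succAbove j) := by
      simp only [hammingDist, card_filter, Fin.sum_univ_succAbove _ i]
    have h0 : (fun j => x (i.succAbove j)) = (fun j => y (i.succAbove j)) ↔
        hammingDist (fun j => x (i.succAbove j)) (fun j => y (i.succAbove j)) = 0 :=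
      hammingDist_eq_zero.symm
    simp only [SimpleGraph.boxProd_adj, Fin.insertNthEquiv_symm_apply,
      SimpleGraph.top_adj, cubeGraph, h]
    change (x i ≠ y i ∧ (fun j => x (i.succAbove j)) = (fun j => y (i.succAbove j)) ∨
      hammingDist (fun j => x (i.succAbove j)) (fun j => y (i.succAbove j)) = 1 ∧ x i = y i) ↔ _
    rw [h0]
    by_cases hi : x i = y i <;> simp [hi]

theorem cubeIsoPrism_apply {n : ℕ} (i : Fin (n + 1)) (x : Fin (n + 1) → Bool) :
    cubeIsoPrism i x = (x i, fun j => x (i.succAbove j)) := rfl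

theorem IsConfig.map {V W κ : Type} {T : κ → Finset V} (hT : IsConfig T) (f : V ↪ W) :
    IsConfig fun k => (T k).map f where
  disj k l x hk hl := by
    obtain ⟨y, hy, rfl⟩ := mem_map.1 hk
    exact hT.disj k l y hy ((mem_map' f).1 hl)
  card_le k := by simpa using hT.card_le k

theorem mem_map_cubeIsoPrism {n : ℕ} {i : Fin (n + 1)} {S : Finset (Fin (n + 1) → Bool)} {τ : Bool}
    {x : Fin n → Bool} :
    (τ, x) ∈ S.map (cubeIsoPrism i).toEquiv.toEmbedding ↔ i.insertNth (α := fun _ => Bool) τ x ∈ S :=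
  mem_map_equiv

/-- Passing to the next cube allows one more terminal. -/
theorem HasLinkages.cubeGraph_succ {m : ℕ} (hm : 3 ≤ m) (h : HasLinkages (cubeGraph m) (m + 1)) :
    HasLinkages (cubeGraph (m + 1)) (m + 2) := by
  classical
  intro κ _ T hT hcard
  let X : Finset (Fin (m + 1) → Bool) := univ.biUnion T
  have memX {k p} (hp : p ∈ T k) : p ∈ X := mem_biUnion.2 ⟨k, mem_univ _, hp⟩
  rcases X.eq_empty_or_nonempty with hX | ⟨y, hy⟩
  · exact linkable_of_forall_eq_empty fun k =>
      eq_empty_iff_forall_notMem.2 fun p hp => by simpa [hX] using memX hp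
  obtain ⟨i, hi⟩ := exists_coordinate_injective (X.erase y) (by
    have h1 : #X ≤ ∑ k, #(T k) := card_biUnion_le
    rw [card_erase_of_mem hy, Fintype.card_fin]
    omega)
  refine .of_iso (cubeIsoPrism i) ?_
  have hT' := hT.map (cubeIsoPrism i).toEquiv.toEmbedding
  set T' := fun k => (T k).map (cubeIsoPrism i).toEquiv.toEmbedding with hTT'
  have hcard' : ∑ k, #(T' k) ≤ m + 1 + 1 := by simpa [hTT'] using hcard
  by_cases hside : ∀ τ, 1 ≤ ∑ k, #(side T' τ k)
  · refine linkable_prism_of_one_edge h (by omega) hT' (cubeIsoPrism i y).2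
      (fun τ k l x hkl hk hl => ?_) hside hcard'
    rw [hTT', mem_map_cubeIsoPrism] at hk hl
    have hyx {σ} (h : i.insertNth (α := fun _ => Bool) σ x = y) : x = (cubeIsoPrism i y).2 := by
      rw [← h, cubeIsoPrism_apply]
      simp
    by_contra hx
    have := hi _ (mem_erase.2 ⟨fun h => hx (hyx h), memX hk⟩) _
      (mem_erase.2 ⟨fun h => hx (hyx h), memX hl⟩) fun j hj => by
        obtain ⟨j, rfl⟩ := Fin.exists_succAbove_eq hj
        simp
    simpa using congrFun this i
  · push Not at hside
    obtain ⟨τ, hτ⟩ := hside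
    refine linkable_prism_of_one_side h (by omega) hT' (!τ) (fun k p hp => ?_) hcard'
    by_contra hpτ
    have hpτ : p.1 = τ := by simpa using hpτ
    have h1 := single_le_sum (f := fun k => #(side T' τ k)) (fun _ _ => Nat.zero_le _) (mem_univ k)
    have h2 : 0 < #(side T' τ k) := card_pos.2 ⟨p.2, mem_side.2 (by rwa [← hpτ])⟩
    omega

section Base

/-- Adjacency in the four-dimensional cube, its vertices being encoded by their binary digits. -/
def codeAdj (x y : ℕ) : Bool := x ^^^ y == 1 || x ^^^ y == 2 || x ^^^ y == 4 || x ^^^ y == 8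

/-- Every entry of the list but the last is adjacent to a later entry. -/
def chainConnected : List ℕ → Bool
  | [] => true
  | x :: l => (l.isEmpty || l.any (codeAdj x)) && chainConnected l

/-- Permuting the coordinates of the four-dimensional cube. -/
def permCode (w : List ℕ) (x : ℕ) : ℕ :=
  x % 2 * w.getD 0 0 + x / 2 % 2 * w.getD 1 0 + x / 4 % 2 * w.getD 2 0 + x / 8 * w.getD 3 0

/-- Up to permutations of the coordinates, two partitions of the four-dimensional cube without the
origin into two connected parts. -/
def splittings : List (List ℕ × List ℕ) :=
  ([1, 2, 4, 8].permutations').flatMap fun w =>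
    [([8, 11, 6, 7, 5, 1, 9], [3, 2, 10, 4, 13, 15, 12, 14]),
     ([10, 2, 7, 3, 1, 9, 4, 12, 8], [5, 13, 6, 14, 11, 15])].map fun p =>
      (p.1.map (permCode w), p.2.map (permCode w))

theorem splittings_valid : (splittings.all fun p => chainConnected p.1 && chainConnected p.2 &&
    p.1.all (fun x => 0 < x && x < 16 && !p.2.elem x) && p.2.all fun x => 0 < x && x < 16) := by
  decide +kernel

theorem splittings_cover : (List.range' 1 15).all fun a => (List.range' a (16 - a)).all fun b =>
    (List.range' (a + 1) (15 - a)).all fun c => (List.range' c (16 - c)).all fun d =>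
      b == c || b == d || splittings.any fun p =>
        (p.1.elem a && p.1.elem b && p.2.elem c && p.2.elem d) ||
        (p.2.elem a && p.2.elem b && p.1.elem c && p.1.elem d) := by
  decide +kernel

theorem exists_splitting {a b c d : ℕ} (ha : 0 < a ∧ a < 16) (hb : 0 < b ∧ b < 16)
    (hc : 0 < c ∧ c < 16) (hd : 0 < d ∧ d < 16) (hac : a ≠ c) (had : a ≠ d) (hbc : b ≠ c)
    (hbd : b ≠ d) : ∃ p ∈ splittings, (a ∈ p.1 ∧ b ∈ p.1 ∧ c ∈ p.2 ∧ d ∈ p.2) ∨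
      (a ∈ p.2 ∧ b ∈ p.2 ∧ c ∈ p.1 ∧ d ∈ p.1) := by
  wlog hab : a ≤ b generalizing a b
  · obtain ⟨p, hp, h⟩ := this hb ha hbc hbd hac had (by omega)
    exact ⟨p, hp, by tauto⟩
  wlog hcd : c ≤ d generalizing c d
  · obtain ⟨p, hp, h⟩ := this hd hc had hac hbd hbc (by omega)
    exact ⟨p, hp, by tauto⟩
  wlog hac' : a < c generalizing a b c d
  · obtain ⟨p, hp, h⟩ := this hc hd hcd ha hb hac.symm hbc.symm had.symm hbd.symm hab (by omega)
    exact ⟨p, hp, by tauto⟩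
  have h := splittings_cover
  simp only [List.all_eq_true, List.mem_range'_1, List.any_eq_true, Bool.or_eq_true,
    Bool.and_eq_true, List.elem_eq_mem, decide_eq_true_eq, beq_iff_eq] at h
  rcases h a (by omega) b (by omega) c (by omega) d (by omega) with (h | h) | ⟨p, hp, h⟩
  · exact absurd h hbc
  · exact absurd h hbd
  · exact ⟨p, hp, by tauto⟩

/-- The vertex of the four-dimensional cube with code `x` when `u` is taken as the origin. -/
def decode (u : Fin 4 → Bool) (x : ℕ) : Fin 4 → Bool := fun j => (u j).xor (x.testBit j)

theorem decode_zero (u : Fin 4 → Bool) : decode u 0 = u := by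
  ext j
  simp [decode]

theorem exists_decode_eq (u z : Fin 4 → Bool) : ∃ x < 16, decode u x = z := by
  have h : ∀ g : Fin 4 → Bool, ∃ x < 16, ∀ j : Fin 4, x.testBit j = g j := by decide
  obtain ⟨x, hx, hxz⟩ := h fun j => (u j).xor (z j)
  exact ⟨x, hx, funext fun j => by simp [decode, hxz]⟩

theorem decode_injOn (u : Fin 4 → Bool) {x y : ℕ} (hx : x < 16) (hy : y < 16)
    (h : decode u x = decode u y) : x = y := by
  have key : ∀ x < 16, ∀ y < 16, (∀ j : Fin 4, x.testBit j = y.testBit j) → x = y := by decide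
  exact key x hx y hy fun j => by simpa [decode] using congrFun h j

theorem adj_decode (u : Fin 4 → Bool) {x y : ℕ} (hx : x < 16) (hy : y < 16)
    (h : codeAdj x y) : (cubeGraph 4).Adj (decode u x) (decode u y) := by
  have key : ∀ x < 16, ∀ y < 16, codeAdj x y → #{j : Fin 4 | x.testBit j ≠ y.testBit j} = 1 := by
    decide +kernel
  change hammingDist _ _ = 1
  rw [← key x hx y hy h]
  simp [hammingDist, decode]

theorem connIn_of_chainConnected (u : Fin 4 → Bool) {S : Set (Fin 4 → Bool)} {l : List ℕ}
    (hl : chainConnected l) (hlt : ∀ x ∈ l, x < 16) (hS : ∀ x ∈ l, decode u x ∈ S) {x y : ℕ}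
    (hx : x ∈ l) (hy : y ∈ l) : ConnIn (cubeGraph 4) S (decode u x) (decode u y) := by
  induction l generalizing x y with
  | nil => simp at hx
  | cons a l ih =>
    simp only [chainConnected, Bool.and_eq_true, Bool.or_eq_true, List.isEmpty_iff,
      List.any_eq_true] at hl
    have ih {x y} := @ih hl.2 (fun x hx => hlt x (by simp [hx])) (fun x hx => hS x (by simp [hx]))
      x y
    have ha {z} (hz : z ∈ l) : ConnIn (cubeGraph 4) S (decode u a) (decode u z) := by
      rcases hl.1 with h | ⟨b, hb, hab⟩
      · simp [h] at hz
      · exact (ConnIn.of_adj (adj_decode u (hlt a (by simp)) (hlt b (by simp [hb])) hab)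
          (hS a (by simp)) (hS b (by simp [hb]))).trans (ih hb hz)
    have haa : ConnIn (cubeGraph 4) S (decode u a) (decode u a) := .refl (hS _ (by simp))
    have hall {z} (hz : z ∈ a :: l) : ConnIn (cubeGraph 4) S (decode u a) (decode u z) := by
      rcases List.mem_cons.1 hz with rfl | hz
      exacts [haa, ha hz]
    exact (hall hx).symm.trans (hall hy)

theorem exists_connIn_cubeGraph_four {u s₁ t₁ s₂ t₂ : Fin 4 → Bool} (hs₁ : s₁ ≠ u) (ht₁ : t₁ ≠ u)
    (hs₂ : s₂ ≠ u) (ht₂ : t₂ ≠ u) (hss : s₁ ≠ s₂) (hst : s₁ ≠ t₂) (hts : t₁ ≠ s₂) (htt : t₁ ≠ t₂) :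
    ∃ C₁ C₂ : Set (Fin 4 → Bool), (∀ x ∈ C₁, x ∉ C₂) ∧ u ∉ C₁ ∧ u ∉ C₂ ∧
      ConnIn (cubeGraph 4) C₁ s₁ t₁ ∧ ConnIn (cubeGraph 4) C₂ s₂ t₂ := by
  have code (z) (hz : z ≠ u) : ∃ x, (0 < x ∧ x < 16) ∧ decode u x = z := by
    obtain ⟨x, hx, rfl⟩ := exists_decode_eq u z
    refine ⟨x, ⟨Nat.pos_of_ne_zero ?_, hx⟩, rfl⟩
    rintro rfl
    exact hz (decode_zero u)
  obtain ⟨a, ha, rfl⟩ := code s₁ hs₁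
  obtain ⟨b, hb, rfl⟩ := code t₁ ht₁
  obtain ⟨c, hc, rfl⟩ := code s₂ hs₂
  obtain ⟨d, hd, rfl⟩ := code t₂ ht₂
  obtain ⟨p, hp, h⟩ := exists_splitting ha hb hc hd (ne_of_apply_ne _ hss) (ne_of_apply_ne _ hst)
    (ne_of_apply_ne _ hts) (ne_of_apply_ne _ htt)
  have hv := splittings_valid
  simp only [List.all_eq_true, Bool.and_eq_true, List.elem_eq_mem, decide_eq_true_eq,
    Bool.not_eq_true', decide_eq_false_iff_not] at hv
  obtain ⟨⟨⟨h₁, h₂⟩, h₃⟩, h₄⟩ := hv p hp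
  let S (l : List ℕ) : Set (Fin 4 → Bool) := {z | ∃ x ∈ l, decode u x = z}
  have hdisj : ∀ z ∈ S p.1, z ∉ S p.2 := by
    rintro _ ⟨x, hx, rfl⟩ ⟨y, hy, hxy⟩
    obtain rfl := decode_injOn u (h₄ y hy).2 (h₃ x hx).1.2 hxy
    exact (h₃ y hx).2 hy
  have hu₁ : u ∉ S p.1 := by
    rintro ⟨x, hx, hxu⟩
    have := decode_injOn u (h₃ x hx).1.2 (by simp) (hxu.trans (decode_zero u).symm)
    have := (h₃ x hx).1.1
    omega
  have hu₂ : u ∉ S p.2 := by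
    rintro ⟨x, hx, hxu⟩
    have := decode_injOn u (h₄ x hx).2 (by simp) (hxu.trans (decode_zero u).symm)
    have := (h₄ x hx).1
    omega
  have hc₁ {x y} := @connIn_of_chainConnected u (S p.1) p.1 h₁ (fun x hx => (h₃ x hx).1.2)
    (fun x hx => ⟨x, hx, rfl⟩) x y
  have hc₂ {x y} := @connIn_of_chainConnected u (S p.2) p.2 h₂ (fun x hx => (h₄ x hx).2)
    (fun x hx => ⟨x, hx, rfl⟩) x y
  rcases h with ⟨h₁, h₂, h₃, h₄⟩ | ⟨h₁, h₂, h₃, h₄⟩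
  · exact ⟨S p.1, S p.2, hdisj, hu₁, hu₂, hc₁ h₁ h₂, hc₂ h₃ h₄⟩
  · exact ⟨S p.2, S p.1, fun z h h' => hdisj z h' h, hu₂, hu₁, hc₂ h₁ h₂, hc₁ h₃ h₄⟩

theorem hasLinkages_cubeGraph_four : HasLinkages (cubeGraph 4) 5 := by
  classical
  intro κ _ T hT hcard
  have card_univ' : #(univ : Finset (Fin 4 → Bool)) = 16 := by simp
  have single {k x y} (h : #(T k) ≤ 1) (hx : x ∈ T k) (hy : y ∈ T k) :
      ConnIn (cubeGraph 4) (T k) x y := by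
    rw [card_le_one.1 h x hx y hy]
    exact .refl hy
  by_cases h₁ : ∃ k, 2 ≤ #(T k)
  swap
  · exact ⟨fun k => T k, fun k l x => hT.disj k l x, fun k x hx y hy =>
      single (by push Not at h₁; have := h₁ k; omega) hx hy⟩
  obtain ⟨k₁, hk₁⟩ := h₁
  obtain ⟨s₁, t₁, -, hst₁⟩ := card_eq_two.1 (le_antisymm (hT.card_le k₁) hk₁)
  have hsum₁ := add_sum_erase univ (fun k => #(T k)) (mem_univ k₁)
  by_cases h₂ : ∃ k, k ≠ k₁ ∧ 2 ≤ #(T k)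
  · obtain ⟨k₂, hk₂₁, hk₂⟩ := h₂
    obtain ⟨s₂, t₂, -, hst₂⟩ := card_eq_two.1 (le_antisymm (hT.card_le k₂) hk₂)
    have hsum₂ := add_sum_erase (univ.erase k₁) (fun k => #(T k)) (mem_erase.2 ⟨hk₂₁, mem_univ k₂⟩)
    have hne {x y} (hx : x ∈ T k₁) (hy : y ∈ T k₂) : x ≠ y := by
      rintro rfl
      exact hk₂₁ (hT.disj _ _ _ hy hx)
    obtain ⟨u, hu₁, hu₂, hu⟩ : ∃ u, u ∉ T k₁ ∧ u ∉ T k₂ ∧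
        ∀ k, k ≠ k₁ → k ≠ k₂ → T k ⊆ {u} := by
      by_cases h₃ : ∃ k, k ≠ k₁ ∧ k ≠ k₂ ∧ (T k).Nonempty
      · obtain ⟨k₃, h₃₁, h₃₂, u, hu⟩ := h₃
        refine ⟨u, fun h => h₃₁ (hT.disj _ _ _ hu h), fun h => h₃₂ (hT.disj _ _ _ hu h),
          fun k hk₁ hk₂ x hx => mem_singleton.2 ?_⟩
        have h := card_le_one.1 ((card_biUnion_le (s := (univ.erase k₁).erase k₂) (t := T)).trans
          (show _ ≤ 1 by omega))
        exact h x (mem_biUnion.2 ⟨k, by simp [hk₁, hk₂], hx⟩) u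
          (mem_biUnion.2 ⟨k₃, by simp [h₃₁, h₃₂], hu⟩)
      · push Not at h₃
        obtain ⟨u, -, hu⟩ := exists_mem_notMem_of_card_lt_card (s := T k₁ ∪ T k₂) (t := univ) (by
          have := card_union_le (T k₁) (T k₂)
          have := hT.card_le k₁
          have := hT.card_le k₂
          omega)
        simp only [mem_union, not_or] at hu
        exact ⟨u, hu.1, hu.2, fun k h h' => by simp [h₃ k h h']⟩
    have hs₁ : s₁ ∈ T k₁ := by simp [hst₁]
    have ht₁ : t₁ ∈ T k₁ := by simp [hst₁]
    have hs₂ : s₂ ∈ T k₂ := by simp [hst₂]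
    have ht₂ : t₂ ∈ T k₂ := by simp [hst₂]
    obtain ⟨C₁, C₂, hC, huC₁, huC₂, hc₁, hc₂⟩ := exists_connIn_cubeGraph_four
      (ne_of_mem_of_not_mem hs₁ hu₁) (ne_of_mem_of_not_mem ht₁ hu₁) (ne_of_mem_of_not_mem hs₂ hu₂)
      (ne_of_mem_of_not_mem ht₂ hu₂) (hne hs₁ hs₂) (hne hs₁ ht₂) (hne ht₁ hs₂) (hne ht₁ ht₂)
    refine ⟨fun k => if k = k₁ then C₁ else if k = k₂ then C₂ else T k, fun k l x hk hl => ?_,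
      fun k x hx y hy => ?_⟩
    · have := hT.disj k l x
      have hu' {k} (h : k ≠ k₁) (h' : k ≠ k₂) (hx : x ∈ T k) : x = u := by simpa using hu k h h' hx
      dsimp only at hk hl
      split_ifs at hk hl with h1 h2 h3 h4 h5 h6 h7 h8
      · rw [h1, h2]
      · exact absurd hl (hC x hk)
      · exact absurd (hu' h2 h3 hl ▸ hk) huC₁
      · exact absurd hk (hC x hl)
      · rw [h4, h6]
      · exact absurd (hu' h5 h6 hl ▸ hk) huC₂
      · exact absurd (hu' h1 h4 hk ▸ hl) huC₁
      · exact absurd (hu' h1 h4 hk ▸ hl) huC₂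
      · exact this hk hl
    · dsimp only
      by_cases h : k = k₁
      · subst h
        rw [hst₁, mem_insert, mem_singleton] at hx hy
        rw [if_pos rfl]
        rcases hx with rfl | rfl <;> rcases hy with rfl | rfl
        exacts [.refl hc₁.left_mem, hc₁, hc₁.symm, .refl hc₁.right_mem]
      by_cases h' : k = k₂
      · subst h'
        rw [hst₂, mem_insert, mem_singleton] at hx hy
        rw [if_neg h, if_pos rfl]
        rcases hx with rfl | rfl <;> rcases hy with rfl | rfl
        exacts [.refl hc₂.left_mem, hc₂, hc₂.symm, .refl hc₂.right_mem]
      · rw [if_neg h, if_neg h']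
        exact single ((card_le_card (hu k h h')).trans (by simp)) hx hy
  · push Not at h₂
    obtain ⟨F, hF, hFT, hF3⟩ := exists_subsuperset_card_eq
      (s := (univ.erase k₁).biUnion T) (t := univ \ T k₁) (n := 3) (by
        intro x hx
        obtain ⟨k, hk, hxk⟩ := mem_biUnion.1 hx
        exact mem_sdiff.2 ⟨mem_univ _, fun h => ne_of_mem_erase hk (hT.disj _ _ _ hxk h)⟩)
      (card_biUnion_le.trans (by omega))
      (by
        have := card_sdiff_add_card_eq_card (subset_univ (T k₁))
        have := hT.card_le k₁
        omega)
    obtain ⟨f₁, f₂, f₃, h12, h13, h23, rfl⟩ := card_eq_three.1 hF3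
    have hne {x y} (hx : x ∈ T k₁) (hy : y ∈ ({f₁, f₂, f₃} : Finset _)) : x ≠ y := by
      rintro rfl
      exact (mem_sdiff.1 (hFT hy)).2 hx
    have hs₁ : s₁ ∈ T k₁ := by simp [hst₁]
    have ht₁ : t₁ ∈ T k₁ := by simp [hst₁]
    obtain ⟨C₁, C₂, hC, huC₁, -, hc₁, hc₂⟩ := exists_connIn_cubeGraph_four (u := f₃)
      (hne hs₁ (by simp)) (hne ht₁ (by simp)) h13 h23 (hne hs₁ (by simp)) (hne hs₁ (by simp))
      (hne ht₁ (by simp)) (hne ht₁ (by simp))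
    have hCT {k x} (hk : k ≠ k₁) (hx : x ∈ T k) : x ∉ C₁ := fun h => by
      have := hF (mem_biUnion.2 ⟨k, by simpa using hk, hx⟩)
      simp only [mem_insert, mem_singleton] at this
      rcases this with rfl | rfl | rfl
      exacts [hC _ h hc₂.left_mem, hC _ h hc₂.right_mem, huC₁ h]
    refine ⟨fun k => if k = k₁ then C₁ else T k, fun k l x hk hl => ?_, fun k x hx y hy => ?_⟩
    · dsimp only at hk hl
      split_ifs at hk hl with h1 h2 h3
      · rw [h1, h2]
      · exact absurd hk (hCT h2 hl)
      · exact absurd hl (hCT h1 hk)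
      · exact hT.disj _ _ _ hk hl
    · dsimp only
      by_cases h : k = k₁
      · subst h
        rw [hst₁, mem_insert, mem_singleton] at hx hy
        rw [if_pos rfl]
        rcases hx with rfl | rfl <;> rcases hy with rfl | rfl
        exacts [.refl hc₁.left_mem, hc₁, hc₁.symm, .refl hc₁.right_mem]
      · rw [if_neg h]
        exact single (Nat.le_of_lt_succ (h₂ k h)) hx hy

end Base

theorem hasLinkages_cubeGraph {m : ℕ} (hm : 4 ≤ m) : HasLinkages (cubeGraph m) (m + 1) := by
  induction m, hm using Nat.le_induction with
  | base => exact hasLinkages_cubeGraph_four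
  | succ m hm ih => exact ih.cubeGraph_succ (by omega)

theorem hammingDist_not {m : ℕ} (u : Fin m → Bool) : hammingDist (fun j => !u j) u = m := by
  simp [hammingDist]

theorem exists_adj_cubeGraph_notMem {m : ℕ} (u : Fin m → Bool) {F : Finset (Fin m → Bool)}
    (hF : #F < m) : ∃ x, (cubeGraph m).Adj u x ∧ x ∉ F := by
  by_contra! h
  let f (j : Fin m) : Fin m → Bool := Function.update u j (!u j)
  have hf : Function.Injective f := fun i j hij => by
    by_contra hne
    have := congrFun hij i
    simp [f, hne] at this
  have hadj (j) : (cubeGraph m).Adj u (f j) := by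
    change #{i | u i ≠ f j i} = 1
    refine card_eq_one.2 ⟨j, ?_⟩
    ext i
    by_cases hi : i = j
    · subst hi
      simp [f]
    · simp [f, hi]
  have := card_le_card_of_injOn f (s := univ) (t := F) (fun j _ => h _ (hadj j)) hf.injOn
  rw [card_univ, Fintype.card_fin] at this
  omega

/-- In a cube, any `m + 3` terminals can be linked if two of them are forbidden antipodal
vertices. -/
theorem linkable_cubeGraph_of_antipodal {m : ℕ} (hm : 5 ≤ m) {κ : Type} [Fintype κ]
    {T : κ → Finset (Fin (m + 1) → Bool)} (hT : IsConfig T) {v : Fin (m + 1) → Bool} {a b : κ}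
    (hab : a ≠ b) (ha : T a = {v}) (hb : T b = {fun i => !v i}) (hcard : ∑ k, #(T k) ≤ m + 3) :
    Linkable (cubeGraph (m + 1)) T := by
  classical
  have hG := hasLinkages_cubeGraph (show 4 ≤ m by omega)
  let Y : Finset (Fin (m + 1) → Bool) := ((univ.erase a).erase b).biUnion T
  have memY {k p} (hka : k ≠ a) (hkb : k ≠ b) (hp : p ∈ T k) : p ∈ Y :=
    mem_biUnion.2 ⟨k, by simp [hka, hkb], hp⟩
  obtain ⟨i, hi⟩ := exists_coordinate_injective Y (by
    have h1 := add_sum_erase univ (fun k => #(T k)) (mem_univ a)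
    have h2 := add_sum_erase (univ.erase a) (fun k => #(T k)) (mem_erase.2 ⟨hab.symm, mem_univ b⟩)
    have h3 : #Y ≤ _ := card_biUnion_le
    simp only [ha, hb, card_singleton] at h1 h2
    rw [Fintype.card_fin]
    omega)
  refine .of_iso (cubeIsoPrism i) ?_
  have hT' := hT.map (cubeIsoPrism i).toEquiv.toEmbedding
  have ha' : (T a).map (cubeIsoPrism i).toEquiv.toEmbedding =
      {(v i, fun j => v (i.succAbove j))} := by
    rw [ha, map_singleton]
    rfl
  have hb' : (T b).map (cubeIsoPrism i).toEquiv.toEmbedding =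
      {(!v i, fun j => !v (i.succAbove j))} := by
    rw [hb, map_singleton]
    rfl
  have hcard' : ∑ k, #((T k).map (cubeIsoPrism i).toEquiv.toEmbedding) ≤ m + 1 + 2 := by
    simpa using hcard
  have hedge (σ k l x) (hkl : k ≠ l) (hka : k ≠ a) (hkb : k ≠ b) (hla : l ≠ a) (hlb : l ≠ b)
      (hk : (σ, x) ∈ (T k).map (cubeIsoPrism i).toEquiv.toEmbedding) :
      (!σ, x) ∉ (T l).map (cubeIsoPrism i).toEquiv.toEmbedding := fun hl => by
    rw [mem_map_cubeIsoPrism] at hk hl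
    have := hi _ (memY hka hkb hk) _ (memY hla hlb hl) fun j hj => by
      obtain ⟨j, rfl⟩ := Fin.exists_succAbove_eq hj
      simp
    simpa using congrFun this i
  generalize v i = τ at ha' hb'
  have hdist := hammingDist_not fun j => v (i.succAbove j)
  have hadj : ¬(cubeGraph m).Adj (fun j => !v (i.succAbove j)) fun j => v (i.succAbove j) :=
    fun h => by
      change _ = 1 at h
      omega
  by_cases hside : ∀ σ,
      3 ≤ ∑ k, #(side (fun k => (T k).map (cubeIsoPrism i).toEquiv.toEmbedding) σ k)
  · exact linkable_prism_of_two_forbidden hG (by omega) hT' hadj hab ha' hb'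
      (fun F hF => exists_adj_cubeGraph_notMem _ (by omega)) hedge hside hcard'
  push Not at hside
  obtain ⟨σ, hσ⟩ := hside
  by_cases h : σ = τ
  · subst h
    exact linkable_prism_of_two_forbidden_of_sum_side_le hG (by omega) hT' hadj hab ha' hb'
      hedge (by omega) hcard'
  · obtain rfl : σ = !τ := by cases σ <;> cases τ <;> simp_all
    exact linkable_prism_of_two_forbidden_of_sum_side_le hG (by omega) hT'
      (fun h => hadj h.symm) hab.symm hb' (by simpa using ha')
      (fun σ k l x hkl hkb hka hlb hla => hedge σ k l x hkl hka hkb hla hlb) (by omega) hcard'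

/-- The link of a vertex of the three-dimensional cube is connected. -/
theorem connIn_cubeGraph_three (v : Fin 3 → Bool) {x y : Fin 3 → Bool}
    (hx : x ∈ ({v, fun i => !v i}ᶜ : Set (Fin 3 → Bool)))
    (hy : y ∈ ({v, fun i => !v i}ᶜ : Set (Fin 3 → Bool))) :
    ConnIn (cubeGraph 3) {v, fun i => !v i}ᶜ x y := by
  have key : ∀ v x : Fin 3 → Bool, (x ≠ v ∧ x ≠ fun i => !v i) → ∃ a b : Fin 3 → Bool,
      (a ≠ v ∧ a ≠ fun i => !v i) ∧ (b ≠ v ∧ b ≠ fun i => !v i) ∧ hammingDist x a ≤ 1 ∧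
      hammingDist a b ≤ 1 ∧ hammingDist b (Function.update v 0 (!v 0)) ≤ 1 := by
    decide +kernel
  have mem {z : Fin 3 → Bool} : z ∈ ({v, fun i => !v i}ᶜ : Set (Fin 3 → Bool)) ↔
      z ≠ v ∧ z ≠ fun i => !v i := by simp
  have step {z z' : Fin 3 → Bool} (hz : z ≠ v ∧ z ≠ fun i => !v i)
      (hz' : z' ≠ v ∧ z' ≠ fun i => !v i) (h : hammingDist z z' ≤ 1) :
      ConnIn (cubeGraph 3) {v, fun i => !v i}ᶜ z z' := by
    rcases Nat.le_one_iff_eq_zero_or_eq_one.1 h with h | h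
    · rw [hammingDist_eq_zero] at h
      exact h ▸ .refl (mem.2 hz)
    · exact .of_adj h (mem.2 hz) (mem.2 hz')
  have hub : Function.update v 0 (!v 0) ≠ v ∧ Function.update v 0 (!v 0) ≠ fun i => !v i :=
    ⟨fun h => by simpa using congrFun h 0, fun h => by simpa using congrFun h 1⟩
  suffices h : ∀ z, z ∈ ({v, fun i => !v i}ᶜ : Set (Fin 3 → Bool)) →
      ConnIn (cubeGraph 3) {v, fun i => !v i}ᶜ z (Function.update v 0 (!v 0)) from
    (h x hx).trans (h y hy).symm
  intro z hz
  obtain ⟨a, b, ha, hb, h₁, h₂, h₃⟩ := key v z (mem.1 hz)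
  exact (step (mem.1 hz) ha h₁).trans ((step ha hb h₂).trans (step hb hub h₃))

theorem ConnIn.exists_isPath_induce {V : Type} {G : SimpleGraph V} {S Z : Set V} {x y : Z}
    (h : ConnIn G S x y) (hS : S ⊆ Z) :
    ∃ p : (G.induce Z).Walk x y, p.IsPath ∧ ∀ z ∈ p.support, (z : V) ∈ S := by
  classical
  obtain ⟨w, hw⟩ := h
  refine ⟨(w.induce Z fun z hz => hS (hw z hz)).bypass, SimpleGraph.Walk.bypass_isPath _,
    fun z hz => hw z ?_⟩
  have := SimpleGraph.Walk.support_bypass_subset_support _ hz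
  rw [SimpleGraph.Walk.support_induce] at this
  simpa using this

theorem two_mul_div_le_card_compl_antipodal {n : ℕ} (hn : 3 ≤ n) (v : Fin n → Bool) :
    2 * (n / 2) ≤ Nat.card ({v, fun i => !v i}ᶜ : Set (Fin n → Bool)) := by
  have h1 : n + 2 ≤ 2 ^ n := by
    induction n, hn using Nat.le_induction with
    | base => norm_num
    | succ n hn ih =>
      have := ih fun _ => false
      rw [pow_succ]
      omega
  have h2 := Set.ncard_add_ncard_compl ({v, fun i => !v i} : Set (Fin n → Bool))
  have h3 : ({v, fun i => !v i} : Set (Fin n → Bool)).ncard ≤ 2 :=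
    (Set.ncard_insert_le _ _).trans (by simp)
  rw [Nat.card_coe_set_eq]
  simp only [Nat.card_eq_fintype_card, Fintype.card_pi, Fintype.card_bool, prod_const, card_univ,
    Fintype.card_fin] at h2
  omega

theorem exists_disjoint_connIn_link {n : ℕ} (hn : 5 ≤ n) (v : Fin n → Bool) {k : ℕ}
    (hk : k ≤ n / 2) (s t : Fin k → ({v, fun i => !v i}ᶜ : Set (Fin n → Bool)))
    (hst : Function.Injective (Sum.elim s t)) :
    ∃ C : Fin k → Set (Fin n → Bool), (∀ i j x, x ∈ C i → x ∈ C j → i = j) ∧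
      (∀ i, C i ⊆ {v, fun i => !v i}ᶜ) ∧ ∀ i, ConnIn (cubeGraph n) (C i) (s i) (t i) := by
  classical
  have hmem (z : ({v, fun i => !v i}ᶜ : Set (Fin n → Bool))) : z.1 ≠ v ∧ z.1 ≠ fun i => !v i := by
    have hz := z.2
    simpa only [Set.mem_compl_iff, Set.mem_insert_iff, Set.mem_singleton_iff, not_or] using hz
  have hne : v ≠ fun i => !v i := fun h => by simpa using congrFun h ⟨0, by omega⟩
  let T : Fin k ⊕ Bool → Finset (Fin n → Bool) :=
    Sum.elim (fun i => {(s i).1, (t i).1}) fun c => if c then {v} else {fun i => !v i}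
  have hT : IsConfig T := by
    have hs (i) := hmem (s i)
    have ht (i) := hmem (t i)
    have hss {i j} (h : (s i).1 = s j) : i = j := by
      simpa using @hst (.inl i) (.inl j) (Subtype.ext h)
    have htt {i j} (h : (t i).1 = t j) : i = j := by
      simpa using @hst (.inr i) (.inr j) (Subtype.ext h)
    have hst {i j} (h : (s i).1 = t j) : False := by
      simpa using @hst (.inl i) (.inr j) (Subtype.ext h)
    refine ⟨?_, ?_⟩
    · rintro (i | _ | _) (j | _ | _) x hi hj <;>
        simp only [T, Sum.elim_inl, Sum.elim_inr, if_true, if_false, mem_insert, mem_singleton,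
          Bool.false_eq_true] at hi hj
      · congr 1
        rcases hi with rfl | rfl <;> rcases hj with h | h
        exacts [hss h, (hst h).elim, (hst h.symm).elim, htt h]
      all_goals grind
    · rintro (i | _ | _)
      · exact card_le_two
      · simp [T]
      · simp [T]
  have hcard : ∑ K, #(T K) ≤ 2 * (n / 2) + 2 := by
    rw [Fintype.sum_sum_type, Fintype.sum_bool]
    have : ∑ i, #(T (.inl i)) ≤ ∑ i : Fin k, 2 := sum_le_sum fun i _ => card_le_two
    simp only [sum_const, card_univ, Fintype.card_fin, smul_eq_mul] at this
    simp only [T, Sum.elim_inr, if_true, Bool.false_eq_true, if_false, card_singleton] at this ⊢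
    omega
  have hlink : Linkable (cubeGraph n) T := by
    obtain rfl | hn := hn.eq_or_lt
    · exact hasLinkages_cubeGraph (by omega) _ T hT (by omega)
    · obtain ⟨m, rfl⟩ : ∃ m, n = m + 1 := ⟨n - 1, by omega⟩
      exact linkable_cubeGraph_of_antipodal (a := .inr true) (b := .inr false) (by omega) hT
        (by simp) rfl rfl (by omega)
  obtain ⟨C, hC, hCT⟩ := hlink
  have hv := (hCT (.inr true) v (by simp [T]) v (by simp [T])).left_mem
  have hv' := (hCT (.inr false) (fun i => !v i) (by simp [T]) (fun i => !v i)
    (by simp [T])).left_mem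
  refine ⟨fun i => C (.inl i), fun i j x hi hj => by simpa using hC _ _ x hi hj,
    fun i x hx hxv => ?_, fun i => hCT (.inl i) _ (by simp [T]) _ (by simp [T])⟩
  rcases hxv with rfl | rfl
  · simpa using hC _ _ _ hx hv
  · simpa using hC _ _ _ hx hv'

theorem link_linked (d : ℕ) (hd : 2 ≤ d) (hd3 : d ≠ 3) (v : Fin (d + 1) → Bool) :
    IsLinked ((cubeGraph (d + 1)).induce ({v, fun i => !(v i)}ᶜ : Set (Fin (d + 1) → Bool)))
      ((d + 1) / 2) := by
  refine ⟨two_mul_div_le_card_compl_antipodal (by omega) v, fun s t hst => ?_⟩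
  obtain ⟨C, hC, hCv, hCst⟩ : ∃ C : Fin ((d + 1) / 2) → Set (Fin (d + 1) → Bool),
      (∀ i j x, x ∈ C i → x ∈ C j → i = j) ∧ (∀ i, C i ⊆ {v, fun i => !v i}ᶜ) ∧
        ∀ i, ConnIn (cubeGraph (d + 1)) (C i) (s i) (t i) := by
    obtain rfl | hd := hd.eq_or_lt
    · exact ⟨fun _ => {v, fun i => !v i}ᶜ, fun (i j : Fin 1) _ _ _ => Subsingleton.elim i j,
        fun _ => subset_rfl, fun i => connIn_cubeGraph_three v (s i).2 (t i).2⟩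
    · exact exists_disjoint_connIn_link (by omega) v le_rfl s t hst
  choose P hP hPC using fun i => (hCst i).exists_isPath_induce (hCv i)
  exact ⟨P, hP, fun i j hij z hi hj => hij (hC i j z (hPC i z hi) (hPC j z hj))⟩
end

section
/- Let X be a set of four distinct vertices of the hypercube graph Q_3. Then X is linked in Q_3 (i.e., for every partition of X into two pairs {s_1,t_1}, {s_2,t_2} there exist two vertex-disjoint paths in Q_3, one joining s_1 to t_1 and the other joining s_2 to t_2) if and only if there is no 2-face of Q_3 containing all four vertices of X, i.e., there is no coordinate i ∈ Fin 3 and Boolean value b such that every x ∈ X satisfies x i = b. -/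
/-- The vertex of `Q_3` whose coordinates are the three lowest binary digits of `n`. -/
def cubeVertex (n : Fin 8) : Fin 3 → Bool := fun i => n.val.testBit i

theorem cubeVertex_injective : Function.Injective cubeVertex := by
  decide +kernel

theorem cubeVertex_surjective : Function.Surjective cubeVertex := by
  decide +kernel

/-- Two numbers below `8` coincide or differ in exactly one binary digit. -/
def DifferAtMostOneBit (m n : Fin 8) : Prop :=
  m.val ^^^ n.val = 0 ∨ m.val ^^^ n.val = 1 ∨ m.val ^^^ n.val = 2 ∨ m.val ^^^ n.val = 4

instance : DecidableRel DifferAtMostOneBit := fun _ _ => inferInstanceAs (Decidable (_ ∨ _))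

theorem DifferAtMostOneBit.eq_or_adj : ∀ {m n : Fin 8}, DifferAtMostOneBit m n →
    cubeVertex m = cubeVertex n ∨ (cubeGraph 3).Adj (cubeVertex m) (cubeVertex n) := by
  change ∀ {m n : Fin 8}, DifferAtMostOneBit m n →
    cubeVertex m = cubeVertex n ∨ hammingDist (cubeVertex m) (cubeVertex n) = 1
  decide +kernel

theorem DifferAtMostOneBit.exists_walk {m n : Fin 8} (h : DifferAtMostOneBit m n) :
    ∃ p : (cubeGraph 3).Walk (cubeVertex m) (cubeVertex n),
      ∀ w ∈ p.support, w = cubeVertex m ∨ w = cubeVertex n := by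
  rcases h.eq_or_adj with h | h
  · rw [← h]
    exact ⟨.nil, by simp⟩
  · exact ⟨h.toWalk, by simp⟩

theorem exists_isPath_of_differAtMostOneBit {m a b n : Fin 8} (h₁ : DifferAtMostOneBit m a)
    (h₂ : DifferAtMostOneBit a b) (h₃ : DifferAtMostOneBit b n) :
    ∃ p : (cubeGraph 3).Walk (cubeVertex m) (cubeVertex n), p.IsPath ∧
      ∀ w ∈ p.support, ∃ k ∈ [m, a, b, n], w = cubeVertex k := by
  obtain ⟨p, hp⟩ := h₁.exists_walk
  obtain ⟨q, hq⟩ := h₂.exists_walk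
  obtain ⟨r, hr⟩ := h₃.exists_walk
  refine ⟨(p.append (q.append r)).bypass, SimpleGraph.Walk.bypass_isPath _, fun w hw => ?_⟩
  have hw := SimpleGraph.Walk.support_bypass_subset_support _ hw
  simp only [SimpleGraph.Walk.mem_support_append_iff] at hw
  simp only [List.mem_cons, List.not_mem_nil, or_false, exists_eq_or_imp, exists_eq_left]
  grind

set_option synthInstance.maxSize 1000 in
/-- If two disjoint pairs do not lie on a common 2-face, they are joined by disjoint walks
of length at most three. -/
theorem exists_disjoint_steps : ∀ s t u v : Fin 8, s ≠ u → s ≠ v → t ≠ u → t ≠ v →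
    (∀ (i : Fin 3) (b : Bool), ¬ (s.val.testBit i = b ∧ t.val.testBit i = b ∧
      u.val.testBit i = b ∧ v.val.testBit i = b)) →
    ∃ a, DifferAtMostOneBit s a ∧ a ≠ u ∧ a ≠ v ∧
    ∃ b, DifferAtMostOneBit a b ∧ DifferAtMostOneBit b t ∧ b ≠ u ∧ b ≠ v ∧
    ∃ c, DifferAtMostOneBit u c ∧ c ≠ s ∧ c ≠ a ∧ c ≠ b ∧ c ≠ t ∧
    ∃ d, DifferAtMostOneBit c d ∧ DifferAtMostOneBit d v ∧
      d ≠ s ∧ d ≠ a ∧ d ≠ b ∧ d ≠ t := by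
  decide +kernel

theorem exists_disjoint_paths_of_not_coplanar {s t u v : Fin 3 → Bool}
    (hsu : s ≠ u) (hsv : s ≠ v) (htu : t ≠ u) (htv : t ≠ v)
    (h : ¬ ∃ (i : Fin 3) (b : Bool), s i = b ∧ t i = b ∧ u i = b ∧ v i = b) :
    ∃ (p : (cubeGraph 3).Walk s t) (q : (cubeGraph 3).Walk u v),
      p.IsPath ∧ q.IsPath ∧ ∀ w ∈ p.support, w ∉ q.support := by
  obtain ⟨s, rfl⟩ := cubeVertex_surjective s
  obtain ⟨t, rfl⟩ := cubeVertex_surjective t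
  obtain ⟨u, rfl⟩ := cubeVertex_surjective u
  obtain ⟨v, rfl⟩ := cubeVertex_surjective v
  rw [cubeVertex_injective.ne_iff] at hsu hsv htu htv
  obtain ⟨a, hsa, hau, hav, b, hab, hbt, hbu, hbv, c, huc, hcs, hca, hcb, hct, d, hcd, hdv,
    hds, hda, hdb, hdt⟩ := exists_disjoint_steps s t u v hsu hsv htu htv
      fun i b hb => h ⟨i, b, hb⟩
  obtain ⟨p, hp, hp'⟩ := exists_isPath_of_differAtMostOneBit hsa hab hbt
  obtain ⟨q, hq, hq'⟩ := exists_isPath_of_differAtMostOneBit huc hcd hdv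
  refine ⟨p, q, hp, hq, fun w hwp hwq => ?_⟩
  obtain ⟨k, hk, rfl⟩ := hp' w hwp
  obtain ⟨l, hl, hkl⟩ := hq' _ hwq
  obtain rfl := cubeVertex_injective hkl
  simp only [List.mem_cons, List.not_mem_nil, or_false] at hk hl
  grind

/-- The vertex of `Q_3` with value `b` at `i`, `c` at `i + 1` and `d` at `i + 2`. -/
def faceVertex (i : Fin 3) (b c d : Bool) : Fin 3 → Bool :=
  fun j => if j = i then b else if j = i + 1 then c else d

theorem filter_apply_eq_faceVertex : ∀ (i : Fin 3) (b : Bool),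
    ({x | x i = b} : Finset (Fin 3 → Bool)) =
      {faceVertex i b false false, faceVertex i b true true,
        faceVertex i b false true, faceVertex i b true false} := by
  decide +kernel

theorem card_filter_apply_eq : ∀ (i : Fin 3) (b : Bool),
    ({x | x i = b} : Finset (Fin 3 → Bool)).card = 4 := by
  decide +kernel

theorem eq_faceVertex_of_adj {i : Fin 3} {b c d : Bool} {y : Fin 3 → Bool}
    (h : (cubeGraph 3).Adj (faceVertex i b c d) y) :
    y = faceVertex i (!b) c d ∨ y = faceVertex i b (!c) d ∨ y = faceVertex i b c (!d) := by
  have key : ∀ (i : Fin 3) (b c d : Bool) (y : Fin 3 → Bool),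
      hammingDist (faceVertex i b c d) y = 1 →
      y = faceVertex i (!b) c d ∨ y = faceVertex i b (!c) d ∨ y = faceVertex i b c (!d) := by
    decide +kernel
  exact key i b c d y h

theorem faceVertex_ne_not : ∀ (i : Fin 3) (b c d : Bool),
    faceVertex i b (!c) (!d) ≠ faceVertex i b c d ∧
      faceVertex i b (!c) (!d) ≠ faceVertex i (!b) c d := by
  decide +kernel

/-- A walk between opposite corners of a 2-face that avoids the two other corners passes
through the neighbour of its start outside the face. -/
theorem faceVertex_mem_support {i : Fin 3} {b c d : Bool}
    (p : (cubeGraph 3).Walk (faceVertex i b c d) (faceVertex i b (!c) (!d)))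
    (h₁ : faceVertex i b (!c) d ∉ p.support) (h₂ : faceVertex i b c (!d) ∉ p.support) :
    faceVertex i (!b) c d ∈ p.support := by
  obtain ⟨e, he, hfst, hsnd⟩ := p.exists_boundary_dart {faceVertex i b c d} rfl
    (faceVertex_ne_not i b c d).1
  have hadj := e.adj
  rw [Set.mem_singleton_iff.mp hfst] at hadj
  have hmem := p.dart_snd_mem_support_of_mem_darts he
  rcases eq_faceVertex_of_adj hadj with h | h | h <;> rw [h] at hmem
  · exact hmem
  · exact absurd hmem h₁
  · exact absurd hmem h₂

theorem not_disjoint_walks_faceVertex {i : Fin 3} {b : Bool}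
    (p : (cubeGraph 3).Walk (faceVertex i b false false) (faceVertex i b true true))
    (q : (cubeGraph 3).Walk (faceVertex i b false true) (faceVertex i b true false)) :
    ¬ ∀ w ∈ p.support, w ∉ q.support := by
  intro h
  have hq₁ : faceVertex i (!b) false true ∈ q.support :=
    faceVertex_mem_support q (h _ p.end_mem_support) (h _ p.start_mem_support)
  have hq₂ : faceVertex i (!b) true false ∈ q.support := by
    have := faceVertex_mem_support (c := true) (d := false) q.reverse
      (by simpa using h _ p.start_mem_support) (by simpa using h _ p.end_mem_support)
    simpa using this
  obtain ⟨e, he, hfst, hsnd⟩ := p.exists_boundary_dart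
    {faceVertex i b false false, faceVertex i (!b) false false} (Or.inl rfl)
    (by simpa using faceVertex_ne_not i b false false)
  have hadj := e.adj
  have hmem := h _ (p.dart_snd_mem_support_of_mem_darts he)
  rcases hfst with hfst | hfst <;> rw [hfst] at hadj <;>
    rcases eq_faceVertex_of_adj hadj with hy | hy | hy <;>
    rw [hy] at hmem hsnd <;>
    simp_all

theorem three_cube_linked_iff (X : Finset (Fin 3 → Bool)) (hX : X.card = 4) :
    (∀ s₁ t₁ s₂ t₂ : Fin 3 → Bool, ({s₁, t₁, s₂, t₂} : Finset (Fin 3 → Bool)) = X →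
      ∃ (P₁ : (cubeGraph 3).Walk s₁ t₁) (P₂ : (cubeGraph 3).Walk s₂ t₂),
        P₁.IsPath ∧ P₂.IsPath ∧ ∀ v ∈ P₁.support, v ∉ P₂.support) ↔
      ¬ ∃ (i : Fin 3) (b : Bool), ∀ x ∈ X, x i = b := by
  constructor
  · rintro h ⟨i, b, hb⟩
    have hXface : X = ({x | x i = b} : Finset (Fin 3 → Bool)) :=
      Finset.eq_of_subset_of_card_le (fun x hx => by simpa using hb x hx)
        (by rw [hX, card_filter_apply_eq])
    obtain ⟨p, q, -, -, hpq⟩ :=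
      h _ _ _ _ ((filter_apply_eq_faceVertex i b).symm.trans hXface.symm)
    exact not_disjoint_walks_faceVertex p q hpq
  · rintro h s t u v rfl
    have hcard : ∀ a b c : Fin 3 → Bool, ({s, t, u, v} : Finset (Fin 3 → Bool)) ≠ {a, b, c} := by
      intro a b c habc
      have := Finset.card_le_three (a := a) (b := b) (c := c)
      rw [← habc] at this
      lia
    refine exists_disjoint_paths_of_not_coplanar ?_ ?_ ?_ ?_
      fun ⟨i, b, hb⟩ => h ⟨i, b, by simpa using hb⟩
    · rintro rfl
      exact hcard s t v (by grind)
    · rintro rfl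
      exact hcard s t u (by grind)
    · rintro rfl
      exact hcard s t v (by grind)
    · rintro rfl
      exact hcard s t u (by grind)
end

section
/- Let d ≥ 5 be odd and consider the hypercube graph Q_d. Let F be the set of vertices of Q_d whose 0-th coordinate is false, and for a vertex x ∈ F let π(x) denote the vertex obtained from x by changing its 0-th coordinate to true (the unique neighbour of x outside F). Let X be a set of d+1 vertices of Q_d, let ρ : X → X be a fixed-point-free involution (a pairing of the vertices of X), and let s_1 ∈ X be such that s_1 and t_1 := ρ(s_1) both lie in F. Define X_F := (X \ {s_1,t_1}) ∩ F, X_α := {x ∈ X_F : ρ(x) ∈ F and ρ(x) is adjacent to x in Q_d}, and X_β := X_F \ X_α. Then there exists an injective map ω : X_β → F such that for every x ∈ X_β: (i) either ω(x) = x, or ω(x) ∈ F and ω(x) is adjacent to x in Q_d; and (ii) neither ω(x) nor π(ω(x)) belongs to X \ {x, ρ(x)}. -/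
section FacetMatching

variable {d : ℕ}

/-- The neighbours of `x` in the hypercube along the directions other than `i0`. -/
def facetNbrs (i0 : Fin d) (x : Fin d → Bool) : Finset (Fin d → Bool) :=
  (Finset.univ.erase i0).image fun i => Function.update x i (!x i)

theorem mem_facetNbrs {i0 : Fin d} {x y : Fin d → Bool} :
    y ∈ facetNbrs i0 x ↔ ∃ i, i ≠ i0 ∧ Function.update x i (!x i) = y := by
  simp [facetNbrs]

theorem update_not_injective (x : Fin d → Bool) :
    Function.Injective fun i => Function.update x i (!x i) := by
  intro i j h
  by_contra hij
  have := congrFun h i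
  simp [Function.update_of_ne hij] at this

theorem card_facetNbrs (i0 : Fin d) (x : Fin d → Bool) :
    (facetNbrs i0 x).card + 1 = d := by
  have := i0.pos
  rw [facetNbrs, Finset.card_image_of_injective _ (update_not_injective x),
    Finset.card_erase_of_mem (Finset.mem_univ _), Finset.card_univ, Fintype.card_fin]
  omega

theorem apply_of_mem_facetNbrs {i0 : Fin d} {x y : Fin d → Bool} (h : y ∈ facetNbrs i0 x) :
    y i0 = x i0 := by
  obtain ⟨i, hi, rfl⟩ := mem_facetNbrs.1 h
  simp [Function.update_of_ne hi.symm]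

theorem adj_of_mem_facetNbrs {i0 : Fin d} {x y : Fin d → Bool} (h : y ∈ facetNbrs i0 x) :
    (cubeGraph d).Adj x y := by
  obtain ⟨i, -, rfl⟩ := mem_facetNbrs.1 h
  change hammingDist _ _ = 1
  rw [hammingDist, Finset.card_eq_one]
  refine ⟨i, ?_⟩
  ext j
  by_cases hj : j = i
  · subst hj; simp
  · simp [hj]

theorem self_notMem_facetNbrs (i0 : Fin d) (x : Fin d → Bool) : x ∉ facetNbrs i0 x :=
  fun h => (cubeGraph d).irrefl (adj_of_mem_facetNbrs h)

theorem facetNbrs_triangle_free {i0 : Fin d} {x y z : Fin d → Bool}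
    (hxy : y ∈ facetNbrs i0 x) (hxz : z ∈ facetNbrs i0 x) : z ∉ facetNbrs i0 y := by
  intro hyz
  obtain ⟨i, -, rfl⟩ := mem_facetNbrs.1 hxy
  obtain ⟨j, -, rfl⟩ := mem_facetNbrs.1 hxz
  obtain ⟨k, -, hk⟩ := mem_facetNbrs.1 hyz
  by_cases hij : i = j
  · subst hij
    exact self_notMem_facetNbrs i0 _ hyz
  · have h1 := congrFun hk i
    have h2 := congrFun hk j
    have hji : j ≠ i := fun h => hij h.symm
    by_cases hki : i = k
    · subst hki
      simp [Function.update_of_ne hji] at h2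
    · simp [Function.update_of_ne hij, Function.update_of_ne hki] at h1

/-- The neighbours `y` of `x` such that `r x` is the only element of `X` projecting to `y`. -/
def freeNbrs (i0 : Fin d) (X : Finset (Fin d → Bool)) (r : (Fin d → Bool) → (Fin d → Bool))
    (x : Fin d → Bool) : Finset (Fin d → Bool) :=
  (facetNbrs i0 x).filter fun y => ∀ z ∈ X, Function.update z i0 false = y → z = r x

theorem update_true_injOn {i0 : Fin d} {B : Finset (Fin d → Bool)}
    (hB : ∀ x ∈ B, x i0 = false) :
    Set.InjOn (fun x : Fin d → Bool => Function.update x i0 true) (B : Set (Fin d → Bool)) := by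
  intro x hx y hy h
  have := congrArg (fun z => Function.update z i0 false) h
  simp only [Function.update_idem] at this
  rwa [← hB x hx, Function.update_eq_self, hB x hx, ← hB y hy, Function.update_eq_self] at this

theorem update_false_of_apply {i0 : Fin d} {x : Fin d → Bool} (h : x i0 = false) :
    Function.update x i0 false = x := by
  rw [← h, Function.update_eq_self]

section Counting

variable {i0 : Fin d} {X B : Finset (Fin d → Bool)} {r : (Fin d → Bool) → (Fin d → Bool)}

theorem card_sdiff_columns (hBX : B ⊆ X) (hB : ∀ x ∈ B, x i0 = false)
    (hπ : ∀ x ∈ B, Function.update x i0 true ∈ X) :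
    (X \ (B ∪ B.image fun x => Function.update x i0 true)).card + 2 * B.card = X.card := by
  have hdisj : Disjoint B (B.image fun x => Function.update x i0 true) := by
    rw [Finset.disjoint_left]
    intro x hx hx'
    obtain ⟨y, -, rfl⟩ := Finset.mem_image.1 hx'
    simpa using hB _ hx
  have hsub : B ∪ (B.image fun x => Function.update x i0 true) ⊆ X :=
    Finset.union_subset hBX (by simpa [Finset.subset_iff] using hπ)
  rw [← Finset.card_sdiff_add_card_eq_card hsub, Finset.card_union_of_disjoint hdisj,
    Finset.card_image_of_injOn (update_true_injOn hB)]
  omega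

theorem facetNbrs_sdiff_freeNbrs_subset (hB : ∀ x ∈ B, x i0 = false) (x : Fin d → Bool) :
    facetNbrs i0 x \ freeNbrs i0 X r x ⊆
      ((X \ (B ∪ B.image fun x => Function.update x i0 true)).image
        fun z => Function.update z i0 false) ∪ (B ∩ facetNbrs i0 x) := by
  intro y hy
  rw [Finset.mem_sdiff, freeNbrs, Finset.mem_filter] at hy
  obtain ⟨hy, hy'⟩ := hy
  push Not at hy'
  obtain ⟨z, hzX, hzy, -⟩ := hy' hy
  rw [Finset.mem_union]
  by_cases hz : z ∈ B ∪ B.image fun x => Function.update x i0 true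
  · right
    rw [Finset.mem_inter]
    refine ⟨?_, hy⟩
    rcases Finset.mem_union.1 hz with hz | hz
    · rwa [← hzy, update_false_of_apply (hB z hz)]
    · obtain ⟨w, hw, rfl⟩ := Finset.mem_image.1 hz
      rwa [← hzy, Function.update_idem, update_false_of_apply (hB w hw)]
  · left
    exact Finset.mem_image.2 ⟨z, Finset.mem_sdiff.2 ⟨hzX, hz⟩, hzy⟩

theorem two_mul_card_le_card_freeNbrs (hX : X.card = d + 1) (hBX : B ⊆ X)
    (hB : ∀ x ∈ B, x i0 = false) (hπ : ∀ x ∈ B, Function.update x i0 true ∈ X)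
    (x : Fin d → Bool) :
    2 * B.card ≤ (freeNbrs i0 X r x).card + (B ∩ facetNbrs i0 x).card + 2 := by
  have h1 := card_sdiff_columns hBX hB hπ
  have h2 := Finset.card_le_card (facetNbrs_sdiff_freeNbrs_subset (X := X) (r := r) hB x)
  have h3 := Finset.card_union_le
    ((X \ (B ∪ B.image fun x => Function.update x i0 true)).image
        fun z => Function.update z i0 false) (B ∩ facetNbrs i0 x)
  have h4 := Finset.card_image_le (f := fun z => Function.update z i0 false)
    (s := X \ (B ∪ B.image fun x => Function.update x i0 true))
  have h5 := Finset.card_sdiff_add_card_eq_card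
    (show freeNbrs i0 X r x ⊆ facetNbrs i0 x from Finset.filter_subset _ _)
  have h6 := card_facetNbrs i0 x
  omega

theorem freeNbrs_nonempty_of_singleton (hX : X.card = d + 1) {x : Fin d → Bool} (hx : x ∈ X)
    (hx0 : x i0 = false) (hπ : Function.update x i0 true ∈ X) (hr : r x ∈ X) (hrx : r x ≠ x)
    (hrπ : Function.update x i0 true ≠ r x) : (freeNbrs i0 X r x).Nonempty := by
  by_contra hne
  rw [Finset.not_nonempty_iff_eq_empty] at hne
  have hB : ∀ y ∈ ({x} : Finset (Fin d → Bool)), y i0 = false := by simpa using hx0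
  have h1 := card_sdiff_columns (X := X) (Finset.singleton_subset_iff.2 hx) hB (by simpa using hπ)
  have h2 := facetNbrs_sdiff_freeNbrs_subset (X := X) (r := r) hB x
  rw [hne, Finset.sdiff_empty, Finset.singleton_inter_of_notMem (self_notMem_facetNbrs i0 x),
    Finset.union_empty] at h2
  set R := X \ ({x} ∪ ({x} : Finset (Fin d → Bool)).image fun x => Function.update x i0 true)
    with hR
  have h6 := card_facetNbrs i0 x
  have h4 := Finset.card_image_le (f := fun z => Function.update z i0 false) (s := R)
  have h7 := Finset.card_le_card h2
  rw [Finset.card_singleton] at h1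
  have heq := Finset.eq_of_subset_of_card_le h2 (by omega)
  have hinj : Set.InjOn (fun z => Function.update z i0 false) (R : Set (Fin d → Bool)) :=
    Finset.card_image_iff.1 (by omega)
  have hrR : r x ∈ R := by
    simp [hR, hr, hrx, hrπ.symm]
  have hy : Function.update (r x) i0 false ∈ facetNbrs i0 x := by
    rw [heq]
    exact Finset.mem_image_of_mem _ hrR
  have : Function.update (r x) i0 false ∈ freeNbrs i0 X r x := by
    refine Finset.mem_filter.2 ⟨hy, fun z hz hzy => ?_⟩
    by_cases hzR : z ∈ R
    · exact hinj hzR hrR hzy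
    · exfalso
      have hzx : Function.update z i0 false = x := by
        have : z = x ∨ z = Function.update x i0 true := by
          simpa [hR, hz, or_iff_not_imp_left] using hzR
        rcases this with rfl | rfl
        · exact update_false_of_apply hx0
        · rw [Function.update_idem, update_false_of_apply hx0]
      rw [← hzy, hzx] at hy
      exact self_notMem_facetNbrs i0 x hy
  simp [hne] at this

theorem exists_injective_mem_freeNbrs (hX : X.card = d + 1) (hBX : B ⊆ X)
    (hB : ∀ x ∈ B, x i0 = false) (hπ : ∀ x ∈ B, Function.update x i0 true ∈ X)
    (hr : ∀ x ∈ B, r x ∈ X) (hrx : ∀ x ∈ B, r x ≠ x)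
    (hrπ : ∀ x ∈ B, Function.update x i0 true ≠ r x) :
    ∃ f : B → (Fin d → Bool), Function.Injective f ∧ ∀ x : B, f x ∈ freeNbrs i0 X r x := by
  rw [← Finset.all_card_le_biUnion_card_iff_exists_injective
    (fun x : B => freeNbrs i0 X r (x : Fin d → Bool))]
  intro S
  rcases S.eq_empty_or_nonempty with rfl | ⟨x, hxS⟩
  · simp
  have hle : ∀ y ∈ S, (freeNbrs i0 X r (y : Fin d → Bool)).card ≤
      (S.biUnion fun x : B => freeNbrs i0 X r (x : Fin d → Bool)).card := fun y hy =>
    Finset.card_le_card (Finset.subset_biUnion_of_mem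
      (fun x : B => freeNbrs i0 X r (x : Fin d → Bool)) hy)
  have hcount : ∀ y : B, 2 * B.card ≤
      (freeNbrs i0 X r (y : Fin d → Bool)).card + (B ∩ facetNbrs i0 y).card + 2 := fun y =>
    two_mul_card_le_card_freeNbrs hX hBX hB hπ y
  have hsub : ∀ y : B, B ∩ facetNbrs i0 (y : Fin d → Bool) ⊆ B.erase y := fun y z hz => by
    obtain ⟨hzB, hz⟩ := Finset.mem_inter.1 hz
    refine Finset.mem_erase.2 ⟨?_, hzB⟩
    rintro rfl
    exact self_notMem_facetNbrs i0 _ hz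
  have hpos : 0 < B.card := Finset.card_pos.2 ⟨x, x.2⟩
  have herase : ∀ y : B, (B.erase (y : Fin d → Bool)).card = B.card - 1 := fun y =>
    Finset.card_erase_of_mem y.2
  have hSB : S.card ≤ B.card := by simpa using S.card_le_univ
  rcases hSB.lt_or_eq with hlt | hSB
  · have := hle x hxS
    have := hcount x
    have := Finset.card_le_card (hsub x)
    have := herase x
    omega
  have hSuniv : S = Finset.univ :=
    Finset.eq_univ_of_card S (hSB.trans (Fintype.card_coe B).symm)
  obtain h1 | h2 : B.card = 1 ∨ 2 ≤ B.card := by omega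
  · have := Finset.card_pos.2 (freeNbrs_nonempty_of_singleton hX (hBX x.2) (hB x x.2) (hπ x x.2)
      (hr x x.2) (hrx x x.2) (hrπ x x.2))
    have := hle x hxS
    omega
  by_cases hall : ∀ y : B, B ∩ facetNbrs i0 (y : Fin d → Bool) = B.erase y
  · obtain ⟨y, hyB, hyx⟩ := Finset.exists_mem_ne h2 (x : Fin d → Bool)
    have hyN : y ∈ facetNbrs i0 (x : Fin d → Bool) := by
      have : y ∈ B.erase (x : Fin d → Bool) := Finset.mem_erase.2 ⟨hyx, hyB⟩
      rw [← hall x] at this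
      exact (Finset.mem_inter.1 this).2
    have hdisj : Disjoint (freeNbrs i0 X r (x : Fin d → Bool)) (freeNbrs i0 X r y) := by
      rw [Finset.disjoint_left]
      intro z hz hz'
      exact facetNbrs_triangle_free hyN (Finset.mem_filter.1 hz).1 (Finset.mem_filter.1 hz').1
    have hunion : freeNbrs i0 X r (x : Fin d → Bool) ∪ freeNbrs i0 X r y ⊆
        S.biUnion fun x : B => freeNbrs i0 X r (x : Fin d → Bool) :=
      Finset.union_subset (fun z hz => Finset.mem_biUnion.2 ⟨x, hxS, hz⟩)
        (fun z hz => Finset.mem_biUnion.2 ⟨⟨y, hyB⟩, hSuniv ▸ Finset.mem_univ _, hz⟩)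
    have hcard := Finset.card_le_card hunion
    rw [Finset.card_union_of_disjoint hdisj] at hcard
    have hcx := hcount x
    have hcy : 2 * B.card ≤ (freeNbrs i0 X r y).card + (B ∩ facetNbrs i0 y).card + 2 :=
      hcount ⟨y, hyB⟩
    have hex := herase x
    have hey : (B.erase y).card = B.card - 1 := herase ⟨y, hyB⟩
    rw [hall] at hcx
    rw [show B ∩ facetNbrs i0 y = B.erase y from hall ⟨y, hyB⟩] at hcy
    omega
  · push Not at hall
    obtain ⟨y, hy⟩ := hall
    have hlt := Finset.card_lt_card ((hsub y).ssubset_of_ne hy)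
    have := hle y (by simp [hSuniv])
    have := hcount y
    have := herase y
    omega

end Counting

end FacetMatching

theorem omega_exists (d : ℕ) (hd : 5 ≤ d) (hodd : Odd d)
    (X : Finset (Fin d → Bool)) (hX : X.card = d + 1)
    (ρ : (Fin d → Bool) → (Fin d → Bool))
    (hρmem : ∀ x ∈ X, ρ x ∈ X) (hρinv : ∀ x ∈ X, ρ (ρ x) = x)
    (hρne : ∀ x ∈ X, ρ x ≠ x)
    (i0 : Fin d) (hi0 : (i0 : ℕ) = 0)
    (s₁ : Fin d → Bool) (hs₁ : s₁ ∈ X) (hs₁F : s₁ i0 = false) (ht₁F : ρ s₁ i0 = false) :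
    ∃ ω : (Fin d → Bool) → (Fin d → Bool),
      Set.InjOn ω {x | x ∈ X ∧ x ≠ s₁ ∧ x ≠ ρ s₁ ∧ x i0 = false ∧
        ¬((ρ x) i0 = false ∧ (cubeGraph d).Adj x (ρ x))} ∧
      ∀ x ∈ X, x ≠ s₁ → x ≠ ρ s₁ → x i0 = false →
        ¬((ρ x) i0 = false ∧ (cubeGraph d).Adj x (ρ x)) →
        (ω x) i0 = false ∧
        (ω x = x ∨ (cubeGraph d).Adj x (ω x)) ∧
        (ω x ∈ X → ω x = x ∨ ω x = ρ x) ∧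
        (Function.update (ω x) i0 true ∈ X →
          Function.update (ω x) i0 true = x ∨ Function.update (ω x) i0 true = ρ x) := by
  classical
  set B : Finset (Fin d → Bool) := X.filter fun x => x i0 = false ∧
    ¬((ρ x) i0 = false ∧ (cubeGraph d).Adj x (ρ x)) ∧
    Function.update x i0 true ∈ X ∧ Function.update x i0 true ≠ ρ x with hBdef
  have hBX : B ⊆ X := Finset.filter_subset _ _
  have hB : ∀ x ∈ B, x i0 = false ∧
      ¬((ρ x) i0 = false ∧ (cubeGraph d).Adj x (ρ x)) ∧
      Function.update x i0 true ∈ X ∧ Function.update x i0 true ≠ ρ x :=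
    fun x hx => (Finset.mem_filter.1 hx).2
  obtain ⟨f, hfinj, hf⟩ := exists_injective_mem_freeNbrs (r := ρ) hX hBX
    (fun x hx => (hB x hx).1) (fun x hx => (hB x hx).2.2.1) (fun x hx => hρmem x (hBX hx))
    (fun x hx => hρne x (hBX hx)) (fun x hx => (hB x hx).2.2.2)
  have hfN : ∀ x : B, f x ∈ facetNbrs i0 (x : Fin d → Bool) :=
    fun x => (Finset.mem_filter.1 (hf x)).1
  have hfF : ∀ x : B, f x i0 = false :=
    fun x => (apply_of_mem_facetNbrs (hfN x)).trans (hB x x.2).1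
  have hfX : ∀ x : B, ∀ z ∈ X, Function.update z i0 false = f x → z = ρ x :=
    fun x => (Finset.mem_filter.1 (hf x)).2
  have hfX' : ∀ x : B, f x ∉ X := fun x hx => by
    have h := hfX x _ hx (update_false_of_apply (hfF x))
    exact (hB x x.2).2.1 ⟨h ▸ hfF x, h ▸ adj_of_mem_facetNbrs (hfN x)⟩
  refine ⟨fun x => if h : x ∈ B then f ⟨x, h⟩ else x, ?_, ?_⟩
  · rintro x ⟨hx, -⟩ y ⟨hy, -⟩ hxy
    by_cases hxB : x ∈ B <;> by_cases hyB : y ∈ B <;> simp only [hxB, hyB, dite_true, dite_false] at hxy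
    · exact congrArg Subtype.val (hfinj hxy)
    · exact absurd (hxy ▸ hy) (hfX' ⟨x, hxB⟩)
    · exact absurd (hxy ▸ hx) (hfX' ⟨y, hyB⟩)
    · exact hxy
  · intro x hx _ _ hx0 hα
    by_cases hxB : x ∈ B
    · simp only [hxB, dite_true]
      refine ⟨hfF _, Or.inr (adj_of_mem_facetNbrs (hfN ⟨x, hxB⟩)),
        fun h => absurd h (hfX' _), fun h => Or.inr (hfX ⟨x, hxB⟩ _ h ?_)⟩
      rw [Function.update_idem, update_false_of_apply (hfF _)]
    · simp only [hxB, dite_false]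
      refine ⟨hx0, Or.inl trivial, fun _ => Or.inl trivial, fun h => Or.inr ?_⟩
      by_contra hne
      exact hxB (Finset.mem_filter.2 ⟨hx, hx0, hα, h, hne⟩)
end
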